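/- Let f be a Rademacher random multiplicative function. For ℓ ≥ 2 and T ≥ 1 define the event E_ℓ := { sup over test points x_i with X_{ℓ−1} < x_i ≤ X_ℓ of V(x_i)·√(log log x_i)/x_i ≤ T }. There exists a constant C = C(ε) > 0 such that for every T ≥ 1 and every sufficiently large ℓ (in terms of ε), ℙ(complement of E_ℓ) ≤ C·[ (√(ℓ^K)/T)^{4/ε} · 2^{−ℓ^K/ε} + T^{−1/4} ]. -/

import Mathlib

open MeasureTheory ProbabilityTheory

noncomputable section

/-- A Rademacher random multiplicative function. -/
structure IsRademacherRMF {Ω : Type*} [MeasurableSpace Ω] (μ : Measure Ω)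
    (f : Ω → ℕ → ℝ) : Prop where
  meas : ∀ n : ℕ, Measurable fun ω => f ω n
  indep : iIndepFun (m := fun _ : Nat.Primes => (inferInstance : MeasurableSpace ℝ))
    (fun (p : Nat.Primes) (ω : Ω) => f ω (p : ℕ)) μ
  prob_one : ∀ p : ℕ, p.Prime → μ {ω | f ω p = 1} = 1 / 2
  prob_neg_one : ∀ p : ℕ, p.Prime → μ {ω | f ω p = -1} = 1 / 2
  eq_zero_of_not_squarefree : ∀ (ω : Ω) (n : ℕ), ¬Squarefree n → f ω n = 0
  eq_prod_of_squarefree : ∀ (ω : Ω) (n : ℕ), Squarefree n →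
    f ω n = ∏ p ∈ n.primeFactors, f ω p

/-- The test points `x_i := ⌊exp(i^ε)⌋`. -/
def testPoint (ε : ℝ) (i : ℕ) : ℕ := ⌊Real.exp ((i : ℝ) ^ ε)⌋₊

/-- `X_ℓ := exp(2^{ℓ^K})` with `K = 1/(4ε)` (here `ℓ` is a real number). -/
def Xpt (ε ℓ : ℝ) : ℝ := Real.exp ((2 : ℝ) ^ (ℓ ^ (1 / (4 * ε))))

/-- `V(x) := ∑_{√x < p ≤ x} |∑_{m ≤ x/p} f(m)|²`, for a natural number `x`. -/
def Vrad {Ω : Type*} (f : Ω → ℕ → ℝ) (ω : Ω) (x : ℕ) : ℝ :=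
  ∑ p ∈ (Finset.Icc 1 x).filter (fun p : ℕ => Nat.Prime p ∧ Real.sqrt x < (p : ℝ)),
    (∑ m ∈ Finset.Icc 1 ⌊(x : ℝ) / (p : ℝ)⌋₊, f ω m) ^ 2

namespace RMF

/-- sign of the prime `p` in configuration `A`. -/
def chi (A : Finset ℕ) (p : ℕ) : ℝ := if p ∈ A then 1 else -1

/-- expectation: each `p ∈ s` is independently put into `A` with probability `q p`. -/
def Ex (q : ℕ → ℝ) (s : Finset ℕ) (Φ : Finset ℕ → ℝ) : ℝ :=
  ∑ A ∈ s.powerset, (∏ p ∈ A, q p) * (∏ p ∈ s \ A, (1 - q p)) * Φ A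

lemma Ex_empty (q : ℕ → ℝ) (Φ : Finset ℕ → ℝ) : Ex q ∅ Φ = Φ ∅ := by
  simp [Ex]

lemma Ex_insert (q : ℕ → ℝ) {p : ℕ} {s : Finset ℕ} (hp : p ∉ s) (Φ : Finset ℕ → ℝ) :
    Ex q (insert p s) Φ = q p * Ex q s (fun A => Φ (insert p A)) + (1 - q p) * Ex q s Φ := by
  unfold Ex
  rw [Finset.sum_powerset_insert hp, add_comm, Finset.mul_sum, Finset.mul_sum]
  congr 1
  · refine Finset.sum_congr rfl fun A hA => ?_
    have hA' := Finset.mem_powerset.1 hA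
    have hpA : p ∉ A := fun h => hp (hA' h)
    rw [Finset.prod_insert hpA]
    have : insert p s \ insert p A = s \ A := by
      ext x; simp only [Finset.mem_sdiff, Finset.mem_insert]; constructor
      · rintro ⟨h1, h2⟩; push Not at h2; exact ⟨h1.resolve_left h2.1, h2.2⟩
      · rintro ⟨h1, h2⟩; refine ⟨Or.inr h1, ?_⟩; rintro (h | h)
        · exact hp (h ▸ h1)
        · exact h2 h
    rw [this]; ring
  · refine Finset.sum_congr rfl fun A hA => ?_
    have hA' := Finset.mem_powerset.1 hA
    have hpA : p ∉ A := fun h => hp (hA' h)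
    rw [Finset.insert_sdiff_of_notMem _ hpA, Finset.prod_insert (by simp [hp])]
    ring

lemma Ex_congr (q : ℕ → ℝ) {s : Finset ℕ} {Φ Ψ : Finset ℕ → ℝ} (h : ∀ A ⊆ s, Φ A = Ψ A) :
    Ex q s Φ = Ex q s Ψ :=
  Finset.sum_congr rfl fun A hA => by rw [h A (Finset.mem_powerset.1 hA)]

lemma Ex_add (q : ℕ → ℝ) (s : Finset ℕ) (Φ Ψ : Finset ℕ → ℝ) :
    Ex q s (fun A => Φ A + Ψ A) = Ex q s Φ + Ex q s Ψ := by
  simp [Ex, mul_add, Finset.sum_add_distrib]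

lemma Ex_const_mul (q : ℕ → ℝ) (s : Finset ℕ) (c : ℝ) (Φ : Finset ℕ → ℝ) :
    Ex q s (fun A => c * Φ A) = c * Ex q s Φ := by
  simp only [Ex, Finset.mul_sum]; exact Finset.sum_congr rfl fun _ _ => by ring

lemma Ex_neg (q : ℕ → ℝ) (s : Finset ℕ) (Φ : Finset ℕ → ℝ) :
    Ex q s (fun A => - Φ A) = - Ex q s Φ := by
  simp [Ex]

lemma Ex_sub (q : ℕ → ℝ) (s : Finset ℕ) (Φ Ψ : Finset ℕ → ℝ) :
    Ex q s (fun A => Φ A - Ψ A) = Ex q s Φ - Ex q s Ψ := by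
  simp [Ex, mul_sub, Finset.sum_sub_distrib]

lemma Ex_sum {ι : Type*} (q : ℕ → ℝ) (s : Finset ℕ) (t : Finset ι) (Φ : ι → Finset ℕ → ℝ) :
    Ex q s (fun A => ∑ i ∈ t, Φ i A) = ∑ i ∈ t, Ex q s (Φ i) := by
  simp only [Ex, Finset.mul_sum]; rw [Finset.sum_comm]

lemma Ex_one (q : ℕ → ℝ) (s : Finset ℕ) : Ex q s (fun _ => 1) = 1 := by
  induction s using Finset.induction_on with
  | empty => simp [Ex_empty]
  | insert p s hp ih => rw [Ex_insert q hp, ih]; ring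

lemma Ex_const (q : ℕ → ℝ) (s : Finset ℕ) (c : ℝ) : Ex q s (fun _ => c) = c := by
  have := Ex_const_mul q s c (fun _ => 1)
  rw [Ex_one] at this; simpa using this

/-- probability vector -/
def IsP (q : ℕ → ℝ) : Prop := ∀ p, 0 ≤ q p ∧ q p ≤ 1

lemma Ex_mono {q : ℕ → ℝ} (hq : IsP q) {s : Finset ℕ} {Φ Ψ : Finset ℕ → ℝ}
    (h : ∀ A ⊆ s, Φ A ≤ Ψ A) : Ex q s Φ ≤ Ex q s Ψ := by
  refine Finset.sum_le_sum fun A hA => ?_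
  refine mul_le_mul_of_nonneg_left (h A (Finset.mem_powerset.1 hA)) ?_
  refine mul_nonneg (Finset.prod_nonneg fun p _ => (hq p).1) (Finset.prod_nonneg fun p _ => ?_)
  linarith [(hq p).2]

lemma Ex_nonneg {q : ℕ → ℝ} (hq : IsP q) {s : Finset ℕ} {Φ : Finset ℕ → ℝ}
    (h : ∀ A ⊆ s, 0 ≤ Φ A) : 0 ≤ Ex q s Φ := by
  have := Ex_mono hq (s := s) (Φ := fun _ => 0) (Ψ := Φ) h
  rwa [Ex_const] at this

/-- conditional expectation over a single coordinate -/
lemma Ex_coord (q : ℕ → ℝ) {p : ℕ} {s : Finset ℕ} (hp : p ∈ s) (Φ : Finset ℕ → ℝ) :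
    Ex q s Φ = Ex q s (fun A => q p * Φ (insert p A) + (1 - q p) * Φ (A.erase p)) := by
  obtain ⟨s', hs', rfl⟩ : ∃ s', p ∉ s' ∧ s = insert p s' :=
    ⟨s.erase p, by simp, by simp [Finset.insert_erase hp]⟩
  rw [Ex_insert q hs', Ex_insert q hs']
  have h1 : Ex q s' (fun A => q p * Φ (insert p (insert p A)) +
      (1 - q p) * Φ ((insert p A).erase p)) =
      q p * Ex q s' (fun A => Φ (insert p A)) + (1 - q p) * Ex q s' Φ := by
    rw [← Ex_const_mul, ← Ex_const_mul, ← Ex_add]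
    refine Ex_congr q fun A hA => ?_
    have : p ∉ A := fun h => hs' (hA h)
    simp [this]
  have h2 : Ex q s' (fun A => q p * Φ (insert p A) +
      (1 - q p) * Φ (A.erase p)) =
      q p * Ex q s' (fun A => Φ (insert p A)) + (1 - q p) * Ex q s' Φ := by
    rw [← Ex_const_mul, ← Ex_const_mul, ← Ex_add]
    refine Ex_congr q fun A hA => ?_
    have : p ∉ A := fun h => hs' (hA h)
    simp [this]
  rw [h1, h2]; ring

lemma chi_insert_self (A : Finset ℕ) (p : ℕ) : chi (insert p A) p = 1 := by simp [chi]
lemma chi_erase_self (A : Finset ℕ) (p : ℕ) : chi (A.erase p) p = -1 := by simp [chi]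
lemma chi_insert_ne (A : Finset ℕ) {p r : ℕ} (h : r ≠ p) : chi (insert p A) r = chi A r := by
  simp [chi, h]
lemma chi_erase_ne (A : Finset ℕ) {p r : ℕ} (h : r ≠ p) : chi (A.erase p) r = chi A r := by
  simp [chi, h]
lemma chi_sq (A : Finset ℕ) (p : ℕ) : chi A p ^ 2 = 1 := by unfold chi; split_ifs <;> norm_num
lemma chi_mul_self (A : Finset ℕ) (p : ℕ) : chi A p * chi A p = 1 := by
  unfold chi; split_ifs <;> norm_num
lemma chi_abs (A : Finset ℕ) (p : ℕ) : |chi A p| = 1 := by unfold chi; split_ifs <;> norm_num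
lemma chi_cases (A : Finset ℕ) (p : ℕ) : chi A p = 1 ∨ chi A p = -1 := by
  unfold chi; split_ifs <;> simp

/-- `Φ` does not depend on the coordinate `p`. -/
def Indep (p : ℕ) (Φ : Finset ℕ → ℝ) : Prop :=
  ∀ A, Φ (insert p A) = Φ A ∧ Φ (A.erase p) = Φ A

/-- general one-coordinate factorisation -/
lemma Ex_coord_mul (q : ℕ → ℝ) {p : ℕ} {s : Finset ℕ} (hp : p ∈ s) (g : ℝ → ℝ)
    {Φ : Finset ℕ → ℝ} (hΦ : Indep p Φ) :
    Ex q s (fun A => g (chi A p) * Φ A) = (q p * g 1 + (1 - q p) * g (-1)) * Ex q s Φ := by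
  rw [Ex_coord q hp, ← Ex_const_mul]
  refine Ex_congr q fun A _ => ?_
  simp only [chi_insert_self, chi_erase_self, (hΦ A).1, (hΦ A).2]; ring

lemma Ex_centered (q : ℕ → ℝ) {p : ℕ} {s : Finset ℕ} (hp : p ∈ s)
    {Φ : Finset ℕ → ℝ} (hΦ : Indep p Φ) :
    Ex q s (fun A => (chi A p - (2 * q p - 1)) * Φ A) = 0 := by
  rw [Ex_coord_mul q hp (fun x => x - (2 * q p - 1)) hΦ]; ring

lemma Ex_prod (q : ℕ → ℝ) (s : Finset ℕ) (g : ℕ → ℝ → ℝ) :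
    Ex q s (fun A => ∏ p ∈ s, g p (chi A p)) = ∏ p ∈ s, (q p * g p 1 + (1 - q p) * g p (-1)) := by
  induction s using Finset.induction_on with
  | empty => simp [Ex_empty]
  | insert p s hp ih =>
    rw [Ex_insert q hp, Finset.prod_insert hp, ← ih]
    have h1 : Ex q s (fun A => ∏ r ∈ insert p s, g r (chi (insert p A) r)) =
        g p 1 * Ex q s (fun A => ∏ r ∈ s, g r (chi A r)) := by
      rw [← Ex_const_mul]
      refine Ex_congr q fun A _ => ?_
      rw [Finset.prod_insert hp, chi_insert_self]
      congr 1
      exact Finset.prod_congr rfl fun r hr => by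
        rw [chi_insert_ne A (show r ≠ p from fun h => hp (h ▸ hr))]
    have h2 : Ex q s (fun A => ∏ r ∈ insert p s, g r (chi A r)) =
        g p (-1) * Ex q s (fun A => ∏ r ∈ s, g r (chi A r)) := by
      rw [← Ex_const_mul]
      refine Ex_congr q fun A hA => ?_
      rw [Finset.prod_insert hp]
      congr 2
      simp [chi, show p ∉ A from fun h => hp (hA h)]
    rw [h1, h2]; ring

/-- change of measure from the uniform to the tilted one -/
lemma Ex_tilt (s : Finset ℕ) (w : ℕ → ℝ → ℝ) (hw : ∀ p ∈ s, w p 1 + w p (-1) = 2)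
    (Φ : Finset ℕ → ℝ) :
    Ex (fun _ => 1 / 2) s (fun A => (∏ p ∈ s, w p (chi A p)) * Φ A) =
      Ex (fun p => w p 1 / 2) s Φ := by
  unfold Ex
  refine Finset.sum_congr rfl fun A hA => ?_
  have hA' := Finset.mem_powerset.1 hA
  rw [← mul_assoc]; congr 1
  rw [← Finset.prod_sdiff hA']
  have h1 : ∏ p ∈ A, w p (chi A p) = ∏ p ∈ A, w p 1 :=
    Finset.prod_congr rfl fun p hp => by simp [chi, hp]
  have h2 : ∏ p ∈ s \ A, w p (chi A p) = ∏ p ∈ s \ A, (2 - w p 1) :=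
    Finset.prod_congr rfl fun p hp => by
      have := Finset.mem_sdiff.1 hp
      simp only [chi, this.2, if_false]; linarith [hw p this.1]
  rw [h1, h2]
  have h3 : ∏ p ∈ A, (w p 1 / 2) = (∏ p ∈ A, (1 / 2 : ℝ)) * ∏ p ∈ A, w p 1 := by
    rw [← Finset.prod_mul_distrib]; exact Finset.prod_congr rfl fun p _ => by ring
  have h4 : ∏ p ∈ s \ A, (1 - w p 1 / 2) =
      (∏ p ∈ s \ A, (1 - 1 / 2 : ℝ)) * ∏ p ∈ s \ A, (2 - w p 1) := by
    rw [← Finset.prod_mul_distrib]; exact Finset.prod_congr rfl fun p _ => by ring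
  rw [h3, h4]; ring

/-- Harris' inequality, orientation free. -/
lemma Ex_harris {q : ℕ → ℝ} (hq : IsP q) (s : Finset ℕ) :
    ∀ (Φ Ψ : Finset ℕ → ℝ), (∀ p A B, p ∉ A → p ∉ B →
      0 ≤ (Φ (insert p A) - Φ A) * (Ψ (insert p B) - Ψ B)) →
    Ex q s Φ * Ex q s Ψ ≤ Ex q s (fun A => Φ A * Ψ A) := by
  induction s using Finset.induction_on with
  | empty => intro Φ Ψ _; simp [Ex_empty]
  | insert p s hp ih =>
    intro Φ Ψ h
    rw [Ex_insert q hp, Ex_insert q hp, Ex_insert q hp]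
    have h0 := ih Φ Ψ h
    -- the functions after inserting p, made regular
    have h1 : Ex q s (fun A => Φ (insert p A)) * Ex q s (fun A => Ψ (insert p A)) ≤
        Ex q s (fun A => Φ (insert p A) * Ψ (insert p A)) := by
      refine ih (fun A => Φ (insert p A)) (fun A => Ψ (insert p A)) ?_
      intro r A B hA hB
      by_cases hr : r = p
      · subst hr; simp
      · have := h r (insert p A) (insert p B) (by simp [hr, hA]) (by simp [hr, hB])
        rwa [Finset.insert_comm r p A, Finset.insert_comm r p B] at this
    have h2 : 0 ≤ (Ex q s (fun A => Φ (insert p A)) - Ex q s Φ) *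
        (Ex q s (fun A => Ψ (insert p A)) - Ex q s Ψ) := by
      rw [← Ex_sub, ← Ex_sub]
      by_cases hpos : ∃ B ⊆ s, Ψ (insert p B) - Ψ B ≠ 0
      · obtain ⟨B, hB, hne⟩ := hpos
        have hpB : p ∉ B := fun h => hp (hB h)
        rcases lt_or_gt_of_ne hne with hlt | hgt
        · have hΦ : ∀ A ⊆ s, Φ (insert p A) - Φ A ≤ 0 := fun A hA => by
            have := h p A B (fun h => hp (hA h)) hpB
            by_contra hcon; push Not at hcon; nlinarith
          by_cases hz : ∃ A ⊆ s, Φ (insert p A) - Φ A ≠ 0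
          · obtain ⟨A, hA, hneA⟩ := hz
            have hA0 : Φ (insert p A) - Φ A < 0 := lt_of_le_of_ne (hΦ A hA) hneA
            have hΨ : ∀ B ⊆ s, Ψ (insert p B) - Ψ B ≤ 0 := fun B hB => by
              have := h p A B (fun h => hp (hA h)) (fun h => hp (hB h))
              by_contra hcon; push Not at hcon; nlinarith
            have e1 := Ex_mono hq hΦ
            have e2 := Ex_mono hq hΨ
            rw [Ex_const] at e1 e2
            exact mul_nonneg_of_nonpos_of_nonpos e1 e2
          · push Not at hz
            rw [Ex_congr q (Ψ := fun _ => 0) hz, Ex_const]; simp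
        · have hΦ : ∀ A ⊆ s, 0 ≤ Φ (insert p A) - Φ A := fun A hA => by
            have := h p A B (fun h => hp (hA h)) hpB
            by_contra hcon; push Not at hcon; nlinarith
          by_cases hz : ∃ A ⊆ s, Φ (insert p A) - Φ A ≠ 0
          · obtain ⟨A, hA, hneA⟩ := hz
            have hA0 : 0 < Φ (insert p A) - Φ A := lt_of_le_of_ne (hΦ A hA) hneA.symm
            have hΨ : ∀ B ⊆ s, 0 ≤ Ψ (insert p B) - Ψ B := fun B hB => by
              have := h p A B (fun h => hp (hA h)) (fun h => hp (hB h))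
              by_contra hcon; push Not at hcon; nlinarith
            exact mul_nonneg (Ex_nonneg hq hΦ) (Ex_nonneg hq hΨ)
          · push Not at hz
            rw [Ex_congr q (Ψ := fun _ => 0) hz, Ex_const]; simp
      · push Not at hpos
        rw [Ex_congr q (Φ := fun A => Ψ (insert p A) - Ψ A) (Ψ := fun _ => 0) hpos, Ex_const]
        simp
    have hq0 := (hq p).1
    have hq1 : 0 ≤ 1 - q p := by linarith [(hq p).2]
    have h3 := mul_nonneg (mul_nonneg hq0 hq1) h2
    have h4 := mul_le_mul_of_nonneg_left h1 hq0
    have h5 := mul_le_mul_of_nonneg_left h0 hq1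
    nlinarith

lemma exp_le_add_exp_sq (x : ℝ) : Real.exp x ≤ x + Real.exp (x ^ 2) := by
  have h1 := Real.add_one_le_exp (x ^ 2)
  rcases le_or_gt |x| 1 with h | h
  · have := (abs_le.1 (Real.abs_exp_sub_one_sub_id_le h)).2
    linarith
  · rcases lt_abs.1 h with h | h
    · have : Real.exp x ≤ Real.exp (x ^ 2) := Real.exp_le_exp.2 (by nlinarith)
      linarith
    · have : Real.exp x ≤ 1 := Real.exp_le_one_iff.2 (by linarith)
      nlinarith

/-- sub-Gaussian bound for centred linear forms. -/
lemma Ex_exp_linear {q : ℕ → ℝ} (hq : IsP q) (s : Finset ℕ) (b : ℕ → ℝ) :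
    Ex q s (fun A => Real.exp (∑ p ∈ s, b p * (chi A p - (2 * q p - 1)))) ≤
      Real.exp (4 * ∑ p ∈ s, b p ^ 2) := by
  simp only [Real.exp_sum]
  rw [Ex_prod q s (fun p x => Real.exp (b p * (x - (2 * q p - 1)))), Finset.mul_sum, Real.exp_sum]
  refine Finset.prod_le_prod (fun p _ => ?_) (fun p _ => ?_)
  · have := (hq p).1; have : 0 ≤ 1 - q p := by linarith [(hq p).2]
    positivity
  · obtain ⟨h0, h1⟩ := hq p
    have e1 := exp_le_add_exp_sq (b p * (1 - (2 * q p - 1)))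
    have e2 := exp_le_add_exp_sq (b p * (-1 - (2 * q p - 1)))
    have e3 : Real.exp ((b p * (1 - (2 * q p - 1))) ^ 2) ≤ Real.exp (4 * b p ^ 2) := by
      apply Real.exp_le_exp.2
      have : (1 - (2 * q p - 1)) ^ 2 ≤ 4 := by nlinarith
      nlinarith [sq_nonneg (b p)]
    have e4 : Real.exp ((b p * (-1 - (2 * q p - 1))) ^ 2) ≤ Real.exp (4 * b p ^ 2) := by
      apply Real.exp_le_exp.2
      have : (-1 - (2 * q p - 1)) ^ 2 ≤ 4 := by nlinarith
      nlinarith [sq_nonneg (b p)]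
    have f1 := mul_le_mul_of_nonneg_left (e1.trans (add_le_add_right e3 _)) h0
    have f2 := mul_le_mul_of_nonneg_left (e2.trans (add_le_add_right e4 _))
      (show 0 ≤ 1 - q p by linarith)
    nlinarith

/-- second moment of centred linear forms. -/
lemma Ex_sq_linear (q : ℕ → ℝ) (s : Finset ℕ) (b : ℕ → ℝ) :
    Ex q s (fun A => (∑ p ∈ s, b p * (chi A p - (2 * q p - 1))) ^ 2) =
      ∑ p ∈ s, b p ^ 2 * (1 - (2 * q p - 1) ^ 2) := by
  have h1 : ∀ A, (∑ p ∈ s, b p * (chi A p - (2 * q p - 1))) ^ 2 =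
      ∑ p ∈ s, ∑ r ∈ s, b p * b r * ((chi A p - (2 * q p - 1)) * (chi A r - (2 * q r - 1))) := by
    intro A
    rw [sq, Finset.sum_mul_sum]
    exact Finset.sum_congr rfl fun p _ => Finset.sum_congr rfl fun r _ => by ring
  simp only [h1]
  rw [Ex_sum]
  refine Finset.sum_congr rfl fun p hp => ?_
  rw [Ex_sum, Finset.sum_eq_single p]
  · rw [Ex_const_mul]
    have := Ex_coord_mul q hp (fun x => (x - (2 * q p - 1)) * (x - (2 * q p - 1)))
      (Φ := fun _ => 1) (fun A => ⟨rfl, rfl⟩)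
    simp only [mul_one, Ex_one] at this
    rw [this]; ring
  · intro r hr hrp
    rw [Ex_const_mul, Ex_centered q hp (Φ := fun A => chi A r - (2 * q r - 1)), mul_zero]
    intro A; simp only [chi_insert_ne A hrp, chi_erase_ne A hrp, and_self]
  · intro h; exact absurd hp h

end RMF

namespace RMF

/-- centred linear form -/
def Lin (q : ℕ → ℝ) (s : Finset ℕ) (b : ℕ → ℝ) (A : Finset ℕ) : ℝ :=
  ∑ p ∈ s, b p * (chi A p - (2 * q p - 1))

lemma Lin_sub (q : ℕ → ℝ) (s : Finset ℕ) (b b' : ℕ → ℝ) (A : Finset ℕ) :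
    Lin q s (fun p => b p - b' p) A = Lin q s b A - Lin q s b' A := by
  simp [Lin, sub_mul, Finset.sum_sub_distrib]

lemma Lin_smul (q : ℕ → ℝ) (s : Finset ℕ) (c : ℝ) (b : ℕ → ℝ) (A : Finset ℕ) :
    Lin q s (fun p => c * b p) A = c * Lin q s b A := by
  simp [Lin, Finset.mul_sum, mul_assoc]

lemma Lin_insert (q : ℕ → ℝ) (s : Finset ℕ) (b : ℕ → ℝ) {p : ℕ} {A : Finset ℕ} (hp : p ∉ A) :
    Lin q s b (insert p A) = Lin q s b A + if p ∈ s then 2 * b p else 0 := by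
  have h : ∀ r ∈ s, b r * (chi (insert p A) r - (2 * q r - 1)) =
      b r * (chi A r - (2 * q r - 1)) + if r = p then 2 * b r else 0 := by
    intro r _
    by_cases hr : r = p
    · subst hr; simp [chi, hp]; ring
    · rw [chi_insert_ne A hr]; simp [hr]
  unfold Lin
  rw [Finset.sum_congr rfl h, Finset.sum_add_distrib, Finset.sum_ite_eq' s p]

lemma Lin_indep (q : ℕ → ℝ) (s : Finset ℕ) (b : ℕ → ℝ) {p : ℕ} (hb : b p = 0) :
    Indep p (Lin q s b) := by
  have key : ∀ A B : Finset ℕ, (∀ r, r ≠ p → chi A r = chi B r) → Lin q s b A = Lin q s b B := by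
    intro A B h
    refine Finset.sum_congr rfl fun r _ => ?_
    by_cases hr : r = p
    · subst hr; simp [hb]
    · rw [h r hr]
  intro A
  exact ⟨key _ _ fun r hr => chi_insert_ne A hr, key _ _ fun r hr => chi_erase_ne A hr⟩

lemma Ex_Lin_mul_zero (q : ℕ → ℝ) (s : Finset ℕ) (b : ℕ → ℝ) (Φ : Finset ℕ → ℝ)
    (h : ∀ p ∈ s, b p = 0 ∨ Indep p Φ) : Ex q s (fun A => Lin q s b A * Φ A) = 0 := by
  have : ∀ A, Lin q s b A * Φ A = ∑ p ∈ s, b p * ((chi A p - (2 * q p - 1)) * Φ A) := by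
    intro A; unfold Lin; rw [Finset.sum_mul]; exact Finset.sum_congr rfl fun _ _ => by ring
  simp only [this]
  rw [Ex_sum]
  refine Finset.sum_eq_zero fun p hp => ?_
  rw [Ex_const_mul]
  rcases h p hp with h | h
  · simp [h]
  · rw [Ex_centered q hp h, mul_zero]

lemma Ex_Lin_pos {q : ℕ → ℝ} (hq : IsP q) (s : Finset ℕ) (b : ℕ → ℝ) {C0 : ℝ}
    (hb : ∑ p ∈ s, b p ^ 2 ≤ C0) (k : ℕ) :
    Ex q s (fun A => max (Lin q s b A - 2 * Real.log (k + 2)) 0) ≤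
      Real.exp (4 * C0) / ((k : ℝ) + 2) ^ 2 := by
  have hk : (0 : ℝ) < (k : ℝ) + 2 := by positivity
  have h1 : ∀ A ⊆ s, max (Lin q s b A - 2 * Real.log (k + 2)) 0 ≤
      (1 / ((k : ℝ) + 2) ^ 2) * Real.exp (Lin q s b A) := by
    intro A _
    have : (1 / ((k : ℝ) + 2) ^ 2) * Real.exp (Lin q s b A) =
        Real.exp (Lin q s b A - 2 * Real.log (k + 2)) := by
      rw [Real.exp_sub, show 2 * Real.log ((k : ℝ) + 2) = Real.log (((k : ℝ) + 2) ^ 2) by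
        rw [Real.log_pow]; norm_num, Real.exp_log (by positivity)]; ring
    rw [this]
    refine max_le ?_ (Real.exp_pos _).le
    linarith [Real.add_one_le_exp (Lin q s b A - 2 * Real.log (k + 2))]
  refine (Ex_mono hq h1).trans ?_
  rw [Ex_const_mul]
  have h2 := Ex_exp_linear hq s b
  have h3 : Real.exp (4 * ∑ p ∈ s, b p ^ 2) ≤ Real.exp (4 * C0) :=
    Real.exp_le_exp.2 (by linarith)
  have h4 := mul_le_mul_of_nonneg_left (h2.trans h3)
    (show 0 ≤ 1 / ((k : ℝ) + 2) ^ 2 by positivity)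
  calc _ ≤ _ := h4
    _ = _ := by ring

lemma pow4_le_exp (w : ℝ) : w ^ 4 ≤ 24 * (Real.exp w + Real.exp (-w)) := by
  have h : ∀ x : ℝ, 0 ≤ x → x ^ 4 ≤ 24 * Real.exp x := by
    intro x hx
    have := Real.pow_div_factorial_le_exp x hx 4
    norm_num [Nat.factorial] at this
    linarith
  rcases le_total 0 w with hw | hw
  · linarith [h w hw, Real.exp_pos (-w)]
  · have := h (-w) (by linarith)
    have e : (-w) ^ 4 = w ^ 4 := by ring
    linarith [Real.exp_pos w]

/-- constant in the L1 lower bound -/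
def cL1 : ℝ := 1 / (36 * Real.sqrt (18 * (48 * Real.exp 4)))

lemma cL1_pos : 0 < cL1 := by unfold cL1; positivity

lemma Ex_Lin_neg_ge_one {q : ℕ → ℝ} (hq : IsP q) (s : Finset ℕ) (b : ℕ → ℝ)
    (hb : ∑ p ∈ s, b p ^ 2 = 1) (hv : ∀ p ∈ s, 1 / 9 ≤ 1 - (2 * q p - 1) ^ 2) :
    cL1 ≤ Ex q s (fun A => max (-Lin q s b A) 0) := by
  set κ := Real.sqrt (18 * (48 * Real.exp 4)) with hκ
  have hκ2 : κ ^ 2 = 18 * (48 * Real.exp 4) := Real.sq_sqrt (by positivity)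
  have hκ0 : 0 < κ := Real.sqrt_pos.2 (by positivity)
  have m1 : Ex q s (fun A => Lin q s b A) = 0 := by
    have := Ex_Lin_mul_zero q s b (fun _ => 1) (fun p _ => Or.inr fun A => ⟨rfl, rfl⟩)
    simpa using this
  have m2 : 1 / 9 ≤ Ex q s (fun A => Lin q s b A ^ 2) := by
    unfold Lin; rw [Ex_sq_linear]
    calc (1 / 9 : ℝ) = ∑ p ∈ s, b p ^ 2 * (1 / 9) := by rw [← Finset.sum_mul, hb]; ring
      _ ≤ _ := Finset.sum_le_sum fun p hp => mul_le_mul_of_nonneg_left (hv p hp) (sq_nonneg _)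
  have m4 : Ex q s (fun A => Lin q s b A ^ 4) ≤ 48 * Real.exp 4 := by
    refine (Ex_mono hq fun A _ => pow4_le_exp (Lin q s b A)).trans ?_
    rw [Ex_const_mul, Ex_add]
    have e1 := Ex_exp_linear hq s b
    have e2 := Ex_exp_linear hq s (fun p => - b p)
    simp only [neg_mul, Finset.sum_neg_distrib, neg_sq, hb] at e1 e2
    unfold Lin
    norm_num at e1 e2 ⊢
    linarith
  have h1 : ∀ A ⊆ s, (1 / 2) * ((1 / κ) * Lin q s b A ^ 2 - (1 / κ ^ 3) * Lin q s b A ^ 4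
      - Lin q s b A) ≤ max (-Lin q s b A) 0 := by
    intro A _
    set w := Lin q s b A
    have : (1 / κ) * w ^ 2 - (1 / κ ^ 3) * w ^ 4 ≤ |w| := by
      have hu : ∀ u : ℝ, 0 ≤ u → u ^ 2 - u ^ 4 ≤ u := by
        intro u hu
        rcases le_total u 1 with h | h
        · nlinarith [pow_nonneg hu 4]
        · have : u ^ 2 * 1 ≤ u ^ 2 * u ^ 2 := by gcongr; nlinarith
          nlinarith
      have := hu (|w| / κ) (by positivity)
      have e : (1 / κ) * w ^ 2 - (1 / κ ^ 3) * w ^ 4 = κ * ((|w| / κ) ^ 2 - (|w| / κ) ^ 4) := by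
        rw [div_pow, div_pow, sq_abs, show |w| ^ 4 = w ^ 4 from by
          rw [show (4 : ℕ) = 2 * 2 from rfl, pow_mul, pow_mul, sq_abs]]
        field_simp
      rw [e]
      calc _ ≤ κ * (|w| / κ) := by gcongr
        _ = _ := by field_simp
    rcases le_total 0 w with hw | hw
    · rw [abs_of_nonneg hw] at this
      exact le_trans (by linarith) (le_max_right _ _)
    · rw [abs_of_nonpos hw] at this
      exact le_trans (by linarith) (le_max_left _ _)
  refine le_trans ?_ (Ex_mono hq h1)
  rw [Ex_const_mul, Ex_sub, Ex_sub, Ex_const_mul, Ex_const_mul, m1]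
  have hc : cL1 = 1 / (36 * κ) := rfl
  rw [hc]
  have i1 : (1 / κ) * (1 / 9) ≤ (1 / κ) * Ex q s (fun A => Lin q s b A ^ 2) := by gcongr
  have i2 : (1 / κ ^ 3) * Ex q s (fun A => Lin q s b A ^ 4) ≤ (1 / κ ^ 3) * (κ ^ 2 / 18) := by
    gcongr; linarith
  have i3 : (1 / κ ^ 3) * (κ ^ 2 / 18) = 1 / (18 * κ) := by field_simp
  have i4 : (1 / κ) * (1 / 9) = 2 * (1 / (18 * κ)) := by field_simp; norm_num
  have i5 : 1 / (36 * κ) = 1 / 2 * (1 / (18 * κ)) := by field_simp; norm_num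
  linarith

lemma Ex_Lin_neg_ge {q : ℕ → ℝ} (hq : IsP q) (s : Finset ℕ) (b : ℕ → ℝ)
    (hv : ∀ p ∈ s, 1 / 9 ≤ 1 - (2 * q p - 1) ^ 2) :
    cL1 * Real.sqrt (∑ p ∈ s, b p ^ 2) ≤ Ex q s (fun A => max (-Lin q s b A) 0) := by
  set v := ∑ p ∈ s, b p ^ 2 with hvdef
  have hv0 : 0 ≤ v := Finset.sum_nonneg fun _ _ => sq_nonneg _
  rcases hv0.eq_or_lt with h | h
  · rw [← h]; simp only [Real.sqrt_zero, mul_zero]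
    exact Ex_nonneg hq fun A _ => le_max_right _ _
  · have hs : 0 < Real.sqrt v := Real.sqrt_pos.2 h
    have h1 := Ex_Lin_neg_ge_one hq s (fun p => (Real.sqrt v)⁻¹ * b p) (by
      simp only [mul_pow]; rw [← Finset.mul_sum, ← hvdef, inv_pow, Real.sq_sqrt hv0]
      field_simp) hv
    have h2 : ∀ A, max (-Lin q s (fun p => (Real.sqrt v)⁻¹ * b p) A) 0 =
        (Real.sqrt v)⁻¹ * max (-Lin q s b A) 0 := by
      intro A
      rw [Lin_smul, mul_max_of_nonneg _ _ (inv_nonneg.2 hs.le)]; simp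
    simp only [h2] at h1
    rw [Ex_const_mul, ← div_eq_inv_mul, le_div_iff₀ hs] at h1
    exact h1

/-- Data for the ballot estimate. -/
structure Ballot (q : ℕ → ℝ) (s : Finset ℕ) (b b' : ℕ → ℕ → ℝ) (C0 A : ℝ) (N : ℕ) : Prop where
  hq : IsP q
  hv : ∀ p ∈ s, 1 / 9 ≤ 1 - (2 * q p - 1) ^ 2
  hA : 1 ≤ A
  hC : 0 ≤ C0
  sign : ∀ k j p, 0 ≤ b k p * b' j p
  mart : ∀ k p, b (k + 1) p = b k p ∨ ∀ j ≤ k, b' j p = 0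
  hD : ∀ k, ∑ p ∈ s, (b (k + 1) p - b' k p) ^ 2 ≤ C0
  hN : ∀ k, ∑ p ∈ s, (b k p - b' k p) ^ 2 ≤ C0
  h0 : ∑ p ∈ s, |b 0 p| ≤ C0
  var : ∀ k : ℕ, k ≤ N → (k : ℝ) ≤ C0 * ∑ p ∈ s, b k p ^ 2 ∨ (k : ℝ) ≤ C0 * A ^ 2

open Classical in
/-- indicator of the event that the walk stays below `A` up to level `k`. -/
def Gk (q : ℕ → ℝ) (s : Finset ℕ) (b' : ℕ → ℕ → ℝ) (A : ℝ) (k : ℕ) (B : Finset ℕ) : ℝ :=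
  if ∀ j ≤ k, Lin q s (b' j) B ≤ A then 1 else 0

lemma Gk_nonneg (q s b' A k B) : 0 ≤ Gk q s b' A k B := by unfold Gk; split_ifs <;> norm_num
lemma Gk_le_one (q s b' A k B) : Gk q s b' A k B ≤ 1 := by unfold Gk; split_ifs <;> norm_num
lemma Gk_succ_le (q s b' A k B) : Gk q s b' A (k + 1) B ≤ Gk q s b' A k B := by
  unfold Gk
  split_ifs with h1 h2
  · norm_num
  · exact absurd (fun j hj => h1 j (by omega)) h2
  · norm_num
  · exact le_rfl

lemma Gk_mul_le {q : ℕ → ℝ} {s : Finset ℕ} {b' : ℕ → ℕ → ℝ} {A : ℝ} {k : ℕ} {B : Finset ℕ}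
    {g W l : ℝ} (hg0 : 0 ≤ g) (hg : g ≤ Gk q s b' A k B) :
    W * g ≤ (A + l) * g + max (W - Lin q s (b' k) B - l) 0 := by
  unfold Gk at hg
  split_ifs at hg with h
  · have h1 := h k le_rfl
    have h2 : (W - Lin q s (b' k) B - l) * g ≤ max (W - Lin q s (b' k) B - l) 0 := by
      calc _ ≤ max (W - Lin q s (b' k) B - l) 0 * g := by gcongr; exact le_max_left _ _
        _ ≤ max (W - Lin q s (b' k) B - l) 0 * 1 := by
          gcongr
        _ = _ := mul_one _
    nlinarith
  · have : g = 0 := le_antisymm hg hg0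
    subst this; simp

lemma Gk_indep {q : ℕ → ℝ} {s : Finset ℕ} {b' : ℕ → ℕ → ℝ} {A : ℝ} {k : ℕ} {p : ℕ}
    (h : ∀ j ≤ k, b' j p = 0) : Indep p (Gk q s b' A k) := by
  intro B
  have h1 : ∀ j ≤ k, Lin q s (b' j) (insert p B) = Lin q s (b' j) B :=
    fun j hj => (Lin_indep q s (b' j) (h j hj) B).1
  have h2 : ∀ j ≤ k, Lin q s (b' j) (B.erase p) = Lin q s (b' j) B :=
    fun j hj => (Lin_indep q s (b' j) (h j hj) B).2
  have e1 : (∀ j ≤ k, Lin q s (b' j) (insert p B) ≤ A) ↔ (∀ j ≤ k, Lin q s (b' j) B ≤ A) :=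
    forall₂_congr fun j hj => by rw [h1 j hj]
  have e2 : (∀ j ≤ k, Lin q s (b' j) (B.erase p) ≤ A) ↔ (∀ j ≤ k, Lin q s (b' j) B ≤ A) :=
    forall₂_congr fun j hj => by rw [h2 j hj]
  unfold Gk
  simp only [e1, e2, and_self]

lemma ballot_harris {q s b b' C0 A N} (h : Ballot q s b b' C0 A N) (k : ℕ) :
    Ex q s (Gk q s b' A k) * Ex q s (fun B => max (-Lin q s (b k) B) 0) ≤
      Ex q s (fun B => Gk q s b' A k B * max (-Lin q s (b k) B) 0) := by
  refine Ex_harris h.hq s _ _ ?_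
  intro p B B' hB hB'
  rw [Lin_insert q s (b k) hB']
  have hG : ∀ (P : Prop) , True := fun _ => trivial
  by_cases hp : p ∈ s
  swap
  · simp [hp]
  simp only [hp, if_true]
  rcases lt_trichotomy (b k p) 0 with hb | hb | hb
  · -- both increase
    have h1 : Gk q s b' A k B ≤ Gk q s b' A k (insert p B) := by
      unfold Gk
      split_ifs with i1 i2 <;> norm_num
      refine i2 fun j hj => ?_
      rw [Lin_insert q s (b' j) hB, if_pos hp]
      have : b' j p ≤ 0 := by
        by_contra hc; push Not at hc; nlinarith [h.sign k j p]
      linarith [i1 j hj]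
    have h2 : max (-Lin q s (b k) B') 0 ≤ max (-(Lin q s (b k) B' + 2 * b k p)) 0 :=
      max_le_max (by linarith) le_rfl
    exact mul_nonneg (by linarith) (by linarith)
  · rw [hb]; simp
  · have h1 : Gk q s b' A k (insert p B) ≤ Gk q s b' A k B := by
      unfold Gk
      split_ifs with i1 i2 <;> norm_num
      refine i2 fun j hj => ?_
      have h3 := i1 j hj
      rw [Lin_insert q s (b' j) hB, if_pos hp] at h3
      have : 0 ≤ b' j p := by
        by_contra hc; push Not at hc; nlinarith [h.sign k j p]
      linarith
    have h2 : max (-(Lin q s (b k) B' + 2 * b k p)) 0 ≤ max (-Lin q s (b k) B') 0 :=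
      max_le_max (by linarith) le_rfl
    exact mul_nonneg_of_nonpos_of_nonpos (by linarith) (by linarith)

/-- main recursion -/
lemma ballot_rec {q s b b' C0 A N} (h : Ballot q s b b' C0 A N) (n : ℕ) :
    - Ex q s (fun B => Lin q s (b n) B * Gk q s b' A n B) +
      (A + 2 * Real.log ((n : ℝ) + 2)) * Ex q s (Gk q s b' A n) ≤
    2 * C0 + (A + 2 * Real.log 2) +
      Real.exp (4 * C0) * (1 - 1 / ((n : ℝ) + 1)) +
      ∑ k ∈ Finset.range n, 2 / ((k : ℝ) + 2) * Ex q s (Gk q s b' A (k + 1)) := by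
  induction n with
  | zero =>
    have h1 : - Ex q s (fun B => Lin q s (b 0) B * Gk q s b' A 0 B) ≤ 2 * C0 := by
      rw [← Ex_neg]
      refine (Ex_mono h.hq (Ψ := fun _ => 2 * C0) fun B _ => ?_).trans_eq (Ex_const _ _ _)
      have h2 : |Lin q s (b 0) B| ≤ 2 * C0 := by
        unfold Lin
        refine (Finset.abs_sum_le_sum_abs _ _).trans ?_
        calc _ ≤ ∑ p ∈ s, 2 * |b 0 p| := Finset.sum_le_sum fun p _ => by
              rw [abs_mul, mul_comm]
              gcongr
              obtain ⟨q0, q1⟩ := h.hq p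
              rw [abs_le]
              rcases chi_cases B p with e | e <;> rw [e] <;> constructor <;> linarith
          _ ≤ _ := by rw [← Finset.mul_sum]; linarith [h.h0]
      have h3 := (abs_le.1 h2).1
      have := Gk_nonneg q s b' A 0 B
      have := Gk_le_one q s b' A 0 B
      nlinarith [h.hC]
    have h2 : Ex q s (Gk q s b' A 0) ≤ 1 :=
      (Ex_mono h.hq fun B _ => Gk_le_one q s b' A 0 B).trans_eq (Ex_one _ _)
    have h3 : 0 ≤ A + 2 * Real.log 2 := by have := h.hA; have := Real.log_pos one_lt_two; linarith
    simp only [Nat.cast_zero, zero_add, Finset.range_zero, Finset.sum_empty]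
    norm_num
    nlinarith
  | succ n ih =>
    rw [Finset.sum_range_succ]
    have hm : Ex q s (fun B => Lin q s (b (n + 1)) B * Gk q s b' A n B) =
        Ex q s (fun B => Lin q s (b n) B * Gk q s b' A n B) := by
      have := Ex_Lin_mul_zero q s (fun p => b (n + 1) p - b n p) (Gk q s b' A n) (by
        intro p _
        rcases h.mart n p with e | e
        · left; rw [e, sub_self]
        · right; exact Gk_indep e)
      simp only [Lin_sub, sub_mul] at this
      rw [Ex_sub] at this; linarith
    set l := 2 * Real.log ((n : ℝ) + 2) with hl
    have hstep : Ex q s (fun B => Lin q s (b (n + 1)) B * (Gk q s b' A n B - Gk q s b' A (n + 1) B))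
        ≤ (A + l) * (Ex q s (Gk q s b' A n) - Ex q s (Gk q s b' A (n + 1))) +
          Real.exp (4 * C0) / ((n : ℝ) + 2) ^ 2 := by
      have e1 : ∀ B ⊆ s, Lin q s (b (n + 1)) B * (Gk q s b' A n B - Gk q s b' A (n + 1) B) ≤
          (A + l) * (Gk q s b' A n B - Gk q s b' A (n + 1) B) +
          max (Lin q s (fun p => b (n + 1) p - b' n p) B - l) 0 := by
        intro B _
        rw [Lin_sub]
        refine Gk_mul_le (k := n) (b' := b') (q := q) (s := s) (by linarith [Gk_succ_le q s b' A n B]) ?_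
        linarith [Gk_nonneg q s b' A (n + 1) B]
      refine (Ex_mono h.hq e1).trans ?_
      rw [Ex_add, Ex_const_mul, Ex_sub]
      have := Ex_Lin_pos h.hq s _ (h.hD n) n
      linarith
    have hsplit : Ex q s (fun B => Lin q s (b (n + 1)) B * Gk q s b' A (n + 1) B) =
        Ex q s (fun B => Lin q s (b (n + 1)) B * Gk q s b' A n B) -
        Ex q s (fun B => Lin q s (b (n + 1)) B *
          (Gk q s b' A n B - Gk q s b' A (n + 1) B)) := by
      rw [← Ex_sub]; congr 1; ext B; ring
    have hh : 0 ≤ Ex q s (Gk q s b' A (n + 1)) := Ex_nonneg h.hq fun B _ => Gk_nonneg q s b' A _ B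
    have hlog : 2 * Real.log (((n + 1 : ℕ) : ℝ) + 2) ≤ l + 2 / ((n : ℝ) + 2) := by
      have : Real.log (((n + 1 : ℕ) : ℝ) + 2) - Real.log ((n : ℝ) + 2) ≤ 1 / ((n : ℝ) + 2) := by
        rw [← Real.log_div (by positivity) (by positivity)]
        refine (Real.log_le_sub_one_of_pos (by positivity)).trans_eq ?_
        push_cast; field_simp; ring
      have e : 2 / ((n : ℝ) + 2) = 2 * (1 / ((n : ℝ) + 2)) := by ring
      rw [hl, e]; linarith
    have htel : Real.exp (4 * C0) / ((n : ℝ) + 2) ^ 2 ≤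
        Real.exp (4 * C0) * (1 - 1 / (((n + 1 : ℕ) : ℝ) + 1)) -
        Real.exp (4 * C0) * (1 - 1 / ((n : ℝ) + 1)) := by
      rw [← mul_sub, div_eq_mul_one_div]
      gcongr
      push_cast
      rw [show (1 - 1 / ((n : ℝ) + 1 + 1)) - (1 - 1 / ((n : ℝ) + 1)) =
        1 / (((n : ℝ) + 1) * ((n : ℝ) + 2)) by field_simp; ring]
      apply one_div_le_one_div_of_le (by positivity)
      nlinarith [show (0 : ℝ) ≤ n from Nat.cast_nonneg n]
    have hfin : 2 * Real.log (((n + 1 : ℕ) : ℝ) + 2) * Ex q s (Gk q s b' A (n + 1)) ≤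
        (l + 2 / ((n : ℝ) + 2)) * Ex q s (Gk q s b' A (n + 1)) := by gcongr
    rw [hsplit, hm]
    nlinarith

lemma ballot_step {q s b b' C0 A N} (h : Ballot q s b b' C0 A N) (n : ℕ) :
    cL1 * Real.sqrt (∑ p ∈ s, b n p ^ 2) * Ex q s (Gk q s b' A n) ≤
    2 * C0 + A + 2 + 2 * Real.exp (4 * C0) +
      ∑ k ∈ Finset.range n, 2 / ((k : ℝ) + 2) * Ex q s (Gk q s b' A (k + 1)) := by
  have h1 := ballot_harris h n
  have h2 := Ex_Lin_neg_ge h.hq s (b n) h.hv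
  have h3 : 0 ≤ Ex q s (Gk q s b' A n) := Ex_nonneg h.hq fun B _ => Gk_nonneg q s b' A _ B
  have h4 := mul_le_mul_of_nonneg_right h2 h3
  have h5 : Ex q s (fun B => Gk q s b' A n B * max (-Lin q s (b n) B) 0) =
      Ex q s (fun B => max (Lin q s (b n) B) 0 * Gk q s b' A n B) -
      Ex q s (fun B => Lin q s (b n) B * Gk q s b' A n B) := by
    rw [← Ex_sub]; congr 1; ext B
    rcases le_total 0 (Lin q s (b n) B) with e | e
    · rw [max_eq_right (by linarith), max_eq_left e]; ring
    · rw [max_eq_left (by linarith), max_eq_right e]; ring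
  have h6 : Ex q s (fun B => max (Lin q s (b n) B) 0 * Gk q s b' A n B) ≤
      (A + 2 * Real.log ((n : ℝ) + 2)) * Ex q s (Gk q s b' A n) +
        Real.exp (4 * C0) / ((n : ℝ) + 2) ^ 2 := by
    have hl : 0 ≤ Real.log ((n : ℝ) + 2) :=
      Real.log_nonneg (by linarith [show (0 : ℝ) ≤ n from Nat.cast_nonneg n])
    have e1 : ∀ B ⊆ s, max (Lin q s (b n) B) 0 * Gk q s b' A n B ≤
        (A + 2 * Real.log ((n : ℝ) + 2)) * Gk q s b' A n B +
        max (Lin q s (fun p => b n p - b' n p) B - 2 * Real.log ((n : ℝ) + 2)) 0 := by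
      intro B _
      have g0 := Gk_nonneg q s b' A n B
      rcases le_total 0 (Lin q s (b n) B) with e | e
      · rw [max_eq_left e, Lin_sub]
        exact Gk_mul_le g0 le_rfl
      · rw [max_eq_right e, zero_mul]
        have := h.hA
        have : 0 ≤ (A + 2 * Real.log ((n : ℝ) + 2)) * Gk q s b' A n B :=
          mul_nonneg (by linarith) g0
        exact add_nonneg this (le_max_right _ _)
    refine (Ex_mono h.hq e1).trans ?_
    rw [Ex_add, Ex_const_mul]
    have := Ex_Lin_pos h.hq s _ (h.hN n) n
    linarith
  have h7 := ballot_rec h n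
  have h8 : Real.exp (4 * C0) / ((n : ℝ) + 2) ^ 2 ≤ Real.exp (4 * C0) := by
    apply div_le_self (Real.exp_pos _).le
    nlinarith [show (0 : ℝ) ≤ n from Nat.cast_nonneg n]
  have h9 : Real.exp (4 * C0) * (1 - 1 / ((n : ℝ) + 1)) ≤ Real.exp (4 * C0) := by
    have : 0 ≤ 1 / ((n : ℝ) + 1) := by positivity
    nlinarith [Real.exp_pos (4 * C0)]
  have h10 : Real.log 2 ≤ 1 := by linarith [Real.log_two_lt_d9]
  rw [mul_comm (Ex q s (Gk q s b' A n))] at h1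
  linarith

theorem ballot_main (C0 : ℝ) : ∃ C : ℝ, 0 < C ∧ ∀ q s b b' A, ∀ n : ℕ, 1 ≤ n →
    Ballot q s b b' C0 A n → Ex q s (Gk q s b' A n) ≤ C * A / Real.sqrt n := by
  set K := 2 * C0 + 2 + 2 * Real.exp (4 * C0) + 1 with hK
  set C' := Real.sqrt C0 / cL1 + Real.sqrt C0 with hC'
  have hC'0 : 0 ≤ C' := by have := cL1_pos; positivity
  set Z := ∑' k : ℕ, 1 / (k : ℝ) ^ (3 / 2 : ℝ) with hZ
  have hsum : Summable fun k : ℕ => 1 / (k : ℝ) ^ (3 / 2 : ℝ) :=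
    Real.summable_one_div_nat_rpow.2 (by norm_num)
  refine ⟨C' * (Real.exp (2 * C' * Z) * (|K| + 1)) + 1, by positivity, ?_⟩
  intro q s b b' A n hn h
  set hh : ℕ → ℝ := fun k => Ex q s (Gk q s b' A k) with hhdef
  have hh0 : ∀ k, 0 ≤ hh k := fun k => Ex_nonneg h.hq fun B _ => Gk_nonneg q s b' A _ B
  have hh1 : ∀ k, hh k ≤ 1 := fun k =>
    (Ex_mono h.hq fun B _ => Gk_le_one q s b' A k B).trans_eq (Ex_one _ _)
  have hC0 := h.hC
  have hA := h.hA
  have hKpos : 0 < K := by positivity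
  -- S (n) for level n+1
  set S : ℕ → ℝ := fun n => K + A + ∑ k ∈ Finset.range n, 2 / ((k : ℝ) + 2) * hh (k + 1) with hS
  have hSA : ∀ n, K + A ≤ S n := fun n => by
    have : 0 ≤ ∑ k ∈ Finset.range n, 2 / ((k : ℝ) + 2) * hh (k + 1) :=
      Finset.sum_nonneg fun k _ => mul_nonneg (by positivity) (hh0 _)
    simp only [hS]; linarith
  have key : ∀ m : ℕ, m + 1 ≤ n → hh (m + 1) ≤ C' * S m / Real.sqrt ((m : ℝ) + 1) := by
    intro m hmn
    have hm : (0 : ℝ) < (m : ℝ) + 1 := by positivity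
    have hs : 0 < Real.sqrt ((m : ℝ) + 1) := Real.sqrt_pos.2 hm
    have hSm : 0 ≤ S m := by linarith [hSA m]
    rw [le_div_iff₀ hs]
    rcases h.var (m + 1) hmn with e | e
    · have h1 := ballot_step h (m + 1)
      rw [Finset.sum_range_succ] at h1
      have h2 : 2 / ((m : ℝ) + 2) * hh (m + 1) ≤ 1 := by
        have : 2 / ((m : ℝ) + 2) ≤ 1 := by
          rw [div_le_one (by positivity)]; linarith [show (0 : ℝ) ≤ m from Nat.cast_nonneg m]
        nlinarith [hh0 (m + 1), hh1 (m + 1)]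
      have h3 : cL1 * Real.sqrt (∑ p ∈ s, b (m + 1) p ^ 2) * hh (m + 1) ≤ S m := by
        simp only [hS, hK]; linarith
      have h4 : Real.sqrt ((m : ℝ) + 1) ≤
          Real.sqrt C0 * Real.sqrt (∑ p ∈ s, b (m + 1) p ^ 2) := by
        rw [← Real.sqrt_mul hC0]; apply Real.sqrt_le_sqrt; push_cast at e; exact e
      have hc := cL1_pos
      calc hh (m + 1) * Real.sqrt ((m : ℝ) + 1) ≤
          hh (m + 1) * (Real.sqrt C0 * Real.sqrt (∑ p ∈ s, b (m + 1) p ^ 2)) := by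
            gcongr; exact hh0 _
        _ = Real.sqrt C0 / cL1 * (cL1 * Real.sqrt (∑ p ∈ s, b (m + 1) p ^ 2) * hh (m + 1)) := by
            field_simp
        _ ≤ Real.sqrt C0 / cL1 * S m := by gcongr
        _ ≤ C' * S m := by
            gcongr; rw [hC']; linarith [Real.sqrt_nonneg C0]
    · have h4 : Real.sqrt ((m : ℝ) + 1) ≤ Real.sqrt C0 * A := by
        rw [← Real.sqrt_sq (show 0 ≤ A by linarith), ← Real.sqrt_mul hC0]
        apply Real.sqrt_le_sqrt; push_cast at e; exact e
      calc hh (m + 1) * Real.sqrt ((m : ℝ) + 1) ≤ 1 * (Real.sqrt C0 * A) := by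
            gcongr; exact hh1 _
        _ ≤ C' * S m := by
            rw [one_mul]
            have : Real.sqrt C0 ≤ C' := by
              rw [hC']; have := cL1_pos
              have : 0 ≤ Real.sqrt C0 / cL1 := by positivity
              linarith
            gcongr
            linarith [hSA m]
  have gron : ∀ m : ℕ, m ≤ n → S m ≤ (K + A) *
      Real.exp (2 * C' * ∑ k ∈ Finset.range (m + 1), 1 / (k : ℝ) ^ (3 / 2 : ℝ)) := by
    intro m
    induction m with
    | zero => intro _; simp [hS]
    | succ m ih =>
      intro hmn
      have ih := ih (by omega)
      rw [Finset.sum_range_succ, mul_add, Real.exp_add, ← mul_assoc]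
      have e1 : S (m + 1) = S m + 2 / ((m : ℝ) + 2) * hh (m + 1) := by
        simp only [hS, Finset.sum_range_succ]; ring
      have hSm : 0 ≤ S m := by linarith [hSA m]
      have hm : (0 : ℝ) < (m : ℝ) + 1 := by positivity
      have e2 : 2 / ((m : ℝ) + 2) * hh (m + 1) ≤
          S m * (2 * C' * (1 / ((m + 1 : ℕ) : ℝ) ^ (3 / 2 : ℝ))) := by
        have e3 : ((m + 1 : ℕ) : ℝ) ^ (3 / 2 : ℝ) = ((m : ℝ) + 1) * Real.sqrt ((m : ℝ) + 1) := by
          push_cast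
          rw [Real.sqrt_eq_rpow, show (3 / 2 : ℝ) = 1 + 1 / 2 by norm_num, Real.rpow_add hm,
            Real.rpow_one]
        rw [e3]
        calc 2 / ((m : ℝ) + 2) * hh (m + 1) ≤
            2 / ((m : ℝ) + 1) * (C' * S m / Real.sqrt ((m : ℝ) + 1)) := by
              gcongr
              · exact hh0 _
              · linarith
              · exact key m hmn
          _ = _ := by
              have : Real.sqrt ((m : ℝ) + 1) ≠ 0 := (Real.sqrt_pos.2 hm).ne'
              field_simp
      calc S (m + 1) ≤ S m * (2 * C' * (1 / ((m + 1 : ℕ) : ℝ) ^ (3 / 2 : ℝ)) + 1) := by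
            rw [e1]; linarith
        _ ≤ S m * Real.exp (2 * C' * (1 / ((m + 1 : ℕ) : ℝ) ^ (3 / 2 : ℝ))) := by
            gcongr; exact Real.add_one_le_exp _
        _ ≤ _ := by gcongr
  obtain ⟨m, rfl⟩ : ∃ m, n = m + 1 := ⟨n - 1, by omega⟩
  have h1 := key m le_rfl
  have h2 := gron m (by omega)
  have h3 : ∑ k ∈ Finset.range (m + 1), 1 / (k : ℝ) ^ (3 / 2 : ℝ) ≤ Z :=
    hsum.sum_le_tsum _ fun k _ => by positivity
  have h4 : S m ≤ (|K| + 1) * A * Real.exp (2 * C' * Z) := by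
    refine h2.trans ?_
    have : K + A ≤ (|K| + 1) * A := by
      have := abs_of_pos hKpos; nlinarith
    gcongr
  push_cast
  refine h1.trans ?_
  have h5 : C' * S m ≤ (C' * (Real.exp (2 * C' * Z) * (|K| + 1)) + 1) * A := by
    calc C' * S m ≤ C' * ((|K| + 1) * A * Real.exp (2 * C' * Z)) :=
          mul_le_mul_of_nonneg_left h4 hC'0
      _ ≤ _ := by nlinarith
  exact div_le_div_of_nonneg_right h5 (Real.sqrt_nonneg _)

end RMF

namespace RMF

open Nat ArithmeticFunction in
/-- index set of the Selberg sieve -/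
def SD (z : ℕ) : Finset ℕ := (Finset.Icc 1 z).filter Squarefree

def SG (z : ℕ) : ℝ := ∑ k ∈ SD z, 1 / (Nat.totient k : ℝ)

def slam (z d : ℕ) : ℝ :=
  (d : ℝ) * (ArithmeticFunction.moebius d : ℝ) / SG z *
    ∑ k ∈ (SD z).filter (d ∣ ·), 1 / (Nat.totient k : ℝ)

lemma mem_SD {z k : ℕ} : k ∈ SD z ↔ (1 ≤ k ∧ k ≤ z) ∧ Squarefree k := by
  simp [SD]

lemma SG_ge_one {z : ℕ} (hz : 1 ≤ z) : 1 ≤ SG z := by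
  have h : (1 : ℕ) ∈ SD z := by rw [mem_SD]; simp [hz]
  calc (1 : ℝ) = 1 / (Nat.totient 1 : ℝ) := by simp
    _ ≤ _ := Finset.single_le_sum (f := fun k => 1 / (Nat.totient k : ℝ))
      (fun _ _ => by positivity) h

lemma slam_one {z : ℕ} (hz : 1 ≤ z) : slam z 1 = 1 := by
  have := SG_ge_one hz
  unfold slam
  simp only [one_dvd, Finset.filter_true, Nat.cast_one, ArithmeticFunction.moebius_apply_one,
    Int.cast_one, mul_one]
  change 1 / SG z * SG z = 1
  field_simp

lemma slam_abs {z : ℕ} (hz : 1 ≤ z) (d : ℕ) : |slam z d| ≤ d := by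
  have hG := SG_ge_one hz
  unfold slam
  have h1 : ∑ k ∈ (SD z).filter (d ∣ ·), 1 / (Nat.totient k : ℝ) ≤ SG z :=
    Finset.sum_le_sum_of_subset_of_nonneg (Finset.filter_subset _ _) fun _ _ _ => by positivity
  have h0 : 0 ≤ ∑ k ∈ (SD z).filter (d ∣ ·), 1 / (Nat.totient k : ℝ) :=
    Finset.sum_nonneg fun _ _ => by positivity
  have h2 : |(ArithmeticFunction.moebius d : ℝ)| ≤ 1 := by
    have := ArithmeticFunction.abs_moebius_le_one (n := d)
    exact_mod_cast this
  rw [abs_mul, abs_div, abs_mul, abs_of_nonneg h0, abs_of_pos (by linarith : 0 < SG z), Nat.abs_cast]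
  calc _ ≤ (d : ℝ) * 1 / SG z * SG z := by gcongr
    _ = d := by field_simp

lemma moebius_between {k j : ℕ} (hj : Squarefree j) (hkj : k ∣ j) :
    ∑ d ∈ j.divisors.filter (k ∣ ·), ArithmeticFunction.moebius d =
      if j = k then ArithmeticFunction.moebius k else 0 := by
  obtain ⟨e, rfl⟩ := hkj
  have hk0 : k ≠ 0 := by rintro rfl; simp at hj
  have he0 : e ≠ 0 := by rintro rfl; simp at hj
  have h1 : ∑ d ∈ (k * e).divisors.filter (k ∣ ·), ArithmeticFunction.moebius d =
      ∑ d ∈ e.divisors, ArithmeticFunction.moebius (k * d) := by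
    symm
    refine Finset.sum_bij (fun d _ => k * d) ?_ ?_ ?_ (fun _ _ => rfl)
    · intro d hd
      simp only [Finset.mem_filter, Nat.mem_divisors] at hd ⊢
      exact ⟨⟨Nat.mul_dvd_mul_left k hd.1, mul_ne_zero hk0 he0⟩, dvd_mul_right _ _⟩
    · intro a _ b _ h
      exact Nat.eq_of_mul_eq_mul_left (Nat.pos_of_ne_zero hk0) h
    · intro d hd
      simp only [Finset.mem_filter, Nat.mem_divisors] at hd
      obtain ⟨c, rfl⟩ := hd.2
      exact ⟨c, Nat.mem_divisors.2 ⟨Nat.dvd_of_mul_dvd_mul_left (Nat.pos_of_ne_zero hk0) hd.1.1, he0⟩, rfl⟩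
  have hcop : Nat.Coprime k e := (Nat.squarefree_mul_iff.1 hj).1
  have h2 : ∀ d ∈ e.divisors, ArithmeticFunction.moebius (k * d) =
      ArithmeticFunction.moebius k * ArithmeticFunction.moebius d := by
    intro d hd
    exact ArithmeticFunction.isMultiplicative_moebius.map_mul_of_coprime
      (Nat.Coprime.coprime_dvd_right (Nat.dvd_of_mem_divisors hd) hcop)
  rw [h1, Finset.sum_congr rfl h2, ← Finset.mul_sum]
  have h3 : ∑ d ∈ e.divisors, ArithmeticFunction.moebius d = if e = 1 then 1 else 0 := by
    have := congrArg (fun f : ArithmeticFunction ℤ => f e) ArithmeticFunction.moebius_mul_coe_zeta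
    simp only [ArithmeticFunction.mul_zeta_apply, ArithmeticFunction.one_apply,
      ArithmeticFunction.coe_mul_zeta_apply] at this
    exact this
  rw [h3]
  have h4 : k * e = k ↔ e = 1 := by
    constructor
    · intro h; exact Nat.eq_of_mul_eq_mul_left (Nat.pos_of_ne_zero hk0) (by omega)
    · rintro rfl; ring
  simp only [h4]
  split_ifs <;> simp

lemma slam_sum {z : ℕ} {k : ℕ} (hk : k ∈ SD z) :
    ∑ d ∈ (SD z).filter (k ∣ ·), slam z d / d =
      (ArithmeticFunction.moebius k : ℝ) / (Nat.totient k * SG z) := by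
  have h1 : ∀ d ∈ (SD z).filter (k ∣ ·), slam z d / d =
      ∑ j ∈ SD z, if d ∣ j then (1 / SG z) * (1 / (Nat.totient j : ℝ)) * (ArithmeticFunction.moebius d : ℝ)
        else 0 := by
    intro d hd
    have hd0 : (d : ℝ) ≠ 0 := by
      have := (mem_SD.1 (Finset.mem_filter.1 hd).1).1.1
      positivity
    unfold slam
    rw [← Finset.sum_filter, mul_div_right_comm, Finset.mul_sum]
    refine Finset.sum_congr rfl fun j _ => ?_
    field_simp
  rw [Finset.sum_congr rfl h1, Finset.sum_comm]
  have h2 : ∀ j ∈ SD z, (∑ d ∈ (SD z).filter (k ∣ ·), if d ∣ j then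
      (1 / SG z) * (1 / (Nat.totient j : ℝ)) * (ArithmeticFunction.moebius d : ℝ) else 0) =
      if j = k then (ArithmeticFunction.moebius k : ℝ) / (Nat.totient k * SG z) else 0 := by
    intro j hj
    obtain ⟨⟨hj1, hjz⟩, hjs⟩ := mem_SD.1 hj
    rw [← Finset.sum_filter, ← Finset.mul_sum]
    have hset : ((SD z).filter (k ∣ ·)).filter (· ∣ j) = j.divisors.filter (k ∣ ·) := by
      ext d
      simp only [Finset.mem_filter, mem_SD, Nat.mem_divisors]
      constructor
      · rintro ⟨⟨_, h⟩, h'⟩; exact ⟨⟨h', by omega⟩, h⟩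
      · rintro ⟨⟨h, _⟩, h'⟩
        exact ⟨⟨⟨⟨Nat.pos_of_dvd_of_pos h (by omega), (Nat.le_of_dvd (by omega) h).trans hjz⟩,
          hjs.squarefree_of_dvd h⟩, h'⟩, h⟩
    rw [hset]
    by_cases hkj : k ∣ j
    · have := moebius_between hjs hkj
      have h3 : ∑ d ∈ j.divisors.filter (k ∣ ·), (ArithmeticFunction.moebius d : ℝ) =
        if j = k then (ArithmeticFunction.moebius k : ℝ) else 0 := by
        rw [← Int.cast_sum, this]; split_ifs <;> simp
      rw [h3]
      split_ifs with e
      · rw [e]; field_simp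
      · simp
    · have : j.divisors.filter (k ∣ ·) = ∅ := by
        ext d; simp only [Finset.mem_filter, Nat.mem_divisors, Finset.notMem_empty, iff_false]
        rintro ⟨⟨h, _⟩, h'⟩; exact hkj (h'.trans h)
      rw [this, if_neg (by rintro rfl; exact hkj dvd_rfl)]; simp
  rw [Finset.sum_congr rfl h2, Finset.sum_ite_eq' (SD z) k, if_pos hk]

lemma slam_quad {z : ℕ} (hz : 1 ≤ z) :
    ∑ d ∈ SD z, ∑ e ∈ SD z, slam z d * slam z e * (1 / (Nat.lcm d e : ℝ)) = 1 / SG z := by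
  have hG := SG_ge_one hz
  have h1 : ∀ d ∈ SD z, ∀ e ∈ SD z, slam z d * slam z e * (1 / (Nat.lcm d e : ℝ)) =
      ∑ k ∈ SD z, if k ∣ d ∧ k ∣ e then (Nat.totient k : ℝ) * (slam z d / d) * (slam z e / e) else 0 := by
    intro d hd e he
    obtain ⟨⟨hd1, hdz⟩, hds⟩ := mem_SD.1 hd
    obtain ⟨⟨he1, hez⟩, hes⟩ := mem_SD.1 he
    have hset : (SD z).filter (fun k => k ∣ d ∧ k ∣ e) = (Nat.gcd d e).divisors := by
      ext k
      simp only [Finset.mem_filter, mem_SD, Nat.mem_divisors, Nat.dvd_gcd_iff]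
      constructor
      · rintro ⟨_, h⟩; exact ⟨h, by have := Nat.gcd_pos_of_pos_left e hd1; omega⟩
      · rintro ⟨h, _⟩
        exact ⟨⟨⟨Nat.pos_of_dvd_of_pos h.1 hd1, (Nat.le_of_dvd hd1 h.1).trans hdz⟩,
          hds.squarefree_of_dvd h.1⟩, h⟩
    rw [← Finset.sum_filter, hset]
    have h2 : ∑ k ∈ (Nat.gcd d e).divisors, (Nat.totient k : ℝ) = (Nat.gcd d e : ℝ) := by
      rw [← Nat.cast_sum, Nat.sum_totient]
    rw [← Finset.sum_mul, ← Finset.sum_mul, h2]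
    have h3 : (Nat.gcd d e : ℝ) * (Nat.lcm d e : ℝ) = d * e := by
      exact_mod_cast Nat.gcd_mul_lcm d e
    have hd0 : (d : ℝ) ≠ 0 := by positivity
    have he0 : (e : ℝ) ≠ 0 := by positivity
    have hl0 : (Nat.lcm d e : ℝ) ≠ 0 := by
      have := Nat.lcm_pos hd1 he1; positivity
    field_simp
    linear_combination (-(slam z d * slam z e)) * h3
  have h2 : ∑ d ∈ SD z, ∑ e ∈ SD z, slam z d * slam z e * (1 / (Nat.lcm d e : ℝ)) =
      ∑ k ∈ SD z, (Nat.totient k : ℝ) * (∑ d ∈ (SD z).filter (k ∣ ·), slam z d / d) ^ 2 := by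
    rw [Finset.sum_congr rfl fun d hd => Finset.sum_congr rfl fun e he => h1 d hd e he]
    have : ∀ d ∈ SD z, ∑ e ∈ SD z, (∑ k ∈ SD z, if k ∣ d ∧ k ∣ e then
        (Nat.totient k : ℝ) * (slam z d / d) * (slam z e / e) else 0) =
        ∑ k ∈ SD z, ∑ e ∈ SD z, if k ∣ d ∧ k ∣ e then
        (Nat.totient k : ℝ) * (slam z d / d) * (slam z e / e) else 0 :=
      fun d _ => Finset.sum_comm
    rw [Finset.sum_congr rfl this, Finset.sum_comm]
    refine Finset.sum_congr rfl fun k _ => ?_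
    rw [sq, Finset.sum_mul_sum, Finset.mul_sum, Finset.sum_filter]
    refine Finset.sum_congr rfl fun d _ => ?_
    rw [Finset.mul_sum, Finset.sum_filter]
    split_ifs with hkd
    · refine Finset.sum_congr rfl fun e _ => ?_
      simp only [hkd, true_and]; split_ifs <;> ring
    · simp [hkd]
  rw [h2]
  have h3 : ∀ k ∈ SD z, (Nat.totient k : ℝ) * (∑ d ∈ (SD z).filter (k ∣ ·), slam z d / d) ^ 2 =
      (1 / SG z ^ 2) * (1 / (Nat.totient k : ℝ)) := by
    intro k hk
    rw [slam_sum hk]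
    obtain ⟨⟨hk1, _⟩, hks⟩ := mem_SD.1 hk
    have h4 : (ArithmeticFunction.moebius k : ℝ) ^ 2 = 1 := by
      have := ArithmeticFunction.moebius_sq_eq_one_of_squarefree hks
      exact_mod_cast this
    have h5 : (Nat.totient k : ℝ) ≠ 0 := by
      have := Nat.totient_pos.2 hk1; positivity
    rw [div_pow, h4]; field_simp
  rw [Finset.sum_congr rfl h3, ← Finset.mul_sum]
  change 1 / SG z ^ 2 * SG z = _
  field_simp

lemma log_le_SD {z : ℕ} (hz : 1 ≤ z) : Real.log z ≤ 2 * ∑ k ∈ SD z, 1 / (k : ℝ) := by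
  have h1 : Real.log z ≤ ∑ n ∈ Finset.Icc 1 z, 1 / (n : ℝ) := by
    have := log_add_one_le_harmonic z
    rw [harmonic_eq_sum_Icc] at this
    push_cast at this
    simp only [one_div]
    refine le_trans ?_ this
    apply Real.log_le_log
    · exact_mod_cast hz
    · push_cast; linarith
  have h2 : ∑ n ∈ Finset.Icc 1 z, 1 / (n : ℝ) ≤
      ∑ p ∈ SD z ×ˢ Finset.Icc 1 z, 1 / ((p.1 : ℝ) * (p.2 : ℝ) ^ 2) := by
    have hch : ∀ n : ℕ, ∃ p : ℕ × ℕ, 1 ≤ n → n ≤ z → p ∈ SD z ×ˢ Finset.Icc 1 z ∧ n = p.1 * p.2 ^ 2 := by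
      intro n
      obtain ⟨a, b, hab, ha⟩ := Nat.sq_mul_squarefree n
      refine ⟨(a, b), fun hn hnz => ?_⟩
      have hb0 : b ≠ 0 := by rintro rfl; simp at hab; omega
      have ha0 : a ≠ 0 := by rintro rfl; simp at ha
      have e : n = a * b ^ 2 := by rw [← hab]; ring
      refine ⟨?_, e⟩
      rw [Finset.mem_product, mem_SD, Finset.mem_Icc]
      have hb2 : 1 ≤ b ^ 2 := Nat.one_le_pow _ _ (by omega)
      have : b ≤ b ^ 2 := by nlinarith
      refine ⟨⟨⟨by simp; omega, ?_⟩, ha⟩, by simp; omega, ?_⟩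
      · simp; nlinarith
      · simp; nlinarith [Nat.pos_of_ne_zero ha0]
    choose g hg using hch
    have hinj : Set.InjOn g (Finset.Icc 1 z) := by
      intro n hn m hm h
      rw [Finset.mem_coe, Finset.mem_Icc] at hn hm
      rw [(hg n hn.1 hn.2).2, (hg m hm.1 hm.2).2, h]
    have hE : ∑ n ∈ Finset.Icc 1 z, 1 / (n : ℝ) =
        ∑ n ∈ Finset.Icc 1 z, 1 / (((g n).1 : ℝ) * ((g n).2 : ℝ) ^ 2) := by
      refine Finset.sum_congr rfl fun n hn => ?_
      rw [Finset.mem_Icc] at hn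
      have h : (n : ℝ) = ((g n).1 : ℝ) * ((g n).2 : ℝ) ^ 2 := by exact_mod_cast (hg n hn.1 hn.2).2
      rw [h]
    rw [hE, ← Finset.sum_image (f := fun p : ℕ × ℕ => 1 / ((p.1 : ℝ) * (p.2 : ℝ) ^ 2)) hinj]
    apply Finset.sum_le_sum_of_subset_of_nonneg
    · intro p hp
      obtain ⟨n, hn, rfl⟩ := Finset.mem_image.1 hp
      rw [Finset.mem_Icc] at hn
      exact (hg n hn.1 hn.2).1
    · intro p _ _; positivity
  have h3 : ∑ b ∈ Finset.Icc 1 z, 1 / (b : ℝ) ^ 2 ≤ 2 := by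
    have : ∀ n : ℕ, 1 ≤ n → ∑ b ∈ Finset.Icc 1 n, 1 / (b : ℝ) ^ 2 ≤ 2 - 1 / (n : ℝ) := by
      intro n hn
      induction n, hn using Nat.le_induction with
      | base => norm_num
      | succ n hn ih =>
        rw [Finset.sum_Icc_succ_top (by omega)]
        have hn' : (1 : ℝ) ≤ n := by exact_mod_cast hn
        have : 1 / (((n + 1 : ℕ) : ℝ)) ^ 2 ≤ 1 / (n : ℝ) - 1 / ((n + 1 : ℕ) : ℝ) := by
          push_cast
          rw [div_sub_div _ _ (by positivity) (by positivity), div_le_div_iff₀ (by positivity) (by positivity)]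
          nlinarith
        linarith
    have h := this z hz
    have : (0 : ℝ) ≤ 1 / z := by positivity
    linarith
  have h4 : ∑ p ∈ SD z ×ˢ Finset.Icc 1 z, 1 / ((p.1 : ℝ) * (p.2 : ℝ) ^ 2) ≤
      2 * ∑ k ∈ SD z, 1 / (k : ℝ) := by
    rw [Finset.sum_product, Finset.mul_sum]
    refine Finset.sum_le_sum fun k hk => ?_
    have e : ∀ b ∈ Finset.Icc 1 z, 1 / ((k : ℝ) * (b : ℝ) ^ 2) = 1 / (k : ℝ) * (1 / (b : ℝ) ^ 2) := by
      intro b _; rw [one_div_mul_one_div]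
    simp only
    rw [Finset.sum_congr rfl e, ← Finset.mul_sum, mul_comm]
    gcongr
  linarith

lemma SG_ge_log {z : ℕ} (hz : 1 ≤ z) : Real.log z / 2 ≤ SG z := by
  have h := log_le_SD hz
  have h4 : ∑ k ∈ SD z, 1 / (k : ℝ) ≤ SG z := by
    refine Finset.sum_le_sum fun k hk => ?_
    obtain ⟨⟨hk1, _⟩, _⟩ := mem_SD.1 hk
    have : (0 : ℝ) < Nat.totient k := by exact_mod_cast Nat.totient_pos.2 hk1
    have : (Nat.totient k : ℝ) ≤ k := by exact_mod_cast Nat.totient_le k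
    gcongr
  linarith

lemma card_dvd_Ioc (a H m : ℕ) (hm : 1 ≤ m) :
    |(((Finset.Ioc a (a + H)).filter (m ∣ ·)).card : ℝ) - H * (1 / (m : ℝ))| ≤ 1 := by
  have h1 : (((Finset.Ioc a (a + H)).filter (m ∣ ·)).card : ℝ) = ((a + H) / m : ℕ) - (a / m : ℕ) := by
    have e1 := Nat.Ioc_filter_dvd_card_eq_div (a + H) m
    have e2 := Nat.Ioc_filter_dvd_card_eq_div a m
    have e3 : (Finset.Ioc 0 (a + H)).filter (m ∣ ·) =
        (Finset.Ioc 0 a).filter (m ∣ ·) ∪ (Finset.Ioc a (a + H)).filter (m ∣ ·) := by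
      rw [← Finset.filter_union, Finset.Ioc_union_Ioc_eq_Ioc (by omega) (by omega)]
    have e4 : Disjoint ((Finset.Ioc 0 a).filter (m ∣ ·)) ((Finset.Ioc a (a + H)).filter (m ∣ ·)) := by
      apply Finset.disjoint_filter_filter
      rw [Finset.disjoint_left]; intro x; simp; omega
    rw [e3, Finset.card_union_of_disjoint e4, e2] at e1
    rw [← e1]; push_cast; ring
  rw [h1]
  have hm0 : (0 : ℝ) < m := by positivity
  have b1 : (((a + H) / m : ℕ) : ℝ) ≤ ((a + H : ℕ) : ℝ) / m := Nat.cast_div_le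
  have b2 : ((a / m : ℕ) : ℝ) ≤ (a : ℝ) / m := Nat.cast_div_le
  have b3 : ((a + H : ℕ) : ℝ) / m ≤ ((a + H) / m : ℕ) + 1 := by
    rw [div_le_iff₀ hm0]
    have := Nat.lt_div_mul_add (a := a + H) (b := m) (by omega)
    have h : a + H ≤ ((a + H) / m + 1) * m := by linarith
    exact_mod_cast h
  have b4 : (a : ℝ) / m ≤ (a / m : ℕ) + 1 := by
    rw [div_le_iff₀ hm0]
    have := Nat.lt_div_mul_add (a := a) (b := m) (by omega)
    have h : a ≤ (a / m + 1) * m := by linarith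
    exact_mod_cast h
  have e : ((a + H : ℕ) : ℝ) / m = (a : ℝ) / m + H * (1 / m) := by push_cast; ring
  rw [e] at b1 b3
  rw [abs_le]; constructor <;> linarith

lemma selberg_bound {z a H : ℕ} (hz : 1 ≤ z) (hza : z ≤ a) :
    (((Finset.Ioc a (a + H)).filter Nat.Prime).card : ℝ) ≤ H / SG z + (z : ℝ) ^ 4 := by
  have h1 : (((Finset.Ioc a (a + H)).filter Nat.Prime).card : ℝ) ≤
      ∑ n ∈ Finset.Ioc a (a + H), (∑ d ∈ SD z, if d ∣ n then slam z d else 0) ^ 2 := by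
    rw [Finset.card_filter]; push_cast
    refine Finset.sum_le_sum fun n hn => ?_
    rw [Finset.mem_Ioc] at hn
    split_ifs with hp
    · have : (∑ d ∈ SD z, if d ∣ n then slam z d else 0) = 1 := by
        rw [Finset.sum_eq_single 1]
        · simp [slam_one hz]
        · intro d hd hd1
          obtain ⟨⟨_, hdz⟩, _⟩ := mem_SD.1 hd
          rw [if_neg]
          intro hdn
          rcases (Nat.dvd_prime hp).1 hdn with h | h <;> omega
        · intro h; exact absurd (mem_SD.2 ⟨⟨le_rfl, hz⟩, squarefree_one⟩) h
      rw [this]; norm_num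
    · positivity
  have h2 : ∑ n ∈ Finset.Ioc a (a + H), (∑ d ∈ SD z, if d ∣ n then slam z d else 0) ^ 2 =
      ∑ d ∈ SD z, ∑ e ∈ SD z, slam z d * slam z e *
        (((Finset.Ioc a (a + H)).filter (Nat.lcm d e ∣ ·)).card : ℝ) := by
    have : ∀ n, (∑ d ∈ SD z, if d ∣ n then slam z d else 0) ^ 2 =
        ∑ d ∈ SD z, ∑ e ∈ SD z, if Nat.lcm d e ∣ n then slam z d * slam z e else 0 := by
      intro n
      rw [sq, Finset.sum_mul_sum]
      refine Finset.sum_congr rfl fun d _ => Finset.sum_congr rfl fun e _ => ?_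
      by_cases hd : d ∣ n <;> by_cases he : e ∣ n <;> simp [Nat.lcm_dvd_iff, hd, he]
    simp only [this]
    rw [Finset.sum_comm]
    refine Finset.sum_congr rfl fun d _ => ?_
    rw [Finset.sum_comm]
    refine Finset.sum_congr rfl fun e _ => ?_
    rw [← Finset.sum_filter, Finset.sum_const, nsmul_eq_mul, mul_comm]
  have h3 : ∑ d ∈ SD z, ∑ e ∈ SD z, slam z d * slam z e *
        (((Finset.Ioc a (a + H)).filter (Nat.lcm d e ∣ ·)).card : ℝ) ≤
      ∑ d ∈ SD z, ∑ e ∈ SD z, ((H : ℝ) * (slam z d * slam z e * (1 / (Nat.lcm d e : ℝ))) +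
        (z : ℝ) * z) := by
    refine Finset.sum_le_sum fun d hd => Finset.sum_le_sum fun e he => ?_
    obtain ⟨⟨hd1, hdz⟩, _⟩ := mem_SD.1 hd
    obtain ⟨⟨he1, hez⟩, _⟩ := mem_SD.1 he
    have hc := card_dvd_Ioc a H (Nat.lcm d e) (Nat.lcm_pos hd1 he1)
    have ha : |slam z d * slam z e| ≤ (z : ℝ) * z := by
      rw [abs_mul]
      have := slam_abs hz d
      have := slam_abs hz e
      have : (d : ℝ) ≤ z := by exact_mod_cast hdz
      have : (e : ℝ) ≤ z := by exact_mod_cast hez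
      gcongr <;> linarith
    set N := (((Finset.Ioc a (a + H)).filter (Nat.lcm d e ∣ ·)).card : ℝ)
    have : |slam z d * slam z e * (N - H * (1 / (Nat.lcm d e : ℝ)))| ≤ (z : ℝ) * z * 1 := by
      rw [abs_mul]; gcongr
    have := (abs_le.1 this).2
    linarith
  have h4 : ∑ d ∈ SD z, ∑ e ∈ SD z, ((H : ℝ) * (slam z d * slam z e * (1 / (Nat.lcm d e : ℝ))) +
        (z : ℝ) * z) ≤ H / SG z + (z : ℝ) ^ 4 := by
    simp only [Finset.sum_add_distrib, ← Finset.mul_sum, slam_quad hz, Finset.sum_const, nsmul_eq_mul]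
    have hc : ((SD z).card : ℝ) ≤ z := by
      have := Finset.card_filter_le (Finset.Icc 1 z) Squarefree
      rw [Nat.card_Icc] at this
      exact_mod_cast this
    have : ((SD z).card : ℝ) * ((SD z).card * ((z : ℝ) * z)) ≤ z * (z * ((z : ℝ) * z)) := by gcongr
    have e : (z : ℝ) ^ 4 = z * (z * ((z : ℝ) * z)) := by ring
    rw [e, mul_one_div]; linarith
  linarith

/-- Brun–Titchmarsh type upper bound. -/
theorem brun_titchmarsh {a H : ℕ} (hH : 2 ≤ H) (hHa : H ≤ a) :
    (((Finset.Ioc a (a + H)).filter Nat.Prime).card : ℝ) ≤ 34 * H / Real.log H := by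
  have hHr : (2 : ℝ) ≤ H := by exact_mod_cast hH
  have hlog : 0 < Real.log H := Real.log_pos (by linarith)
  rcases lt_or_ge H (2 ^ 16) with hs | hs
  · have h1 : (((Finset.Ioc a (a + H)).filter Nat.Prime).card : ℝ) ≤ H := by
      have := Finset.card_filter_le (Finset.Ioc a (a + H)) Nat.Prime
      rw [Nat.card_Ioc] at this
      have h : ((Finset.Ioc a (a + H)).filter Nat.Prime).card ≤ H := by omega
      exact_mod_cast h
    refine h1.trans ?_
    rw [le_div_iff₀ hlog]
    have : Real.log H ≤ 34 := by
      have : Real.log H ≤ Real.log ((2 : ℝ) ^ 16) :=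
        Real.log_le_log (by linarith) (by exact_mod_cast hs.le)
      rw [Real.log_pow] at this
      have := Real.log_two_lt_d9
      push_cast at *; linarith
    nlinarith
  · set y : ℝ := (H : ℝ) ^ (1 / 8 : ℝ) with hy
    have hH0 : (0 : ℝ) < H := by linarith
    have hy16 : (H : ℝ) ^ (1 / 16 : ℝ) ≥ 2 := by
      have : ((2 : ℝ) ^ (16 : ℕ)) ^ (1 / 16 : ℝ) ≤ (H : ℝ) ^ (1 / 16 : ℝ) := by
        apply Real.rpow_le_rpow (by positivity) (by exact_mod_cast hs) (by norm_num)
      rw [← Real.rpow_natCast, ← Real.rpow_mul (by norm_num)] at this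
      norm_num at this ⊢
      linarith
    have hyy : y = (H : ℝ) ^ (1 / 16 : ℝ) * (H : ℝ) ^ (1 / 16 : ℝ) := by
      rw [← Real.rpow_add hH0]; norm_num [hy]
    set w := (H : ℝ) ^ (1 / 16 : ℝ) with hw
    set z := ⌊y⌋₊ with hzdef
    have hy0 : 0 ≤ y := by positivity
    have hzy : (z : ℝ) ≤ y := Nat.floor_le hy0
    have hzw : w ≤ z := by
      have : y < z + 1 := Nat.lt_floor_add_one y
      nlinarith
    have hz1 : 1 ≤ z := by
      have : (1 : ℝ) ≤ z := by linarith
      exact_mod_cast this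
    have hza : z ≤ a := by
      have : y ≤ H := by
        calc y ≤ (H : ℝ) ^ (1 : ℝ) := Real.rpow_le_rpow_of_exponent_le (by linarith) (by norm_num)
          _ = H := Real.rpow_one _
      have h : (z : ℝ) ≤ H := hzy.trans this
      have : z ≤ H := by exact_mod_cast h
      omega
    have h := selberg_bound (H := H) hz1 hza
    have hG : Real.log H / 32 ≤ SG z := by
      have h1 := SG_ge_log hz1
      have h2 : Real.log H / 16 ≤ Real.log z := by
        have : Real.log w ≤ Real.log z := Real.log_le_log (by linarith) hzw
        rw [hw, Real.log_rpow hH0] at this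
        linarith
      linarith
    have hz4 : (z : ℝ) ^ 4 ≤ Real.sqrt H := by
      calc (z : ℝ) ^ 4 ≤ y ^ 4 := by gcongr
        _ = Real.sqrt H := by
          rw [hy, ← Real.rpow_natCast, ← Real.rpow_mul hH0.le, Real.sqrt_eq_rpow]; norm_num
    have hsq : Real.log H ≤ 2 * Real.sqrt H := by
      have h1 := Real.log_le_sub_one_of_pos (Real.sqrt_pos.2 hH0)
      rw [Real.log_sqrt hH0.le] at h1
      linarith
    have h5 : (H : ℝ) / SG z ≤ 32 * H / Real.log H := by
      calc (H : ℝ) / SG z ≤ H / (Real.log H / 32) := by gcongr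
        _ = _ := by field_simp
    have h6 : Real.sqrt H ≤ 2 * H / Real.log H := by
      rw [le_div_iff₀ hlog]
      nlinarith [Real.sq_sqrt hH0.le, Real.sqrt_nonneg (H : ℝ)]
    have e : 34 * (H : ℝ) / Real.log H = 32 * H / Real.log H + 2 * H / Real.log H := by ring
    rw [e]; linarith

end RMF

namespace RMF

/-- doubly exponential scale -/
def Yk (k : ℕ) : ℕ := 2 ^ (2 ^ k)

lemma log_Yk (k : ℕ) : Real.log (Yk k) = 2 ^ k * Real.log 2 := by
  unfold Yk; push_cast; rw [Real.log_pow]; push_cast; ring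

lemma Yk_ge_two (k : ℕ) : 2 ≤ Yk k := by
  unfold Yk
  calc 2 = 2 ^ 1 := by norm_num
    _ ≤ 2 ^ (2 ^ k) := Nat.pow_le_pow_right (by norm_num) Nat.one_le_two_pow

lemma Yk_mono : Monotone Yk := fun a b h =>
  Nat.pow_le_pow_right (by norm_num) (Nat.pow_le_pow_right (by norm_num) h)

lemma mertens_log (N : ℕ) (hN : 1 ≤ N) :
    ∑ p ∈ Nat.primesLE N, Real.log p / p ≤ Real.log N + Real.log 4 := by
  have hN0 : (0 : ℝ) < N := by exact_mod_cast hN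
  have h1 : ∀ n ∈ Finset.Ioc 0 N, ∑ p ∈ (Nat.primesLE N).filter (· ∣ n), Real.log p ≤ Real.log N := by
    intro n hn
    rw [Finset.mem_Ioc] at hn
    have hs : (Nat.primesLE N).filter (· ∣ n) = n.primeFactors := by
      ext p
      simp only [Finset.mem_filter, Nat.mem_primesLE, Nat.mem_primeFactors]
      constructor
      · rintro ⟨⟨_, h⟩, h'⟩; exact ⟨h, h', by omega⟩
      · rintro ⟨h, h', _⟩; exact ⟨⟨(Nat.le_of_dvd hn.1 h').trans hn.2, h⟩, h'⟩
    rw [hs, ← Real.log_prod (fun p hp => by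
      have := (Nat.prime_of_mem_primeFactors hp).pos; positivity)]
    apply Real.log_le_log
    · exact Finset.prod_pos fun p hp => by
        have := (Nat.prime_of_mem_primeFactors hp).pos; positivity
    · have : ∏ p ∈ n.primeFactors, p ≤ N :=
        (Nat.le_of_dvd hn.1 (Nat.prod_primeFactors_dvd n)).trans hn.2
      rw [← Nat.cast_prod]; exact_mod_cast this
  have h2 := Finset.sum_le_sum h1
  simp only [Finset.sum_filter] at h2
  rw [Finset.sum_comm] at h2
  simp only [← Finset.sum_filter, Finset.sum_const, nsmul_eq_mul, Nat.Ioc_filter_dvd_card_eq_div,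
    Nat.card_Ioc, Nat.sub_zero] at h2
  have h3 : ∑ p ∈ Nat.primesLE N, Real.log p ≤ Real.log 4 * N := by
    have := Chebyshev.theta_le_log4_mul_x (x := (N : ℝ)) (by positivity)
    rwa [Chebyshev.theta_eq_sum_primesLE_log] at this
  have h4 : (N : ℝ) * ∑ p ∈ Nat.primesLE N, Real.log p / p ≤
      ∑ p ∈ Nat.primesLE N, ((N / p : ℕ) : ℝ) * Real.log p + ∑ p ∈ Nat.primesLE N, Real.log p := by
    rw [Finset.mul_sum, ← Finset.sum_add_distrib]
    refine Finset.sum_le_sum fun p hp => ?_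
    have hp' := (Nat.mem_primesLE.1 hp).2
    have hp0 : (0 : ℝ) < p := by exact_mod_cast hp'.pos
    have hl : 0 ≤ Real.log p := Real.log_natCast_nonneg p
    have : (N : ℝ) / p ≤ (N / p : ℕ) + 1 := by
      rw [div_le_iff₀ hp0]
      have := Nat.lt_div_mul_add (a := N) (b := p) hp'.pos
      have h : N ≤ (N / p + 1) * p := by linarith
      exact_mod_cast h
    calc (N : ℝ) * (Real.log p / p) = (N : ℝ) / p * Real.log p := by ring
      _ ≤ ((N / p : ℕ) + 1) * Real.log p := by gcongr
      _ = _ := by ring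
  have h5 : (N : ℝ) * ∑ p ∈ Nat.primesLE N, Real.log p / p ≤ N * (Real.log N + Real.log 4) := by
    linarith
  exact le_of_mul_le_mul_left h5 hN0

lemma log4_eq : Real.log 4 = 2 * Real.log 2 := by
  rw [show (4 : ℝ) = 2 ^ 2 by norm_num, Real.log_pow]; norm_num

/-- N1 -/
lemma sum_log_div_Yk (k : ℕ) : ∑ p ∈ Nat.primesLE (Yk k), Real.log p / p ≤ 3 * 2 ^ k := by
  refine (mertens_log _ (by have := Yk_ge_two k; omega)).trans ?_
  rw [log_Yk, log4_eq]
  have : (1 : ℝ) ≤ 2 ^ k := one_le_pow₀ (by norm_num)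
  have h1 := Real.log_two_lt_d9
  have h2 := Real.log_two_gt_d9
  nlinarith

/-- N2 -/
lemma sum_block (k : ℕ) :
    ∑ p ∈ (Nat.primesLE (Yk (k + 1))).filter (Yk k < ·), 1 / (p : ℝ) ≤ 9 := by
  have h := sum_log_div_Yk (k + 1)
  have h1 : (2 ^ k * Real.log 2) * ∑ p ∈ (Nat.primesLE (Yk (k + 1))).filter (Yk k < ·), 1 / (p : ℝ) ≤
      ∑ p ∈ Nat.primesLE (Yk (k + 1)), Real.log p / p := by
    rw [Finset.mul_sum]
    calc _ ≤ ∑ p ∈ (Nat.primesLE (Yk (k + 1))).filter (Yk k < ·), Real.log p / p := by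
          refine Finset.sum_le_sum fun p hp => ?_
          rw [Finset.mem_filter] at hp
          rw [← log_Yk, mul_one_div]
          have : Real.log (Yk k) ≤ Real.log p := Real.log_le_log (by
            have := Yk_ge_two k; positivity) (by exact_mod_cast hp.2.le)
          gcongr
      _ ≤ _ := Finset.sum_le_sum_of_subset_of_nonneg (Finset.filter_subset _ _) fun p _ _ =>
          div_nonneg (Real.log_natCast_nonneg p) (Nat.cast_nonneg p)
  have h2 := Real.log_two_gt_d9
  have h3 : (0 : ℝ) < 2 ^ k := by positivity
  have h4 : (2 ^ k * Real.log 2) * ∑ p ∈ (Nat.primesLE (Yk (k + 1))).filter (Yk k < ·), 1 / (p : ℝ) ≤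
    (2 ^ k * Real.log 2) * 9 := by
    rw [pow_succ] at h; nlinarith
  exact le_of_mul_le_mul_left h4 (by nlinarith)

lemma sum_SD_le_prod (z : ℕ) :
    ∑ k ∈ SD z, 1 / (k : ℝ) ≤ ∏ p ∈ Nat.primesLE z, (1 + 1 / (p : ℝ)) := by
  rw [Finset.prod_one_add]
  have hE : ∑ k ∈ SD z, 1 / (k : ℝ) = ∑ k ∈ SD z, ∏ p ∈ k.primeFactors, 1 / (p : ℝ) := by
    refine Finset.sum_congr rfl fun k hk => ?_
    obtain ⟨⟨hk1, _⟩, hks⟩ := mem_SD.1 hk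
    have := Nat.prod_primeFactors_of_squarefree hks
    have h : (k : ℝ) = ∏ p ∈ k.primeFactors, (p : ℝ) := by
      rw [← Nat.cast_prod, this]
    simp only [one_div, Finset.prod_inv_distrib]
    rw [← h]
  have hinj : Set.InjOn Nat.primeFactors (SD z : Set ℕ) := by
    intro a ha b hb h
    have ha' := (mem_SD.1 ha).2
    have hb' := (mem_SD.1 hb).2
    rw [← Nat.prod_primeFactors_of_squarefree ha', h, Nat.prod_primeFactors_of_squarefree hb']
  rw [hE, ← Finset.sum_image (f := fun t : Finset ℕ => ∏ p ∈ t, 1 / (p : ℝ)) hinj]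
  apply Finset.sum_le_sum_of_subset_of_nonneg
  · intro t ht
    obtain ⟨k, hk, rfl⟩ := Finset.mem_image.1 ht
    obtain ⟨⟨hk1, hkz⟩, hks⟩ := mem_SD.1 hk
    rw [Finset.mem_powerset]
    intro p hp
    exact Nat.mem_primesLE.2 ⟨(Nat.le_of_mem_primeFactors hp).trans hkz, Nat.prime_of_mem_primeFactors hp⟩
  · intro t _ _; exact Finset.prod_nonneg fun _ _ => by positivity

/-- N3 -/
lemma sum_inv_ge (k : ℕ) : (k : ℝ) * Real.log 2 - 2 ≤ ∑ p ∈ Nat.primesLE (Yk k), 1 / (p : ℝ) := by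
  have h1 := log_le_SD (z := Yk k) (by have := Yk_ge_two k; omega)
  have h2 := sum_SD_le_prod (Yk k)
  have h3 : ∏ p ∈ Nat.primesLE (Yk k), (1 + 1 / (p : ℝ)) ≤
      Real.exp (∑ p ∈ Nat.primesLE (Yk k), 1 / (p : ℝ)) := by
    rw [Real.exp_sum]
    refine Finset.prod_le_prod (fun _ _ => by positivity) fun p _ => ?_
    rw [add_comm]; exact Real.add_one_le_exp _
  have h4 : 2 ^ k * Real.log 2 / 2 ≤ Real.exp (∑ p ∈ Nat.primesLE (Yk k), 1 / (p : ℝ)) := by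
    rw [log_Yk] at h1; linarith
  have h5 := Real.log_two_gt_d9
  have h6 : Real.exp ((k : ℝ) * Real.log 2 - 2) ≤ 2 ^ k * Real.log 2 / 2 := by
    rw [Real.exp_sub, mul_comm (k : ℝ), Real.exp_mul, Real.exp_log (by norm_num), Real.rpow_natCast]
    have : (3 : ℝ) ≤ Real.exp 2 := by have := Real.add_one_le_exp (2 : ℝ); linarith
    have h7 : (0 : ℝ) < 2 ^ k := by positivity
    rw [div_le_iff₀ (by positivity)]
    have h8 : (1 : ℝ) ≤ Real.log 2 / 2 * Real.exp 2 := by nlinarith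
    nlinarith
  exact Real.exp_le_exp.1 (h6.trans h4)

lemma sum_rpow_le {σ : ℝ} (hσ : 0 < σ) (N : ℕ) :
    ∑ n ∈ Finset.Icc 1 N, (n : ℝ) ^ (-(1 + σ)) ≤ 1 + 1 / σ := by
  have key : ∀ N : ℕ, 1 ≤ N → ∑ n ∈ Finset.Icc 1 N, (n : ℝ) ^ (-(1 + σ)) ≤
      1 + 1 / σ - 1 / σ * (N : ℝ) ^ (-σ) := by
    intro N hN
    induction N, hN using Nat.le_induction with
    | base => simp
    | succ n hn ih =>
      rw [Finset.sum_Icc_succ_top (by omega)]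
      have hn' : (0 : ℝ) < n := by exact_mod_cast hn
      have hn1 : (0 : ℝ) < ((n + 1 : ℕ) : ℝ) := by positivity
      suffices h : ((n + 1 : ℕ) : ℝ) ^ (-(1 + σ)) ≤
          1 / σ * ((n : ℝ) ^ (-σ) - ((n + 1 : ℕ) : ℝ) ^ (-σ)) by linarith
      have e1 : ((n + 1 : ℕ) : ℝ) ^ (-(1 + σ)) = ((n + 1 : ℕ) : ℝ) ^ (-σ) * (1 / ((n + 1 : ℕ) : ℝ)) := by
        rw [show -(1 + σ) = -σ + -1 by ring, Real.rpow_add hn1, Real.rpow_neg_one, one_div]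
      have e2 : (n : ℝ) ^ (-σ) = ((n + 1 : ℕ) : ℝ) ^ (-σ) * (((n + 1 : ℕ) : ℝ) / n) ^ σ := by
        rw [Real.div_rpow hn1.le hn'.le, Real.rpow_neg hn'.le, Real.rpow_neg hn1.le]
        have := (Real.rpow_pos_of_pos hn1 σ).ne'
        field_simp
      have e3 : 1 + σ * (1 / ((n + 1 : ℕ) : ℝ)) ≤ (((n + 1 : ℕ) : ℝ) / n) ^ σ := by
        rw [Real.rpow_def_of_pos (by positivity)]
        have h1 := Real.add_one_le_exp (Real.log (((n + 1 : ℕ) : ℝ) / n) * σ)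
        have h2 : 1 / ((n + 1 : ℕ) : ℝ) ≤ Real.log (((n + 1 : ℕ) : ℝ) / n) := by
          have h3 := Real.log_le_sub_one_of_pos (show 0 < (n : ℝ) / ((n + 1 : ℕ) : ℝ) by positivity)
          have h4 : Real.log (((n + 1 : ℕ) : ℝ) / n) = - Real.log ((n : ℝ) / ((n + 1 : ℕ) : ℝ)) := by
            rw [← Real.log_inv, inv_div]
          rw [h4]
          have : (n : ℝ) / ((n + 1 : ℕ) : ℝ) - 1 = - (1 / ((n + 1 : ℕ) : ℝ)) := by
            push_cast; field_simp; ring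
          linarith
        nlinarith
      rw [e1, e2]
      have hpos : 0 < ((n + 1 : ℕ) : ℝ) ^ (-σ) := by positivity
      calc _ = 1 / σ * (((n + 1 : ℕ) : ℝ) ^ (-σ) * (1 + σ * (1 / ((n + 1 : ℕ) : ℝ))) -
            ((n + 1 : ℕ) : ℝ) ^ (-σ)) := by field_simp; ring
        _ ≤ _ := by gcongr
  rcases Nat.eq_zero_or_pos N with h | h
  · subst h; simp; positivity
  · have := key N h
    have : 0 ≤ 1 / σ * (N : ℝ) ^ (-σ) := by positivity
    linarith

/-- sum over primes of p^{-3/2} -/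
def CP : ℝ := ∑' n : ℕ, (n : ℝ) ^ (-(3 / 2) : ℝ)

lemma summable_32 : Summable fun n : ℕ => (n : ℝ) ^ (-(3 / 2) : ℝ) :=
  Real.summable_nat_rpow.2 (by norm_num)

lemma CP_nonneg : 0 ≤ CP := tsum_nonneg fun _ => by positivity

/-- N6 -/
lemma sum_32_le (s : Finset ℕ) : ∑ p ∈ s, (p : ℝ) ^ (-(3 / 2) : ℝ) ≤ CP :=
  summable_32.sum_le_tsum _ fun _ _ => by positivity

lemma sum_prime_rpow_le {σ : ℝ} (hσ : 0 < σ) (s : Finset ℕ) (hs : ∀ p ∈ s, Nat.Prime p) :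
    ∑ p ∈ s, (p : ℝ) ^ (-(1 + σ)) ≤ Real.log (1 + 1 / σ) + CP := by
  have h1 : ∏ p ∈ s, (1 + (p : ℝ) ^ (-(1 + σ))) ≤ 1 + 1 / σ := by
    rw [Finset.prod_one_add]
    have hE : ∀ t ∈ s.powerset, ∏ p ∈ t, (p : ℝ) ^ (-(1 + σ)) =
        ((∏ p ∈ t, p : ℕ) : ℝ) ^ (-(1 + σ)) := by
      intro t _
      push_cast
      rw [Real.finsetProd_rpow _ _ fun _ _ => by positivity]
    rw [Finset.sum_congr rfl hE]
    have hinj : Set.InjOn (fun t : Finset ℕ => ∏ p ∈ t, p) (s.powerset : Set (Finset ℕ)) := by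
      intro a ha b hb h
      have h : ∏ p ∈ a, p = ∏ p ∈ b, p := h
      rw [Finset.mem_coe, Finset.mem_powerset] at ha hb
      rw [← Nat.primeFactors_prod (fun p hp => hs p (ha hp)),
        ← Nat.primeFactors_prod (fun p hp => hs p (hb hp)), h]
    rw [← Finset.sum_image (f := fun n : ℕ => (n : ℝ) ^ (-(1 + σ))) hinj]
    refine le_trans (Finset.sum_le_sum_of_subset_of_nonneg ?_ fun _ _ _ => by positivity)
      (sum_rpow_le hσ (∏ p ∈ s, p))
    intro n hn
    obtain ⟨t, ht, rfl⟩ := Finset.mem_image.1 hn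
    rw [Finset.mem_powerset] at ht
    rw [Finset.mem_Icc]
    refine ⟨Finset.prod_pos fun p hp => (hs p (ht hp)).pos, ?_⟩
    exact Nat.le_of_dvd (Finset.prod_pos fun p hp => (hs p hp).pos) (Finset.prod_dvd_prod_of_subset _ _ _ ht)
  have h2 : ∑ p ∈ s, Real.log (1 + (p : ℝ) ^ (-(1 + σ))) ≤ Real.log (1 + 1 / σ) := by
    rw [← Real.log_prod fun p _ => by positivity]
    exact Real.log_le_log (Finset.prod_pos fun p _ => by positivity) h1
  have h3 : ∀ p ∈ s, (p : ℝ) ^ (-(1 + σ)) ≤ Real.log (1 + (p : ℝ) ^ (-(1 + σ))) +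
      (p : ℝ) ^ (-(3 / 2) : ℝ) := by
    intro p hp
    have hp1 : (1 : ℝ) ≤ p := by exact_mod_cast (hs p hp).pos
    set x := (p : ℝ) ^ (-(1 + σ)) with hx
    have hx0 : 0 < x := by positivity
    have h4 : x ^ 2 ≤ (p : ℝ) ^ (-(3 / 2) : ℝ) := by
      rw [hx, ← Real.rpow_natCast, ← Real.rpow_mul (by linarith)]
      apply Real.rpow_le_rpow_of_exponent_le hp1
      push_cast; linarith
    have h5 : x - x ^ 2 ≤ Real.log (1 + x) := by
      have := Real.one_sub_inv_le_log_of_pos (show 0 < 1 + x by linarith)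
      have e : x - x ^ 2 ≤ 1 - (1 + x)⁻¹ := by
        rw [show 1 - (1 + x)⁻¹ = x / (1 + x) by field_simp; ring, le_div_iff₀ (by linarith)]
        nlinarith [pow_pos hx0 3]
      linarith
    linarith
  calc _ ≤ _ := Finset.sum_le_sum h3
    _ ≤ _ := by rw [Finset.sum_add_distrib]; linarith [sum_32_le s]

lemma inv_le_rpow {σ : ℝ} {p : ℕ} (hp : 1 ≤ p) :
    1 / (p : ℝ) ≤ (p : ℝ) ^ (-(1 + σ)) + σ * (Real.log p / p) := by
  have hp0 : (0 : ℝ) < p := by exact_mod_cast hp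
  rw [show -(1 + σ) = -σ + -1 by ring, Real.rpow_add hp0, Real.rpow_neg_one,
    Real.rpow_def_of_pos hp0]
  have := Real.add_one_le_exp (Real.log p * -σ)
  have h : (1 - Real.log p * σ) * (p : ℝ)⁻¹ ≤ Real.exp (Real.log p * -σ) * (p : ℝ)⁻¹ := by
    gcongr; linarith
  calc 1 / (p : ℝ) = (1 - Real.log p * σ) * (p : ℝ)⁻¹ + σ * (Real.log p / p) := by field_simp; ring
    _ ≤ _ := by linarith

/-- N4 -/
lemma prod_primes_le : ∃ C : ℝ, 0 < C ∧ ∀ y : ℕ, 2 ≤ y →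
    ∏ p ∈ Nat.primesLE y, (1 + 1 / (p : ℝ)) ≤ C * Real.log y := by
  refine ⟨3 * Real.exp (CP + 3), by positivity, fun y hy => ?_⟩
  have hy' : (2 : ℝ) ≤ y := by exact_mod_cast hy
  have hl2 := Real.log_two_gt_d9
  have hl : Real.log 2 ≤ Real.log y := Real.log_le_log (by norm_num) hy'
  have hl0 : 0 < Real.log y := by linarith
  set σ := 1 / Real.log y with hσ
  have hσ0 : 0 < σ := by positivity
  have h1 : ∑ p ∈ Nat.primesLE y, 1 / (p : ℝ) ≤ Real.log (1 + Real.log y) + (CP + 3) := by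
    calc _ ≤ ∑ p ∈ Nat.primesLE y, ((p : ℝ) ^ (-(1 + σ)) + σ * (Real.log p / p)) :=
          Finset.sum_le_sum fun p hp => inv_le_rpow (Nat.mem_primesLE.1 hp).2.pos
      _ = ∑ p ∈ Nat.primesLE y, (p : ℝ) ^ (-(1 + σ)) +
          σ * ∑ p ∈ Nat.primesLE y, (Real.log p / p) := by
          rw [Finset.sum_add_distrib, Finset.mul_sum]
      _ ≤ (Real.log (1 + 1 / σ) + CP) + σ * (Real.log y + Real.log 4) := by
          gcongr
          · exact sum_prime_rpow_le hσ0 _ fun p hp => (Nat.mem_primesLE.1 hp).2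
          · exact mertens_log y (by omega)
      _ ≤ _ := by
          have e1 : 1 / σ = Real.log y := by rw [hσ]; field_simp
          have e2 : σ * (Real.log y + Real.log 4) ≤ 3 := by
            rw [hσ, one_div_mul_eq_div, div_le_iff₀ hl0, log4_eq]; linarith
          rw [e1]; linarith
  calc ∏ p ∈ Nat.primesLE y, (1 + 1 / (p : ℝ)) ≤ Real.exp (∑ p ∈ Nat.primesLE y, 1 / (p : ℝ)) := by
        rw [Real.exp_sum]
        refine Finset.prod_le_prod (fun _ _ => by positivity) fun p _ => ?_
        rw [add_comm]; exact Real.add_one_le_exp _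
    _ ≤ Real.exp (Real.log (1 + Real.log y) + (CP + 3)) := Real.exp_le_exp.2 h1
    _ = (1 + Real.log y) * Real.exp (CP + 3) := by
        rw [Real.exp_add, Real.exp_log (by linarith)]
    _ ≤ (3 * Real.log y) * Real.exp (CP + 3) := by gcongr; linarith
    _ = _ := by ring

end RMF

namespace RMF

/-- fractional part integral -/
def zJ (s : ℂ) : ℂ := ∫ u in Set.Ioi (1 : ℝ), ((u - (⌊u⌋₊ : ℝ) : ℝ) : ℂ) * (u : ℂ) ^ (-(s + 1))

lemma norm_cpow_u {u : ℝ} (hu : 1 < u) (s : ℂ) : ‖(u : ℂ) ^ s‖ = u ^ s.re :=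
  Complex.norm_cpow_eq_rpow_re_of_pos (by linarith) s

lemma fract_bd {u : ℝ} (hu : 1 < u) : 0 ≤ u - (⌊u⌋₊ : ℝ) ∧ u - (⌊u⌋₊ : ℝ) ≤ 1 := by
  constructor
  · linarith [Nat.floor_le (show 0 ≤ u by linarith)]
  · linarith [Nat.lt_floor_add_one u]

lemma zJ_meas (s : ℂ) : AEStronglyMeasurable
    (fun u : ℝ => ((u - (⌊u⌋₊ : ℝ) : ℝ) : ℂ) * (u : ℂ) ^ (-(s + 1))) (volume.restrict (Set.Ioi 1)) := by
  apply AEStronglyMeasurable.mul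
  · apply Measurable.aestronglyMeasurable
    fun_prop
  · apply ContinuousOn.aestronglyMeasurable _ measurableSet_Ioi
    intro u hu
    apply ContinuousAt.continuousWithinAt
    exact Complex.continuousAt_ofReal_cpow_const u _ (Or.inr (by
      have : (1 : ℝ) < u := hu
      linarith))

lemma zJ_int {s : ℂ} (hs : 1 < s.re) : IntegrableOn
    (fun u : ℝ => ((u - (⌊u⌋₊ : ℝ) : ℝ) : ℂ) * (u : ℂ) ^ (-(s + 1))) (Set.Ioi 1) := by
  have h2 : IntegrableOn (fun u : ℝ => u ^ (-2 : ℝ)) (Set.Ioi 1) :=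
    integrableOn_Ioi_rpow_of_lt (by norm_num) one_pos
  refine Integrable.mono' h2 (zJ_meas s) ?_
  refine (ae_restrict_iff' measurableSet_Ioi).2 (ae_of_all _ fun u hu => ?_)
  have hu : 1 < u := hu
  rw [norm_mul, norm_cpow_u hu, Complex.norm_real, Real.norm_of_nonneg (fract_bd hu).1]
  have : u ^ (-(s + 1)).re ≤ u ^ (-2 : ℝ) :=
    Real.rpow_le_rpow_of_exponent_le hu.le (by simp; linarith)
  have h3 : 0 ≤ u ^ (-(s + 1)).re := by positivity
  nlinarith [fract_bd hu]

lemma zJ_norm {s : ℂ} (hs : 1 < s.re) : ‖zJ s‖ ≤ 1 := by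
  have h2 : IntegrableOn (fun u : ℝ => u ^ (-2 : ℝ)) (Set.Ioi 1) :=
    integrableOn_Ioi_rpow_of_lt (by norm_num) one_pos
  have : ∫ u in Set.Ioi (1 : ℝ), u ^ (-2 : ℝ) = 1 := by
    rw [integral_Ioi_rpow_of_lt (by norm_num) one_pos]; norm_num
  rw [← this]
  refine norm_integral_le_of_norm_le h2 ?_
  refine (ae_restrict_iff' measurableSet_Ioi).2 (ae_of_all _ fun u hu => ?_)
  have hu : 1 < u := hu
  rw [norm_mul, norm_cpow_u hu, Complex.norm_real, Real.norm_of_nonneg (fract_bd hu).1]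
  have : u ^ (-(s + 1)).re ≤ u ^ (-2 : ℝ) :=
    Real.rpow_le_rpow_of_exponent_le hu.le (by simp; linarith)
  have h3 : 0 ≤ u ^ (-(s + 1)).re := by positivity
  nlinarith [fract_bd hu]

lemma zJ_lip {s : ℂ} {h : ℝ} (hs : 1 < s.re) (hh : 0 ≤ h) : ‖zJ s - zJ (s + h)‖ ≤ 4 * h := by
  have hs' : 1 < (s + h).re := by simp; linarith
  unfold zJ
  rw [← integral_sub (zJ_int hs) (zJ_int hs')]
  have h2 : IntegrableOn (fun u : ℝ => 2 * h * u ^ (-3 / 2 : ℝ)) (Set.Ioi 1) :=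
    (integrableOn_Ioi_rpow_of_lt (by norm_num) one_pos).const_mul _
  have : ∫ u in Set.Ioi (1 : ℝ), 2 * h * u ^ (-3 / 2 : ℝ) = 4 * h := by
    rw [integral_const_mul, integral_Ioi_rpow_of_lt (by norm_num) one_pos]; norm_num; ring
  rw [← this]
  refine norm_integral_le_of_norm_le h2 ?_
  refine (ae_restrict_iff' measurableSet_Ioi).2 (ae_of_all _ fun u hu => ?_)
  have hu : 1 < u := hu
  have hu0 : (u : ℂ) ≠ 0 := by
    simp only [ne_eq, Complex.ofReal_eq_zero]; linarith
  have e1 : (u : ℂ) ^ (-(s + h + 1)) = (u : ℂ) ^ (-(s + 1)) * ((u ^ (-h) : ℝ) : ℂ) := by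
    rw [Complex.ofReal_cpow (by linarith), ← Complex.cpow_add _ _ hu0]
    congr 1; push_cast; ring
  rw [← mul_sub, e1, ← mul_one_sub, norm_mul, norm_mul, norm_cpow_u hu, Complex.norm_real,
    Real.norm_of_nonneg (fract_bd hu).1]
  have h4 : ‖(1 : ℂ) - ((u ^ (-h) : ℝ) : ℂ)‖ = 1 - u ^ (-h) := by
    rw [← Complex.ofReal_one, ← Complex.ofReal_sub, Complex.norm_real, Real.norm_of_nonneg]
    have : u ^ (-h) ≤ u ^ (0 : ℝ) := Real.rpow_le_rpow_of_exponent_le hu.le (by linarith)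
    rw [Real.rpow_zero] at this; linarith
  rw [h4]
  have h5 : 1 - u ^ (-h) ≤ h * Real.log u := by
    rw [Real.rpow_def_of_pos (by linarith)]
    have := Real.add_one_le_exp (Real.log u * -h)
    linarith
  have h6 : Real.log u ≤ 2 * u ^ (1 / 2 : ℝ) := by
    have h7 := Real.log_le_sub_one_of_pos (show 0 < u ^ (1 / 2 : ℝ) by positivity)
    rw [Real.log_rpow (by linarith)] at h7
    linarith
  have h8 : 0 ≤ 1 - u ^ (-h) := by rw [← h4]; exact norm_nonneg _
  have h9 : u ^ (-(s + 1)).re ≤ u ^ (-2 : ℝ) :=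
    Real.rpow_le_rpow_of_exponent_le hu.le (by simp; linarith)
  calc (u - (⌊u⌋₊ : ℝ)) * (u ^ (-(s + 1)).re * (1 - u ^ (-h)))
      ≤ 1 * (u ^ (-2 : ℝ) * (h * (2 * u ^ (1 / 2 : ℝ)))) := by
        gcongr
        · exact (fract_bd hu).2
        · exact h5.trans (by gcongr)
    _ = 2 * h * (u ^ (-2 : ℝ) * u ^ (1 / 2 : ℝ)) := by ring
    _ = _ := by rw [← Real.rpow_add (by linarith)]; norm_num

lemma zeta_rep {s : ℂ} (hs : 1 < s.re) : riemannZeta s = s / (s - 1) - s * zJ s := by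
  have hs1 : s - 1 ≠ 0 := by
    intro h; have : s = 1 := by linear_combination h
    rw [this] at hs; simp at hs
  have h1 := LSeries_eq_mul_integral_of_nonneg (fun _ => (1 : ℝ)) (r := 1) zero_le_one hs (by
    simp only [Finset.sum_const, Nat.card_Icc, Nat.add_sub_cancel, nsmul_eq_mul, mul_one, Real.rpow_one]
    exact Asymptotics.isBigO_refl _ _) (fun _ => zero_le_one)
  have h2 : LSeries (fun n : ℕ => (((fun _ => (1 : ℝ)) n : ℝ) : ℂ)) s = riemannZeta s := by
    rw [← LSeries_one_eq_riemannZeta hs]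
    congr 1
  rw [h2] at h1
  rw [h1]
  have hI : IntegrableOn (fun u : ℝ => (u : ℂ) ^ (-s)) (Set.Ioi 1) :=
    integrableOn_Ioi_cpow_of_lt (by simp; linarith) one_pos
  have h3 : ∫ u in Set.Ioi (1 : ℝ), (∑ k ∈ Finset.Icc 1 ⌊u⌋₊, ((1 : ℝ) : ℂ)) * (u : ℂ) ^ (-(s + 1)) =
      ∫ u in Set.Ioi (1 : ℝ), ((u : ℂ) ^ (-s) -
        ((u - (⌊u⌋₊ : ℝ) : ℝ) : ℂ) * (u : ℂ) ^ (-(s + 1))) := by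
    refine setIntegral_congr_fun measurableSet_Ioi fun u hu => ?_
    have hu : 1 < u := hu
    have hu0 : (u : ℂ) ≠ 0 := by
      simp only [ne_eq, Complex.ofReal_eq_zero]; linarith
    have : (u : ℂ) ^ (-s) = u * (u : ℂ) ^ (-(s + 1)) := by
      nth_rewrite 2 [← Complex.cpow_one (u : ℂ)]
      rw [← Complex.cpow_add _ _ hu0]; congr 1; ring
    simp only [this, Finset.sum_const, Nat.card_Icc, Nat.add_sub_cancel]
    push_cast
    simp
    ring
  rw [h3, integral_sub hI (zJ_int hs), integral_Ioi_cpow_of_lt (by simp; linarith) one_pos]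
  simp only [Complex.ofReal_one, Complex.one_cpow]
  have : -s + 1 ≠ 0 := by intro h; apply hs1; linear_combination -h
  unfold zJ
  field_simp
  ring

lemma zeta_341 {σ : ℝ} (hσ : 0 < σ) (t : ℝ) :
    1 ≤ ‖riemannZeta (1 + σ)‖ ^ 3 * ‖riemannZeta (1 + σ + Complex.I * t)‖ ^ 4 *
      ‖riemannZeta (1 + σ + 2 * Complex.I * t)‖ := by
  have h := DirichletCharacter.norm_LSeries_product_ge_one (N := 1) (1 : DirichletCharacter ℂ 1) hσ t
  have e : ∀ n : ℕ, ((1 : DirichletCharacter ℂ 1) (n : ZMod 1)) = 1 := fun n => by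
    rw [Subsingleton.elim ((n : ZMod 1)) 1, map_one]
  have hf : (fun n : ℕ => (1 : DirichletCharacter ℂ 1) (n : ZMod 1)) = 1 := by ext n; simp [e]
  have hf2 : (fun n : ℕ => ((1 : DirichletCharacter ℂ 1) ^ 2 : DirichletCharacter ℂ 1) (n : ZMod 1)) = 1 := by
    rw [one_pow]; exact hf
  rw [hf, hf2, LSeries_one_eq_riemannZeta (by simp [hσ]), LSeries_one_eq_riemannZeta (by simp [hσ]),
    LSeries_one_eq_riemannZeta (by simp [hσ]), norm_mul, norm_mul, norm_pow, norm_pow] at h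
  exact h

lemma zeta_real_le {σ : ℝ} (hσ : 0 < σ) (h1 : σ ≤ 1) : ‖riemannZeta (1 + σ)‖ ≤ 4 / σ := by
  have hs : 1 < ((1 : ℂ) + σ).re := by simp [hσ]
  rw [zeta_rep hs]
  have hJ := zJ_norm hs
  have e : (1 : ℂ) + σ - 1 = σ := by ring
  rw [e]
  have n1 : ‖(1 : ℂ) + σ‖ = 1 + σ := by
    rw [← Complex.ofReal_one, ← Complex.ofReal_add, Complex.norm_real, Real.norm_of_nonneg (by linarith)]
  have n2 : ‖(σ : ℂ)‖ = σ := by rw [Complex.norm_real, Real.norm_of_nonneg hσ.le]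
  have step : ‖((1 : ℂ) + σ) / σ - (1 + σ) * zJ (1 + σ)‖ ≤ (1 + σ) / σ + (1 + σ) * 1 := by
    refine (norm_sub_le _ _).trans ?_
    rw [norm_div, norm_mul, n1, n2]; gcongr
  refine step.trans ?_
  rw [le_div_iff₀ hσ, add_mul, div_mul_cancel₀ _ hσ.ne']; nlinarith

end RMF

namespace RMF

lemma s_facts {σ t : ℝ} (hσ : 0 < σ) (h1 : σ ≤ 1) (ht : 1 ≤ |t|) :
    1 < ((1 : ℂ) + σ + Complex.I * t).re ∧ |t| ≤ ‖((1 : ℂ) + σ + Complex.I * t) - 1‖ ∧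
    ‖((1 : ℂ) + σ + Complex.I * t)‖ ≤ 3 * |t| ∧ ((1 : ℂ) + σ + Complex.I * t) - 1 ≠ 0 := by
  have h2 : |t| ≤ ‖((1 : ℂ) + σ + Complex.I * t) - 1‖ := by
    have := Complex.abs_im_le_norm (((1 : ℂ) + σ + Complex.I * t) - 1)
    simpa using this
  refine ⟨by simp [hσ], h2, ?_, ?_⟩
  · have : ‖((1 : ℂ) + σ + Complex.I * t)‖ ≤ ‖(1 : ℂ)‖ + ‖(σ : ℂ)‖ + ‖Complex.I * (t : ℂ)‖ := norm_add₃_le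
    rw [norm_one, norm_mul, Complex.norm_I, Complex.norm_real, Complex.norm_real,
      Real.norm_of_nonneg hσ.le, Real.norm_eq_abs] at this
    linarith
  · intro h; rw [h, norm_zero] at h2; linarith

lemma zeta_upper {σ t : ℝ} (hσ : 0 < σ) (h1 : σ ≤ 1) (ht : 1 ≤ |t|) :
    ‖riemannZeta (1 + σ + Complex.I * t)‖ ≤ 6 * |t| := by
  obtain ⟨a, b, c, d⟩ := s_facts hσ h1 ht
  set s := (1 : ℂ) + σ + Complex.I * t with hs
  rw [zeta_rep a]
  have hJ := zJ_norm a
  have e : s / (s - 1) = 1 + 1 / (s - 1) := by field_simp; ring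
  have h3 : ‖1 / (s - 1)‖ ≤ 1 := by
    rw [norm_div, norm_one, div_le_one (by linarith)]; linarith
  calc ‖s / (s - 1) - s * zJ s‖ ≤ ‖s / (s - 1)‖ + ‖s * zJ s‖ := norm_sub_le _ _
    _ ≤ 2 + 3 * |t| * 1 := by
      gcongr
      · rw [e]; refine (norm_add_le _ _).trans ?_; rw [norm_one]; linarith
      · rw [norm_mul]; gcongr
    _ ≤ _ := by linarith

lemma zeta_lip {σ t h : ℝ} (hσ : 0 < σ) (h1 : σ ≤ 1) (hh : 0 ≤ h) (hh1 : σ + h ≤ 1) (ht : 1 ≤ |t|) :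
    ‖riemannZeta (1 + σ + Complex.I * t) - riemannZeta (1 + (σ + h : ℝ) + Complex.I * t)‖ ≤ 14 * |t| * h := by
  obtain ⟨a, b, c, d⟩ := s_facts hσ h1 ht
  obtain ⟨a', b', c', d'⟩ := s_facts (σ := σ + h) (by linarith) hh1 ht
  have e : (1 : ℂ) + (σ + h : ℝ) + Complex.I * t = (1 : ℂ) + σ + Complex.I * t + h := by
    push_cast; ring
  rw [e] at a' b' c' d' ⊢
  set s := (1 : ℂ) + σ + Complex.I * t with hs
  rw [zeta_rep a, zeta_rep a']
  have hJ := zJ_norm a'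
  have hL := zJ_lip a hh
  have e1 : s / (s - 1) - s * zJ s - ((s + h) / (s + h - 1) - (s + h) * zJ (s + h)) =
      h / ((s - 1) * (s + h - 1)) - s * (zJ s - zJ (s + h)) + h * zJ (s + h) := by
    field_simp; ring
  rw [e1]
  have nh : ‖(h : ℂ)‖ = h := by rw [Complex.norm_real, Real.norm_of_nonneg hh]
  have h4 : ‖(h : ℂ) / ((s - 1) * (s + h - 1))‖ ≤ h := by
    rw [norm_div, norm_mul, nh]
    apply div_le_self hh
    nlinarith
  calc _ ≤ ‖(h : ℂ) / ((s - 1) * (s + h - 1))‖ + ‖s * (zJ s - zJ (s + h))‖ + ‖h * zJ (s + h)‖ := by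
        refine (norm_add_le _ _).trans ?_
        gcongr
        exact norm_sub_le _ _
    _ ≤ h + 3 * |t| * (4 * h) + h * 1 := by
        rw [norm_mul, norm_mul, nh]; gcongr
    _ ≤ _ := by nlinarith

lemma zeta_lower_large {σ t : ℝ} (hσ : 0 < σ) (h1 : σ ≤ 1) (ht : 1 ≤ |t|) :
    1 / (28 ^ 4 * 768) * (1 / |t| ^ 4) ≤ ‖riemannZeta (1 + σ + Complex.I * t)‖ := by
  set τ := |t| with hτ
  set η : ℝ := 1 / (28 ^ 4 * 768 * τ ^ 5) with hη
  have hτ0 : 0 < τ := by linarith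
  have hη0 : 0 < η := by positivity
  have hη1 : η ≤ 1 := by
    rw [hη, div_le_one (by positivity)]
    have : 1 ≤ τ ^ 5 := one_le_pow₀ ht
    linarith
  have e0 : 1 / (28 ^ 4 * 768) * (1 / τ ^ 4) = η * τ := by rw [hη]; field_simp
  have big : ∀ v : ℝ, η ≤ v → v ≤ 1 → 28 * τ * η ≤ ‖riemannZeta (1 + v + Complex.I * t)‖ := by
    intro v hv hv1
    have hv0 : 0 < v := by linarith
    have h341 := zeta_341 hv0 t
    have z1 := zeta_real_le hv0 hv1
    have z2 : ‖riemannZeta (1 + v + 2 * Complex.I * t)‖ ≤ 12 * τ := by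
      have h2 : 1 ≤ |2 * t| := by rw [abs_mul]; norm_num; linarith
      have := zeta_upper hv0 hv1 h2
      rw [show (1 : ℂ) + v + Complex.I * ((2 * t : ℝ) : ℂ) = 1 + v + 2 * Complex.I * t by push_cast; ring,
        abs_mul] at this
      norm_num at this
      linarith
    set N := ‖riemannZeta (1 + v + Complex.I * t)‖
    have hN : 0 ≤ N := norm_nonneg _
    have : 1 ≤ (4 / v) ^ 3 * N ^ 4 * (12 * τ) := h341.trans (by gcongr)
    have h5 : η ^ 3 ≤ v ^ 3 := by gcongr
    have h6 : v ^ 3 ≤ 768 * τ * N ^ 4 := by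
      rw [div_pow] at this
      have h7 : 4 ^ 3 / v ^ 3 * N ^ 4 * (12 * τ) = (768 * τ * N ^ 4) / v ^ 3 := by ring
      rw [h7, le_div_iff₀ (by positivity)] at this
      linarith
    have h8 : (28 * τ * η) ^ 4 * (768 * τ) = η ^ 3 := by
      rw [hη]; field_simp
    have h9 : (28 * τ * η) ^ 4 ≤ N ^ 4 := by
      have : (28 * τ * η) ^ 4 * (768 * τ) ≤ N ^ 4 * (768 * τ) := by linarith
      exact le_of_mul_le_mul_right this (by positivity)
    exact le_of_pow_le_pow_left₀ (by norm_num) hN h9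
  rw [e0]
  by_cases hc : η ≤ σ
  · have := big σ hc h1
    nlinarith
  · push Not at hc
    have h2 := big η le_rfl hη1
    have h3 := zeta_lip hσ h1 (h := η - σ) (by linarith) (by linarith) ht
    rw [show σ + (η - σ) = η by ring] at h3
    have h4 := norm_sub_norm_le (riemannZeta (1 + η + Complex.I * t)) (riemannZeta (1 + σ + Complex.I * t))
    rw [norm_sub_rev] at h3
    nlinarith [mul_pos hτ0 hσ]

lemma zeta_lower_small : ∃ c : ℝ, 0 < c ∧ ∀ σ t : ℝ, 0 < σ → σ ≤ 1 → |t| ≤ 1 →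
    c ≤ ‖riemannZeta (1 + σ + Complex.I * t)‖ := by
  set S : Set ℂ := (Set.Icc (1 : ℝ) 2 ×ℂ Set.Icc (-1 : ℝ) 1) \ Metric.ball 1 (1 / 2) with hS
  have hSc : IsCompact S := (isCompact_Icc.reProdIm isCompact_Icc).diff Metric.isOpen_ball
  have hcont : ContinuousOn (fun s => ‖riemannZeta s‖) S := by
    intro s hs
    have : s ≠ 1 := by
      rintro rfl; apply hs.2; simp
    exact ((differentiableAt_riemannZeta this).continuousAt.norm).continuousWithinAt
  obtain ⟨c, hc, hcS⟩ : ∃ c : ℝ, 0 < c ∧ ∀ s ∈ S, c ≤ ‖riemannZeta s‖ := by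
    by_cases hne : S.Nonempty
    · obtain ⟨s0, hs0, hmin⟩ := hSc.exists_isMinOn hne hcont
      refine ⟨‖riemannZeta s0‖, ?_, fun s hs => hmin hs⟩
      rw [norm_pos_iff]
      exact riemannZeta_ne_zero_of_one_le_re (hs0.1.1.1)
    · exact ⟨1, one_pos, fun s hs => (hne ⟨s, hs⟩).elim⟩
  refine ⟨min c 1, by positivity, fun σ t hσ h1 ht => ?_⟩
  set s := (1 : ℂ) + σ + Complex.I * t with hs
  have hre : s.re = 1 + σ := by simp [hs]
  have him : s.im = t := by simp [hs]
  by_cases hb : s ∈ Metric.ball (1 : ℂ) (1 / 2)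
  · refine (min_le_right _ _).trans ?_
    have a : 1 < s.re := by rw [hre]; linarith
    rw [mem_ball_iff_norm] at hb
    have hJ := zJ_norm a
    have d : s - 1 ≠ 0 := by
      intro h
      have : s = 1 := by linear_combination h
      rw [this] at a; simp at a
    rw [zeta_rep a, show s / (s - 1) - s * zJ s = s * (1 / (s - 1) - zJ s) by field_simp, norm_mul]
    have n1 : 1 ≤ ‖s‖ := by
      have := Complex.abs_re_le_norm s
      have h3 := le_abs_self s.re
      linarith
    have n2 : 1 ≤ ‖1 / (s - 1) - zJ s‖ := by
      have h3 := norm_sub_norm_le (1 / (s - 1)) (zJ s)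
      have h4 : 2 ≤ ‖1 / (s - 1)‖ := by
        rw [norm_div, norm_one, le_div_iff₀ (norm_pos_iff.2 d)]; linarith
      linarith
    nlinarith
  · refine (min_le_left _ _).trans (hcS s ⟨⟨?_, ?_⟩, hb⟩)
    · simp only [Set.mem_preimage, Set.mem_Icc, hre]; constructor <;> linarith
    · simp only [Set.mem_preimage, Set.mem_Icc, him]; exact abs_le.1 ht

lemma zeta_lower : ∃ c : ℝ, 0 < c ∧ ∀ σ t : ℝ, 0 < σ → σ ≤ 1 →
    c * (1 / (2 + |t|) ^ 4) ≤ ‖riemannZeta (1 + σ + Complex.I * t)‖ := by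
  obtain ⟨c, hc, h⟩ := zeta_lower_small
  refine ⟨min c (1 / (28 ^ 4 * 768)), by positivity, fun σ t hσ h1 => ?_⟩
  by_cases ht : |t| ≤ 1
  · refine le_trans ?_ (h σ t hσ h1 ht)
    have h3 : 1 / (2 + |t|) ^ 4 ≤ 1 := by
      rw [div_le_one (by positivity)]
      exact one_le_pow₀ (by linarith [abs_nonneg t])
    have : 0 < 1 / (2 + |t|) ^ 4 := by positivity
    calc _ ≤ c * 1 := by gcongr; exact min_le_left _ _
      _ = c := mul_one c
  · push Not at ht
    refine le_trans ?_ (zeta_lower_large hσ h1 ht.le)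
    gcongr
    · exact min_le_right _ _
    · linarith

end RMF

namespace RMF

lemma norm_inv_one_sub_le {z : ℂ} (hz : ‖z‖ ≤ 1 / 2) :
    ‖(1 - z)⁻¹‖ ≤ Real.exp (z.re + ‖z‖ ^ 2) := by
  have h0 : (1 - z) ≠ 0 := by
    intro h
    have : z = 1 := by linear_combination -h
    rw [this] at hz; norm_num at hz
  have h1 := Complex.norm_log_one_add_sub_self_le (z := -z) (by rw [norm_neg]; linarith)
  rw [norm_neg] at h1
  have h2 : (1 - ‖z‖)⁻¹ ≤ 2 := by
    rw [inv_le_comm₀ (by linarith) (by norm_num)]; linarith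
  have h3 : ‖z‖ ^ 2 * (1 - ‖z‖)⁻¹ / 2 ≤ ‖z‖ ^ 2 := by nlinarith [sq_nonneg ‖z‖]
  have h4 := Complex.abs_re_le_norm (Complex.log (1 + -z) - -z)
  rw [← sub_eq_add_neg] at h1 h4
  have h5 : -(Complex.log (1 - z)).re ≤ z.re + ‖z‖ ^ 2 := by
    have := (abs_le.1 (h4.trans (h1.trans h3))).1
    simp only [Complex.sub_re, Complex.neg_re] at this
    linarith
  rw [norm_inv, Complex.log_re] at *
  rw [← Real.exp_log (norm_pos_iff.2 h0), ← Real.exp_neg]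
  exact Real.exp_le_exp.2 h5

lemma re_prime_cpow {σ t : ℝ} {p : ℕ} (hp : 2 ≤ p) :
    ((p : ℂ) ^ (-(1 + σ + Complex.I * t : ℂ))).re = (p : ℝ) ^ (-(1 + σ)) * Real.cos (t * Real.log p) := by
  have hp0 : (0 : ℝ) < p := by exact_mod_cast (by omega : 0 < p)
  have hpc : (p : ℂ) ≠ 0 := by exact_mod_cast (by omega : p ≠ 0)
  rw [show (-(1 + σ + Complex.I * t) : ℂ) = ((-(1 + σ) : ℝ) : ℂ) + ((-t : ℝ) : ℂ) * Complex.I by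
    push_cast; ring, Complex.cpow_add _ _ hpc, ← Complex.ofReal_natCast, ← Complex.ofReal_cpow hp0.le,
    Complex.re_ofReal_mul, Complex.cpow_def_of_ne_zero (by exact_mod_cast hp0.ne'),
    ← Complex.ofReal_log hp0.le, ← mul_assoc, ← Complex.ofReal_mul, Complex.exp_ofReal_mul_I_re]
  rw [show Real.log p * -t = -(t * Real.log p) by ring, Real.cos_neg]

lemma norm_prime_cpow {σ t : ℝ} {p : ℕ} (hp : 2 ≤ p) :
    ‖(p : ℂ) ^ (-(1 + σ + Complex.I * t : ℂ))‖ = (p : ℝ) ^ (-(1 + σ)) := by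
  rw [Complex.norm_natCast_cpow_of_pos (by omega)]
  simp

lemma zeta_le_cos (k : ℕ) (t : ℝ) :
    ‖riemannZeta (1 + ((1 / 2 ^ k : ℝ) : ℂ) + Complex.I * t)‖ ≤
      Real.exp (∑ p ∈ Nat.primesLE (Yk k), Real.cos (t * Real.log p) / p + (9 + 2 * CP)) := by
  set σ : ℝ := 1 / 2 ^ k with hσd
  have hσ : 0 < σ := by positivity
  set s := (1 : ℂ) + σ + Complex.I * t with hs
  have hre : 1 < s.re := by simp [hs, hσ]
  have hP := (riemannZeta_eulerProduct_hasProd hre).norm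
  refine le_of_tendsto hP ?_
  set P := Nat.primesLE (Yk k) with hPd
  have hPp : ∀ p ∈ P, Nat.Prime p := fun p hp => (Nat.mem_primesLE.1 hp).2
  let P' : Finset Nat.Primes := P.subtype Nat.Prime
  filter_upwards [Filter.eventually_ge_atTop P'] with S hS
  have tr : ∀ F : ℕ → ℝ, ∑ p ∈ S, F p = ∑ p ∈ S.map ⟨fun p : Nat.Primes => (p : ℕ), Nat.Primes.coe_nat_injective⟩, F p := fun F => by
    rw [Finset.sum_map]; rfl
  set S0 : Finset ℕ := S.map ⟨fun p : Nat.Primes => (p : ℕ), Nat.Primes.coe_nat_injective⟩ with hS0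
  have hSp : ∀ p ∈ S0, Nat.Prime p := by
    intro p hp
    obtain ⟨q, -, rfl⟩ := Finset.mem_map.1 hp
    exact q.2
  have hPS : P ⊆ S0 := by
    intro p hp
    exact Finset.mem_map.2 ⟨⟨p, hPp p hp⟩, hS (Finset.mem_subtype.2 hp), rfl⟩
  calc ∏ p ∈ S, ‖(1 - (p : ℂ) ^ (-s))⁻¹‖
      ≤ ∏ p ∈ S, Real.exp ((p : ℝ) ^ (-(1 + σ)) * Real.cos (t * Real.log p) + (p : ℝ) ^ (-(3 / 2) : ℝ)) := by
        apply Finset.prod_le_prod (fun _ _ => norm_nonneg _)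
        intro p _
        have hp2 : 2 ≤ (p : ℕ) := p.2.two_le
        have hp1 : (2 : ℝ) ≤ ((p : ℕ) : ℝ) := by exact_mod_cast hp2
        have hn := norm_prime_cpow (σ := σ) (t := t) hp2
        have hle : ((p : ℕ) : ℝ) ^ (-(1 + σ)) ≤ 1 / 2 := by
          calc ((p : ℕ) : ℝ) ^ (-(1 + σ)) ≤ ((p : ℕ) : ℝ) ^ (-1 : ℝ) :=
                Real.rpow_le_rpow_of_exponent_le (by linarith) (by linarith)
            _ = 1 / p := by rw [Real.rpow_neg_one, one_div]
            _ ≤ 1 / 2 := by gcongr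
        refine (norm_inv_one_sub_le (by rw [hn]; exact hle)).trans ?_
        rw [hn, re_prime_cpow hp2]
        apply Real.exp_le_exp.2
        gcongr
        rw [← Real.rpow_natCast, ← Real.rpow_mul (by linarith)]
        apply Real.rpow_le_rpow_of_exponent_le (by linarith)
        push_cast; linarith
    _ = Real.exp (∑ p ∈ S0, ((p : ℝ) ^ (-(1 + σ)) * Real.cos (t * Real.log p) + (p : ℝ) ^ (-(3 / 2) : ℝ))) := by
        rw [← Real.exp_sum, ← tr]
    _ ≤ _ := by
        apply Real.exp_le_exp.2
        rw [Finset.sum_add_distrib, ← Finset.sum_sdiff hPS]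
        have b1 := sum_32_le S0
        have b2 : ∑ p ∈ S0 \ P, (p : ℝ) ^ (-(1 + σ)) * Real.cos (t * Real.log p) ≤
            ∑ p ∈ S0 \ P, (p : ℝ) ^ (-(1 + σ)) :=
          Finset.sum_le_sum fun p _ => mul_le_of_le_one_right (by positivity) (Real.cos_le_one _)
        have b3 : ∑ p ∈ S0 \ P, (p : ℝ) ^ (-(1 + σ)) + ∑ p ∈ P, (p : ℝ) ^ (-(1 + σ)) ≤
            Real.log (1 + 1 / σ) + CP := by
          rw [Finset.sum_sdiff hPS]; exact sum_prime_rpow_le hσ S0 hSp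
        have b4 : ∑ p ∈ P, 1 / (p : ℝ) ≤ ∑ p ∈ P, (p : ℝ) ^ (-(1 + σ)) + σ * ∑ p ∈ P, Real.log p / p := by
          rw [Finset.mul_sum, ← Finset.sum_add_distrib]
          exact Finset.sum_le_sum fun p hp => inv_le_rpow (hPp p hp).one_lt.le
        have b5 := sum_log_div_Yk k
        have b6 : σ * ∑ p ∈ P, Real.log p / p ≤ 3 := by
          calc σ * ∑ p ∈ P, Real.log p / p ≤ σ * (3 * 2 ^ k) := by gcongr
            _ = 3 := by rw [hσd]; field_simp
        have b7 := sum_inv_ge k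
        have b8 : ∑ p ∈ P, (p : ℝ) ^ (-(1 + σ)) * Real.cos (t * Real.log p) ≤
            ∑ p ∈ P, Real.cos (t * Real.log p) / p + σ * ∑ p ∈ P, Real.log p / p := by
          rw [Finset.mul_sum, ← Finset.sum_add_distrib]
          refine Finset.sum_le_sum fun p hp => ?_
          have hp1 : (1 : ℝ) ≤ p := by exact_mod_cast (hPp p hp).one_lt.le
          have c1 := inv_le_rpow (σ := σ) (hPp p hp).one_lt.le
          have c2 : (p : ℝ) ^ (-(1 + σ)) ≤ 1 / p := by
            rw [one_div, ← Real.rpow_neg_one]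
            exact Real.rpow_le_rpow_of_exponent_le hp1 (by linarith)
          rw [div_eq_mul_one_div (Real.cos _)]
          nlinarith [Real.neg_one_le_cos (t * Real.log p), Real.cos_le_one (t * Real.log p)]
        have b9 : Real.log (1 + 1 / σ) ≤ Real.log 2 + k * Real.log 2 := by
          rw [← Real.log_pow, ← Real.log_mul (by norm_num) (by positivity)]
          apply Real.log_le_log (by positivity)
          rw [hσd, one_div_one_div]
          have : (1 : ℝ) ≤ 2 ^ k := one_le_pow₀ (by norm_num)
          linarith
        have := Real.log_two_lt_d9
        linarith

/-- N5 -/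
lemma cos_sum_ge : ∃ C : ℝ, 0 < C ∧ ∀ (k : ℕ) (t : ℝ),
    -C * (1 + Real.log (2 + |t|)) ≤ ∑ p ∈ Nat.primesLE (Yk k), Real.cos (t * Real.log p) / p := by
  obtain ⟨c, hc, h⟩ := zeta_lower
  refine ⟨|Real.log c| + 13 + 2 * CP, by have := CP_nonneg; positivity, fun k t => ?_⟩
  have h1 := (h (1 / 2 ^ k) t (by positivity) (by
    rw [div_le_one (by positivity)]; exact one_le_pow₀ (by norm_num))).trans (zeta_le_cos k t)
  have ht : 0 < 2 + |t| := by positivity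
  have h2 := Real.log_le_log (by positivity) h1
  rw [Real.log_exp, Real.log_mul hc.ne' (by positivity), one_div, Real.log_inv, Real.log_pow] at h2
  have h3 := neg_abs_le (Real.log c)
  have h4 : 0 ≤ Real.log (2 + |t|) := Real.log_nonneg (by linarith [abs_nonneg t])
  have h5 := CP_nonneg
  have h6 := abs_nonneg (Real.log c)
  push_cast at h2
  nlinarith [mul_nonneg h6 h4, mul_nonneg h5 h4]

end RMF

namespace RMF
open scoped FourierTransform

/-- Poisson kernel -/
def pk (δ u : ℝ) : ℝ := δ / (Real.pi * (δ ^ 2 + u ^ 2))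

lemma pk_nonneg {δ : ℝ} (hδ : 0 < δ) (u : ℝ) : 0 ≤ pk δ u := by unfold pk; positivity

lemma pk_cont {δ : ℝ} (hδ : 0 < δ) : Continuous (pk δ) := by
  unfold pk
  refine continuous_const.div (by fun_prop) fun u => ?_
  positivity

lemma pk_int {δ : ℝ} (hδ : 0 < δ) : Integrable (pk δ) := by
  have h := (integrable_inv_one_add_sq.comp_div hδ.ne').const_mul (1 / (Real.pi * δ))
  refine h.congr (ae_of_all _ fun u => ?_)
  unfold pk
  field_simp

lemma exp_abs_integrable {δ : ℝ} (hδ : 0 < δ) (w : ℝ) :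
    IntegrableOn (fun x : ℝ => Complex.exp ((-2 * Real.pi * x * w : ℝ) * Complex.I) • ((Real.exp (-δ * |x|) : ℝ) : ℂ)) (Set.Ioi 0) ∧
    IntegrableOn (fun x : ℝ => Complex.exp ((-2 * Real.pi * x * w : ℝ) * Complex.I) • ((Real.exp (-δ * |x|) : ℝ) : ℂ)) (Set.Iic 0) ∧
    (∫ x in Set.Ioi (0:ℝ), Complex.exp ((-2 * Real.pi * x * w : ℝ) * Complex.I) • ((Real.exp (-δ * |x|) : ℝ) : ℂ)) = 1 / (δ + 2 * Real.pi * w * Complex.I) ∧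
    (∫ x in Set.Iic (0:ℝ), Complex.exp ((-2 * Real.pi * x * w : ℝ) * Complex.I) • ((Real.exp (-δ * |x|) : ℝ) : ℂ)) = 1 / (δ - 2 * Real.pi * w * Complex.I) := by
  have e1 : Set.EqOn (fun x : ℝ => Complex.exp ((-2 * Real.pi * x * w : ℝ) * Complex.I) • ((Real.exp (-δ * |x|) : ℝ) : ℂ))
      (fun x : ℝ => Complex.exp ((-(δ + 2 * Real.pi * w * Complex.I)) * x)) (Set.Ioi 0) := by
    intro x hx
    simp only [smul_eq_mul, abs_of_pos (show 0 < x from hx)]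
    rw [Complex.ofReal_exp, ← Complex.exp_add]; congr 1; push_cast; ring
  have e2 : Set.EqOn (fun x : ℝ => Complex.exp ((-2 * Real.pi * x * w : ℝ) * Complex.I) • ((Real.exp (-δ * |x|) : ℝ) : ℂ))
      (fun x : ℝ => Complex.exp ((δ - 2 * Real.pi * w * Complex.I) * x)) (Set.Iic 0) := by
    intro x hx
    simp only [smul_eq_mul, abs_of_nonpos (show x ≤ 0 from hx)]
    rw [Complex.ofReal_exp, ← Complex.exp_add]; congr 1; push_cast; ring
  have r1 : (-((δ : ℂ) + 2 * Real.pi * w * Complex.I)).re < 0 := by simp [hδ]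
  have r2 : 0 < ((δ : ℂ) - 2 * Real.pi * w * Complex.I).re := by simp [hδ]
  refine ⟨(integrableOn_congr_fun e1 measurableSet_Ioi).2 (integrableOn_exp_mul_complex_Ioi r1 0),
    (integrableOn_congr_fun e2 measurableSet_Iic).2 (integrableOn_exp_mul_complex_Iic r2 0), ?_, ?_⟩
  · rw [setIntegral_congr_fun measurableSet_Ioi e1, integral_exp_mul_complex_Ioi r1]
    rw [neg_div_neg_eq]; simp
  · rw [setIntegral_congr_fun measurableSet_Iic e2, integral_exp_mul_complex_Iic r2]
    simp

lemma fourier_exp_abs {δ : ℝ} (hδ : 0 < δ) :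
    𝓕 (fun x : ℝ => ((Real.exp (-δ * |x|) : ℝ) : ℂ)) = fun w : ℝ => ((2 * Real.pi * pk δ (2 * Real.pi * w) : ℝ) : ℂ) := by
  ext w
  rw [Real.fourier_real_eq_integral_exp_smul]
  obtain ⟨a, b, c, d⟩ := exp_abs_integrable hδ w
  have hU : Set.Iic (0 : ℝ) ∪ Set.Ioi 0 = Set.univ := Set.Iic_union_Ioi
  rw [← setIntegral_univ, ← hU, setIntegral_union (Set.Iic_disjoint_Ioi le_rfl) measurableSet_Ioi b a, c, d]
  have n1 : (δ : ℂ) + 2 * Real.pi * w * Complex.I ≠ 0 := by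
    intro h; have := congrArg Complex.re h; simp at this; linarith
  have n2 : (δ : ℂ) - 2 * Real.pi * w * Complex.I ≠ 0 := by
    intro h; have := congrArg Complex.re h; simp at this; linarith
  have n3 : (δ : ℂ) ^ 2 + (2 * Real.pi * w) ^ 2 ≠ 0 := by
    have : ((δ ^ 2 + (2 * Real.pi * w) ^ 2 : ℝ) : ℂ) ≠ 0 := by
      rw [Complex.ofReal_ne_zero]; positivity
    push_cast at this; exact this
  have npi : (Real.pi : ℂ) ≠ 0 := by exact_mod_cast Real.pi_ne_zero
  unfold pk
  push_cast
  have n4 : (δ : ℂ) ^ 2 + (2 * Real.pi * w) ^ 2 =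
      ((δ : ℂ) + 2 * Real.pi * w * Complex.I) * ((δ : ℂ) - 2 * Real.pi * w * Complex.I) := by
    ring_nf; rw [Complex.I_sq]; ring
  rw [n4]
  field_simp
  ring

lemma pk_exp {δ : ℝ} (hδ : 0 < δ) (v : ℝ) :
    ∫ u : ℝ, Complex.exp (((u * v : ℝ) : ℂ) * Complex.I) * ((pk δ u : ℝ) : ℂ) = ((Real.exp (-δ * |v|) : ℝ) : ℂ) := by
  have hcont : Continuous (fun x : ℝ => ((Real.exp (-δ * |x|) : ℝ) : ℂ)) := by fun_prop
  have hInteg : Integrable (fun x : ℝ => ((Real.exp (-δ * |x|) : ℝ) : ℂ)) := by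
    obtain ⟨a, b, -, -⟩ := exp_abs_integrable hδ 0
    have hU : Set.Iic (0 : ℝ) ∪ Set.Ioi 0 = Set.univ := Set.Iic_union_Ioi
    rw [← integrableOn_univ, ← hU]
    refine IntegrableOn.union (b.congr_fun ?_ measurableSet_Iic) (a.congr_fun ?_ measurableSet_Ioi) <;>
    · intro x _; simp
  have hF : Integrable (𝓕 (fun x : ℝ => ((Real.exp (-δ * |x|) : ℝ) : ℂ))) := by
    rw [fourier_exp_abs hδ]
    apply Integrable.ofReal
    exact ((pk_int hδ).comp_mul_left' (by positivity : (2 * Real.pi) ≠ 0)).const_mul _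
  have h := congrFun (hcont.fourierInv_fourier_eq hInteg hF) v
  rw [Real.fourierInv_eq', fourier_exp_abs hδ] at h
  rw [← h]
  have h2 := Measure.integral_comp_mul_left
    (fun u : ℝ => Complex.exp (((u * v : ℝ) : ℂ) * Complex.I) * ((pk δ u : ℝ) : ℂ)) (2 * Real.pi)
  rw [abs_of_pos (by positivity)] at h2
  have h3 : ∫ u : ℝ, Complex.exp (((u * v : ℝ) : ℂ) * Complex.I) * ((pk δ u : ℝ) : ℂ) =
      (2 * Real.pi) • ∫ x : ℝ, Complex.exp (((2 * Real.pi * x * v : ℝ) : ℂ) * Complex.I) * ((pk δ (2 * Real.pi * x) : ℝ) : ℂ) := by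
    rw [h2, smul_smul, mul_inv_cancel₀ (by positivity), one_smul]
  rw [h3, ← integral_smul]
  congr 1
  ext x
  simp only [smul_eq_mul, Complex.real_smul, RCLike.inner_apply, conj_trivial]
  push_cast
  ring_nf

lemma pk_bdd_int {δ : ℝ} (hδ : 0 < δ) {g : ℝ → ℝ} (hg : Continuous g) {M : ℝ} (hM : ∀ u, |g u| ≤ M) :
    Integrable (fun u => pk δ u * g u) := by
  refine ((pk_int hδ).mul_const M).mono' ((pk_cont hδ).mul hg).aestronglyMeasurable (ae_of_all _ fun u => ?_)
  rw [Real.norm_eq_abs, abs_mul, abs_of_nonneg (pk_nonneg hδ u)]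
  exact mul_le_mul_of_nonneg_left (hM u) (pk_nonneg hδ u)

lemma pk_exp_int {δ : ℝ} (hδ : 0 < δ) (v : ℝ) :
    Integrable (fun u : ℝ => Complex.exp (((u * v : ℝ) : ℂ) * Complex.I) * ((pk δ u : ℝ) : ℂ)) := by
  refine (pk_int hδ).mono' ?_ (ae_of_all _ fun u => ?_)
  · apply Continuous.aestronglyMeasurable
    have := pk_cont hδ
    fun_prop
  · rw [norm_mul, Complex.norm_exp_ofReal_mul_I, one_mul, Complex.norm_real, Real.norm_of_nonneg (pk_nonneg hδ u)]

lemma pk_cos {δ : ℝ} (hδ : 0 < δ) (v : ℝ) : ∫ u : ℝ, pk δ u * Real.cos (u * v) = Real.exp (-δ * |v|) := by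
  have h := congrArg Complex.re (pk_exp hδ v)
  rw [Complex.ofReal_re, ← RCLike.re_eq_complex_re, ← integral_re (pk_exp_int hδ v)] at h
  rw [← h]
  congr 1
  ext u
  rw [RCLike.re_eq_complex_re, mul_comm (Complex.exp _), Complex.re_ofReal_mul, Complex.exp_ofReal_mul_I_re]

lemma pk_sin {δ : ℝ} (hδ : 0 < δ) (v : ℝ) : ∫ u : ℝ, pk δ u * Real.sin (u * v) = 0 := by
  have h := congrArg Complex.im (pk_exp hδ v)
  rw [Complex.ofReal_im, ← RCLike.im_eq_complex_im, ← integral_im (pk_exp_int hδ v)] at h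
  rw [← h]
  congr 1
  ext u
  rw [RCLike.im_eq_complex_im, mul_comm (Complex.exp _), Complex.im_ofReal_mul, Complex.exp_ofReal_mul_I_im]

lemma pk_one {δ : ℝ} (hδ : 0 < δ) : ∫ u : ℝ, pk δ u = 1 := by
  have := pk_cos hδ 0
  simpa using this

end RMF

namespace RMF

section trig
variable {ι : Type*}

def tc (I : Finset ι) (a v : ι → ℝ) (t : ℝ) : ℝ := ∑ i ∈ I, a i * Real.cos (t * v i)
def ts (I : Finset ι) (a v : ι → ℝ) (t : ℝ) : ℝ := ∑ i ∈ I, a i * Real.sin (t * v i)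

lemma tc_cont (I : Finset ι) (a v : ι → ℝ) : Continuous (tc I a v) := by unfold tc; fun_prop
lemma ts_cont (I : Finset ι) (a v : ι → ℝ) : Continuous (ts I a v) := by unfold ts; fun_prop

lemma tc_bdd (I : Finset ι) (a v : ι → ℝ) (t : ℝ) : |tc I a v t| ≤ ∑ i ∈ I, |a i| := by
  unfold tc
  refine (Finset.abs_sum_le_sum_abs _ _).trans (Finset.sum_le_sum fun i _ => ?_)
  rw [abs_mul]; exact mul_le_of_le_one_right (abs_nonneg _) (Real.abs_cos_le_one _)
lemma ts_bdd (I : Finset ι) (a v : ι → ℝ) (t : ℝ) : |ts I a v t| ≤ ∑ i ∈ I, |a i| := by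
  unfold ts
  refine (Finset.abs_sum_le_sum_abs _ _).trans (Finset.sum_le_sum fun i _ => ?_)
  rw [abs_mul]; exact mul_le_of_le_one_right (abs_nonneg _) (Real.abs_sin_le_one _)

lemma tcts_eq (I : Finset ι) (a v : ι → ℝ) (t : ℝ) :
    tc I a v t ^ 2 + ts I a v t ^ 2 = ∑ i ∈ I, ∑ j ∈ I, a i * a j * Real.cos (t * (v i - v j)) := by
  unfold tc ts
  rw [sq, sq, Finset.sum_mul_sum, Finset.sum_mul_sum, ← Finset.sum_add_distrib]
  refine Finset.sum_congr rfl fun i _ => ?_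
  rw [← Finset.sum_add_distrib]
  refine Finset.sum_congr rfl fun j _ => ?_
  rw [mul_sub, Real.cos_sub]; ring

lemma trig_A {δ : ℝ} (hδ : 0 < δ) (I : Finset ι) (a v : ι → ℝ) :
    ∫ t, pk δ t * (tc I a v t ^ 2 + ts I a v t ^ 2) =
      ∑ i ∈ I, ∑ j ∈ I, a i * a j * Real.exp (-δ * |v i - v j|) := by
  simp_rw [tcts_eq, Finset.mul_sum]
  have hInteg : ∀ i j, Integrable (fun t => pk δ t * (a i * a j * Real.cos (t * (v i - v j)))) := fun i j =>
    pk_bdd_int hδ (by fun_prop) (M := |a i * a j|) fun u => by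
      rw [abs_mul]; exact mul_le_of_le_one_right (abs_nonneg _) (Real.abs_cos_le_one _)
  rw [integral_finsetSum _ fun i _ => integrable_finsetSum _ fun j _ => hInteg i j]
  refine Finset.sum_congr rfl fun i _ => ?_
  rw [integral_finsetSum _ fun j _ => hInteg i j]
  refine Finset.sum_congr rfl fun j _ => ?_
  rw [← pk_cos hδ, ← integral_const_mul]
  congr 1; ext t; ring

lemma pk_jensen {δ : ℝ} (hδ : 0 < δ) {g : ℝ → ℝ} (hg : Continuous g) {M : ℝ} (hM : ∀ u, |g u| ≤ M) :
    (∫ u, pk δ u * g u) ^ 2 ≤ ∫ u, pk δ u * g u ^ 2 := by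
  set c := ∫ u, pk δ u * g u with hc
  have i1 := pk_bdd_int hδ hg hM
  have i2 : Integrable (fun u => pk δ u * g u ^ 2) := pk_bdd_int hδ (by fun_prop) (M := M ^ 2) fun u => by
    rw [abs_pow]; exact pow_le_pow_left₀ (abs_nonneg _) (hM u) 2
  have h0 : 0 ≤ ∫ u, pk δ u * (g u - c) ^ 2 :=
    integral_nonneg fun u => mul_nonneg (pk_nonneg hδ u) (sq_nonneg _)
  have h1 : ∫ u, pk δ u * (g u - c) ^ 2 = (∫ u, pk δ u * g u ^ 2) - 2 * c * c + c ^ 2 * 1 := by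
    have e : ∀ u, pk δ u * (g u - c) ^ 2 = pk δ u * g u ^ 2 - 2 * c * (pk δ u * g u) + c ^ 2 * pk δ u := fun u => by ring
    simp_rw [e]
    have i3 : Integrable (fun u => pk δ u * g u ^ 2 - 2 * c * (pk δ u * g u)) := i2.sub (i1.const_mul _)
    rw [integral_add i3 ((pk_int hδ).const_mul _), integral_sub i2 (i1.const_mul _),
      integral_const_mul, integral_const_mul, pk_one hδ]
  rw [h1] at h0
  nlinarith

lemma trig_B {δ : ℝ} (hδ : 0 < δ) (I : Finset ι) (a v : ι → ℝ) (hv : ∀ i ∈ I, 0 ≤ v i) (t : ℝ) :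
    tc I (fun i => a i * Real.exp (-δ * v i)) v t ^ 2 + ts I (fun i => a i * Real.exp (-δ * v i)) v t ^ 2 ≤
      ∫ u, pk δ u * (tc I a v (t + u) ^ 2 + ts I a v (t + u) ^ 2) := by
  have ic : ∀ w, Integrable (fun u => pk δ u * Real.cos (u * w)) := fun w =>
    pk_bdd_int hδ (by fun_prop) (M := 1) fun u => Real.abs_cos_le_one _
  have is : ∀ w, Integrable (fun u => pk δ u * Real.sin (u * w)) := fun w =>
    pk_bdd_int hδ (by fun_prop) (M := 1) fun u => Real.abs_sin_le_one _
  have e1 : ∫ u, pk δ u * tc I a v (t + u) = tc I (fun i => a i * Real.exp (-δ * v i)) v t := by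
    have : ∀ u, pk δ u * tc I a v (t + u) = ∑ i ∈ I, (a i * Real.cos (t * v i) * (pk δ u * Real.cos (u * v i)) -
        a i * Real.sin (t * v i) * (pk δ u * Real.sin (u * v i))) := fun u => by
      unfold tc; rw [Finset.mul_sum]
      refine Finset.sum_congr rfl fun i _ => ?_
      rw [add_mul, Real.cos_add]; ring
    simp_rw [this]
    have i3 : ∀ i, Integrable (fun u => a i * Real.cos (t * v i) * (pk δ u * Real.cos (u * v i)) -
        a i * Real.sin (t * v i) * (pk δ u * Real.sin (u * v i))) := fun i =>
      ((ic _).const_mul _).sub ((is _).const_mul _)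
    rw [integral_finsetSum _ fun i _ => i3 i]
    unfold tc
    refine Finset.sum_congr rfl fun i hi => ?_
    rw [integral_sub ((ic _).const_mul _) ((is _).const_mul _), integral_const_mul, integral_const_mul,
      pk_cos hδ, pk_sin hδ, abs_of_nonneg (hv i hi)]
    ring
  have e2 : ∫ u, pk δ u * ts I a v (t + u) = ts I (fun i => a i * Real.exp (-δ * v i)) v t := by
    have : ∀ u, pk δ u * ts I a v (t + u) = ∑ i ∈ I, (a i * Real.sin (t * v i) * (pk δ u * Real.cos (u * v i)) +
        a i * Real.cos (t * v i) * (pk δ u * Real.sin (u * v i))) := fun u => by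
      unfold ts; rw [Finset.mul_sum]
      refine Finset.sum_congr rfl fun i _ => ?_
      rw [add_mul, Real.sin_add]; ring
    simp_rw [this]
    have i3 : ∀ i, Integrable (fun u => a i * Real.sin (t * v i) * (pk δ u * Real.cos (u * v i)) +
        a i * Real.cos (t * v i) * (pk δ u * Real.sin (u * v i))) := fun i =>
      ((ic _).const_mul _).add ((is _).const_mul _)
    rw [integral_finsetSum _ fun i _ => i3 i]
    unfold ts
    refine Finset.sum_congr rfl fun i hi => ?_
    rw [integral_add ((ic _).const_mul _) ((is _).const_mul _), integral_const_mul, integral_const_mul,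
      pk_cos hδ, pk_sin hδ, abs_of_nonneg (hv i hi)]
    ring
  have c1 : Continuous fun u => tc I a v (t + u) := (tc_cont I a v).comp (by fun_prop)
  have c2 : Continuous fun u => ts I a v (t + u) := (ts_cont I a v).comp (by fun_prop)
  have j1 := pk_jensen hδ c1 (fun u => tc_bdd I a v (t + u))
  have j2 := pk_jensen hδ c2 (fun u => ts_bdd I a v (t + u))
  rw [e1] at j1
  rw [e2] at j2
  refine (add_le_add j1 j2).trans (le_of_eq ?_)
  rw [← integral_add]
  · congr 1; ext u; ring
  · exact pk_bdd_int hδ (by fun_prop) (M := (∑ i ∈ I, |a i|) ^ 2) fun u => by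
      rw [abs_pow]; exact pow_le_pow_left₀ (abs_nonneg _) (tc_bdd _ _ _ _) 2
  · exact pk_bdd_int hδ (by fun_prop) (M := (∑ i ∈ I, |a i|) ^ 2) fun u => by
      rw [abs_pow]; exact pow_le_pow_left₀ (abs_nonneg _) (ts_bdd _ _ _ _) 2

lemma pk_C {δ : ℝ} (hδ : 0 < δ) (t u : ℝ) :
    pk δ (u - t) ≤ 2 * ((1 / 4 + 2 * t ^ 2) / δ + 2 * δ) * pk (1 / 2) u := by
  unfold pk
  have hpi := Real.pi_pos
  have e : 2 * ((1 / 4 + 2 * t ^ 2) / δ + 2 * δ) * (1 / 2 / (Real.pi * ((1 / 2) ^ 2 + u ^ 2))) =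
     (((1 / 4 + 2 * t ^ 2) + 2 * δ ^ 2) / δ) / (Real.pi * (1 / 4 + u ^ 2)) := by
    field_simp; ring
  rw [e, div_div, div_le_div_iff₀ (by positivity) (by positivity)]
  have key : δ ^ 2 * (1 / 4 + u ^ 2) ≤ ((1 / 4 + 2 * t ^ 2) + 2 * δ ^ 2) * (δ ^ 2 + (u - t) ^ 2) := by
    have : 1 / 4 + u ^ 2 ≤ 1 / 4 + 2 * t ^ 2 + 2 * (u - t) ^ 2 := by nlinarith [sq_nonneg (u - 2 * t)]
    have h2 := mul_le_mul_of_nonneg_left this (sq_nonneg δ)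
    nlinarith [mul_nonneg (show 0 ≤ 1 / 4 + 2 * t ^ 2 by positivity) (sq_nonneg (u - t)), sq_nonneg (δ ^ 2)]
  nlinarith [mul_le_mul_of_nonneg_left key hpi.le]

lemma trig_BC {δ : ℝ} (hδ : 0 < δ) (I : Finset ι) (a v : ι → ℝ) (hv : ∀ i ∈ I, 0 ≤ v i) (t : ℝ) :
    tc I (fun i => a i * Real.exp (-δ * v i)) v t ^ 2 + ts I (fun i => a i * Real.exp (-δ * v i)) v t ^ 2 ≤
      2 * ((1 / 4 + 2 * t ^ 2) / δ + 2 * δ) * ∫ u, pk (1 / 2) u * (tc I a v u ^ 2 + ts I a v u ^ 2) := by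
  refine (trig_B hδ I a v hv t).trans ?_
  have h1 := integral_add_left_eq_self (μ := volume) (fun u => pk δ (u - t) * (tc I a v u ^ 2 + ts I a v u ^ 2)) t
  simp only [add_sub_cancel_left] at h1
  rw [h1, ← integral_const_mul]
  have c1 := tc_cont I a v
  have c2 := ts_cont I a v
  have hb : ∀ u, |tc I a v u ^ 2 + ts I a v u ^ 2| ≤ 2 * (∑ i ∈ I, |a i|) ^ 2 := fun u => by
    rw [abs_of_nonneg (by positivity), ← sq_abs (tc I a v u), ← sq_abs (ts I a v u)]
    have := pow_le_pow_left₀ (abs_nonneg _) (tc_bdd I a v u) 2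
    have := pow_le_pow_left₀ (abs_nonneg _) (ts_bdd I a v u) 2
    linarith
  refine integral_mono ?_ ?_ fun u => ?_
  · have := (pk_bdd_int hδ (g := fun u => tc I a v (t + u) ^ 2 + ts I a v (t + u) ^ 2) (by fun_prop) fun u => hb (t + u))
    have h2 := this.comp_sub_right t
    refine h2.congr (ae_of_all _ fun u => ?_)
    simp
  · exact (pk_bdd_int (by norm_num) (by fun_prop) hb).const_mul _
  · simp only
    rw [← mul_assoc]
    exact mul_le_mul_of_nonneg_right (pk_C hδ t u) (by positivity)

end trig

lemma prod_trig (s : Finset ℕ) (x θ : ℕ → ℝ) (t : ℝ) :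
    ∏ p ∈ s, (1 + 2 * x p * Real.cos (t * θ p) + x p ^ 2) =
      tc s.powerset (fun T => ∏ p ∈ T, x p) (fun T => ∑ p ∈ T, θ p) t ^ 2 +
      ts s.powerset (fun T => ∏ p ∈ T, x p) (fun T => ∑ p ∈ T, θ p) t ^ 2 := by
  set Z : ℂ := ∏ p ∈ s, (1 + (x p : ℂ) * Complex.exp (((t * θ p : ℝ) : ℂ) * Complex.I)) with hZ
  have h1 : Complex.normSq Z = ∏ p ∈ s, (1 + 2 * x p * Real.cos (t * θ p) + x p ^ 2) := by
    rw [hZ, map_prod]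
    refine Finset.prod_congr rfl fun p _ => ?_
    rw [Complex.normSq_apply, Complex.add_re, Complex.add_im, Complex.re_ofReal_mul, Complex.im_ofReal_mul,
      Complex.exp_ofReal_mul_I_re, Complex.exp_ofReal_mul_I_im, Complex.one_re, Complex.one_im]
    have := Real.sin_sq_add_cos_sq (t * θ p)
    linear_combination x p ^ 2 * this
  have h2 : Z = ∑ T ∈ s.powerset, ((∏ p ∈ T, x p : ℝ) : ℂ) * Complex.exp (((t * ∑ p ∈ T, θ p : ℝ) : ℂ) * Complex.I) := by
    rw [hZ, Finset.prod_one_add]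
    refine Finset.sum_congr rfl fun T _ => ?_
    rw [Finset.prod_mul_distrib, ← Complex.exp_sum, Complex.ofReal_prod]
    congr 2
    rw [← Finset.sum_mul, Finset.mul_sum, Complex.ofReal_sum]
  have hre : Z.re = tc s.powerset (fun T => ∏ p ∈ T, x p) (fun T => ∑ p ∈ T, θ p) t := by
    rw [h2, Complex.re_sum]; unfold tc
    refine Finset.sum_congr rfl fun T _ => ?_
    rw [Complex.re_ofReal_mul, Complex.exp_ofReal_mul_I_re]
  have him : Z.im = ts s.powerset (fun T => ∏ p ∈ T, x p) (fun T => ∑ p ∈ T, θ p) t := by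
    rw [h2, Complex.im_sum]; unfold ts
    refine Finset.sum_congr rfl fun T _ => ?_
    rw [Complex.im_ofReal_mul, Complex.exp_ofReal_mul_I_im]
  rw [← h1, Complex.normSq_apply, hre, him]; ring

/-- squared Euler product at `1/2+δ+it`. -/
def Wd (δ : ℝ) (s : Finset ℕ) (A : Finset ℕ) (t : ℝ) : ℝ :=
  ∏ p ∈ s, (1 + 2 * (chi A p * (p : ℝ) ^ (-(1 / 2 + δ))) * Real.cos (t * Real.log p) +
    (chi A p * (p : ℝ) ^ (-(1 / 2 + δ))) ^ 2)

/-- the mass integral -/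
def JJ (s : Finset ℕ) (A : Finset ℕ) : ℝ := ∫ t, pk (1 / 2) t * Wd 0 s A t

lemma Wd_nonneg (δ : ℝ) (s A : Finset ℕ) (t : ℝ) : 0 ≤ Wd δ s A t := by
  unfold Wd; rw [prod_trig s (fun p => chi A p * (p : ℝ) ^ (-(1 / 2 + δ))) (fun p => Real.log p)]; positivity

lemma Wd_cont (δ : ℝ) (s A : Finset ℕ) : Continuous (Wd δ s A) := by unfold Wd; fun_prop

lemma JJ_nonneg (s A : Finset ℕ) : 0 ≤ JJ s A :=
  integral_nonneg fun t => mul_nonneg (pk_nonneg (by norm_num) t) (Wd_nonneg _ _ _ _)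

lemma Wd_le_JJ {δ : ℝ} (hδ : 0 < δ) (s A : Finset ℕ) (hs : ∀ p ∈ s, 1 ≤ p) (t : ℝ) :
    Wd δ s A t ≤ 2 * ((1 / 4 + 2 * t ^ 2) / δ + 2 * δ) * JJ s A := by
  have h := trig_BC hδ s.powerset (fun T => ∏ p ∈ T, (chi A p * (p : ℝ) ^ (-(1 / 2 + 0) : ℝ)))
    (fun T => ∑ p ∈ T, Real.log p) (fun T hT => Finset.sum_nonneg fun p hp =>
      Real.log_nonneg (by exact_mod_cast hs p (Finset.mem_powerset.1 hT hp))) t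
  unfold JJ Wd
  simp_rw [prod_trig s (fun p => chi A p * (p : ℝ) ^ (-(1 / 2 + 0) : ℝ)) (fun p => Real.log p)]
  refine le_trans (le_of_eq ?_) h
  rw [prod_trig s (fun p => chi A p * (p : ℝ) ^ (-(1 / 2 + δ) : ℝ)) (fun p => Real.log p)]
  have e : ∀ T ∈ s.powerset, ∏ p ∈ T, (chi A p * (p : ℝ) ^ (-(1 / 2 + δ) : ℝ)) =
      (∏ p ∈ T, (chi A p * (p : ℝ) ^ (-(1 / 2 + 0) : ℝ))) * Real.exp (-δ * ∑ p ∈ T, Real.log p) := fun T hT => by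
    rw [Finset.mul_sum, Real.exp_sum, ← Finset.prod_mul_distrib]
    refine Finset.prod_congr rfl fun p hp => ?_
    have hp0 : (0 : ℝ) < p := by exact_mod_cast hs p (Finset.mem_powerset.1 hT hp)
    rw [mul_assoc]
    congr 1
    rw [show -(1 / 2 + δ) = -(1 / 2 + 0) + -δ by ring, Real.rpow_add hp0, Real.rpow_def_of_pos hp0 (-δ)]
    rw [mul_comm (Real.log _)]
  unfold tc ts
  congr 2
  · exact Finset.sum_congr rfl fun T hT => by simp only [e T hT]
  · exact Finset.sum_congr rfl fun T hT => by simp only [e T hT]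

end RMF

namespace RMF

/-- deterministic model of the multiplicative function. -/
def fA (A : Finset ℕ) (n : ℕ) : ℝ := if Squarefree n then ∏ p ∈ n.primeFactors, chi A p else 0

def SA (A : Finset ℕ) (m : ℕ) : ℝ := ∑ n ∈ Finset.Icc 1 m, fA A n

lemma tele (a M : ℕ) (ha : 1 ≤ a) (h : a ≤ M + 1) :
    ∑ m ∈ Finset.Icc 1 M, (if a ≤ m then 1 / ((m : ℝ) * (m + 1)) else 0) = 1 / (a : ℝ) - 1 / (M + 1) := by
  induction M with
  | zero =>
    have : a = 1 := by omega
    subst this; simp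
  | succ M ih =>
    rw [Finset.sum_Icc_succ_top (by omega)]
    by_cases h1 : a ≤ M + 1
    · rw [ih h1, if_pos h1]
      have : (a : ℝ) ≠ 0 := by positivity
      push_cast
      field_simp
      ring
    · have h2 : a = M + 2 := by omega
      rw [if_neg h1, Finset.sum_eq_zero]
      · subst h2; push_cast; ring
      · intro m hm
        rw [if_neg]; have := (Finset.mem_Icc.1 hm).2; omega

lemma abel_max {ι : Type*} (I : Finset ι) (c : ι → ℝ) (n : ι → ℕ) (hn : ∀ i ∈ I, 1 ≤ n i) (N : ℕ) :
    ∑ m ∈ Finset.Icc 1 N, (∑ i ∈ I, if n i ≤ m then c i else 0) ^ 2 / ((m : ℝ) * (m + 1)) ≤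
      ∑ i ∈ I, ∑ j ∈ I, c i * c j * (1 / ((max (n i) (n j) : ℕ) : ℝ)) := by
  set M := N + ∑ i ∈ I, n i with hM
  have hnM : ∀ i ∈ I, n i ≤ M := fun i hi => by
    have := Finset.single_le_sum (f := n) (fun _ _ => Nat.zero_le _) hi
    omega
  have h1 : ∑ m ∈ Finset.Icc 1 N, (∑ i ∈ I, if n i ≤ m then c i else 0) ^ 2 / ((m : ℝ) * (m + 1)) ≤
      ∑ m ∈ Finset.Icc 1 M, (∑ i ∈ I, if n i ≤ m then c i else 0) ^ 2 / ((m : ℝ) * (m + 1)) :=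
    Finset.sum_le_sum_of_subset_of_nonneg (Finset.Icc_subset_Icc le_rfl (by omega))
      fun _ _ _ => by positivity
  refine h1.trans ?_
  have h2 : ∑ m ∈ Finset.Icc 1 M, (∑ i ∈ I, if n i ≤ m then c i else 0) ^ 2 / ((m : ℝ) * (m + 1)) =
      ∑ i ∈ I, ∑ j ∈ I, c i * c j * ∑ m ∈ Finset.Icc 1 M,
        (if max (n i) (n j) ≤ m then 1 / ((m : ℝ) * (m + 1)) else 0) := by
    simp_rw [Finset.mul_sum]
    rw [Finset.sum_congr rfl fun i _ => Finset.sum_comm, Finset.sum_comm]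
    refine Finset.sum_congr rfl fun m _ => ?_
    rw [sq, Finset.sum_mul_sum, Finset.sum_div]
    refine Finset.sum_congr rfl fun i _ => ?_
    rw [Finset.sum_div]
    refine Finset.sum_congr rfl fun j _ => ?_
    by_cases hi : n i ≤ m <;> by_cases hj : n j ≤ m <;> simp only [hi, hj, max_le_iff, and_true, and_false, if_true, if_false] <;> first | ring | (simp; done) | (rw [mul_one_div])
  have h3 : ∑ i ∈ I, ∑ j ∈ I, c i * c j * ∑ m ∈ Finset.Icc 1 M,
        (if max (n i) (n j) ≤ m then 1 / ((m : ℝ) * (m + 1)) else 0) =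
      ∑ i ∈ I, ∑ j ∈ I, c i * c j * (1 / ((max (n i) (n j) : ℕ) : ℝ)) - (∑ i ∈ I, c i) ^ 2 * (1 / (M + 1)) := by
    rw [sq, Finset.sum_mul_sum, Finset.sum_mul, ← Finset.sum_sub_distrib]
    refine Finset.sum_congr rfl fun i hi => ?_
    rw [Finset.sum_mul, ← Finset.sum_sub_distrib]
    refine Finset.sum_congr rfl fun j hj => ?_
    rw [tele _ _ (le_max_of_le_left (hn i hi)) (by have := hnM i hi; have := hnM j hj; omega)]
    ring
  rw [h2, h3]
  have : 0 ≤ (∑ i ∈ I, c i) ^ 2 * (1 / ((M : ℝ) + 1)) := by positivity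
  linarith

lemma SA_eq (A : Finset ℕ) {y m : ℕ} (hm : m ≤ y) :
    SA A m = ∑ T ∈ (Nat.primesLE y).powerset, if ∏ p ∈ T, p ≤ m then ∏ p ∈ T, chi A p else 0 := by
  have hT : ∀ T ∈ (Nat.primesLE y).powerset, ∀ p ∈ T, Nat.Prime p := fun T hT p hp =>
    (Nat.mem_primesLE.1 (Finset.mem_powerset.1 hT hp)).2
  have hsq : ∀ T ∈ (Nat.primesLE y).powerset, Squarefree (∏ p ∈ T, p) := fun T h =>
    Finset.squarefree_prod_of_pairwise_isCoprime (fun p hp q hq hpq =>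
      Nat.coprime_iff_isRelPrime.1 ((Nat.coprime_primes (hT T h p hp) (hT T h q hq)).2 hpq))
      (fun p hp => (hT T h p hp).prime.squarefree)
  unfold SA fA
  rw [← Finset.sum_filter, ← Finset.sum_filter]
  symm
  refine Finset.sum_bij (fun T _ => ∏ p ∈ T, p) ?_ ?_ ?_ ?_
  · intro T h
    rw [Finset.mem_filter] at h
    rw [Finset.mem_filter, Finset.mem_Icc]
    refine ⟨⟨Finset.prod_pos fun p hp => (hT T h.1 p hp).pos, h.2⟩, hsq T h.1⟩
  · intro T h U h' e
    rw [Finset.mem_filter] at h h'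
    have h1 := Nat.primeFactors_prod (hT T h.1)
    have h2 := Nat.primeFactors_prod (hT U h'.1)
    rw [← h1, ← h2, e]
  · intro n hn
    rw [Finset.mem_filter, Finset.mem_Icc] at hn
    refine ⟨n.primeFactors, ?_, Nat.prod_primeFactors_of_squarefree hn.2⟩
    rw [Finset.mem_filter, Finset.mem_powerset, Nat.prod_primeFactors_of_squarefree hn.2]
    refine ⟨fun p hp => ?_, hn.1.2⟩
    rw [Nat.mem_primesLE]
    exact ⟨(Nat.le_of_mem_primeFactors hp).trans (hn.1.2.trans hm), Nat.prime_of_mem_primeFactors hp⟩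
  · intro T h
    rw [Finset.mem_filter] at h
    rw [Nat.primeFactors_prod (hT T h.1)]

lemma SA_sum_le_JJ (A : Finset ℕ) {y N : ℕ} (hN : N ≤ y) :
    ∑ m ∈ Finset.Icc 1 N, SA A m ^ 2 / ((m : ℝ) * (m + 1)) ≤ JJ (Nat.primesLE y) A := by
  set s := Nat.primesLE y with hs
  have hT : ∀ T ∈ s.powerset, ∀ p ∈ T, Nat.Prime p := fun T hT p hp =>
    (Nat.mem_primesLE.1 (Finset.mem_powerset.1 hT hp)).2
  have h1 := abel_max s.powerset (fun T => ∏ p ∈ T, chi A p) (fun T => ∏ p ∈ T, p)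
    (fun T h => Finset.prod_pos fun p hp => (hT T h p hp).pos) N
  rw [Finset.sum_congr rfl fun m hm => by
    rw [SA_eq A ((Finset.mem_Icc.1 hm).2.trans hN)]]
  refine h1.trans (le_of_eq ?_)
  unfold JJ Wd
  simp_rw [prod_trig s (fun p => chi A p * (p : ℝ) ^ (-(1 / 2 + 0) : ℝ)) (fun p => Real.log p)]
  rw [trig_A (by norm_num)]
  have ea : ∀ T ∈ s.powerset, ∏ p ∈ T, (chi A p * (p : ℝ) ^ (-(1 / 2 + 0) : ℝ)) =
      (∏ p ∈ T, chi A p) * Real.exp (-(1 / 2) * ∑ p ∈ T, Real.log p) := fun T h => by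
    rw [Finset.prod_mul_distrib, Finset.mul_sum, Real.exp_sum]
    congr 1
    refine Finset.prod_congr rfl fun p hp => ?_
    rw [Real.rpow_def_of_pos (by exact_mod_cast (hT T h p hp).pos)]
    congr 1; ring
  have ev : ∀ T ∈ s.powerset, ((∏ p ∈ T, p : ℕ) : ℝ) = Real.exp (∑ p ∈ T, Real.log p) := fun T h => by
    rw [Real.exp_sum, Nat.cast_prod]
    refine Finset.prod_congr rfl fun p hp => ?_
    rw [Real.exp_log (by exact_mod_cast (hT T h p hp).pos)]
  refine Finset.sum_congr rfl fun T h => Finset.sum_congr rfl fun U h' => ?_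
  rw [ea T h, ea U h', Nat.cast_max, ev T h, ev U h']
  set v := ∑ p ∈ T, Real.log p
  set w := ∑ p ∈ U, Real.log p
  have : 1 / max (Real.exp v) (Real.exp w) = Real.exp (-(1 / 2) * v) * Real.exp (-(1 / 2) * w) * Real.exp (-(1 / 2) * |v - w|) := by
    rw [← Real.exp_add, ← Real.exp_add]
    rcases le_total v w with hh | hh
    · rw [max_eq_right (Real.exp_le_exp.2 hh), abs_of_nonpos (by linarith), one_div, ← Real.exp_neg]
      congr 1; ring
    · rw [max_eq_left (Real.exp_le_exp.2 hh), abs_of_nonneg (by linarith), one_div, ← Real.exp_neg]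
      congr 1; ring
  rw [this]; ring

end RMF

namespace RMF

lemma log_trig {u : ℝ} (hu : u ^ 2 ≤ 1 / 2) (θ : ℝ) :
    0 < 1 + 2 * u * Real.cos θ + u ^ 2 ∧
    2 * u * Real.cos θ - u ^ 2 * Real.cos (2 * θ) - 3 * |u| ^ 3 ≤
      Real.log (1 + 2 * u * Real.cos θ + u ^ 2) := by
  have habs : |u| ≤ 71 / 100 := abs_le_of_sq_le_sq (by nlinarith) (by norm_num)
  have hc := Real.cos_sq_add_sin_sq θ
  have hpos : 0 < 1 + 2 * u * Real.cos θ + u ^ 2 := by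
    have h1 : 1 + 2 * u * Real.cos θ + u ^ 2 = (u + Real.cos θ) ^ 2 + Real.sin θ ^ 2 := by
      nlinarith
    have h2 : |u * Real.cos θ| ≤ |u| := by
      rw [abs_mul]; exact mul_le_of_le_one_right (abs_nonneg _) (Real.abs_cos_le_one θ)
    have h3 := (abs_le.1 h2).1
    have h4 := sq_abs u
    nlinarith
  refine ⟨hpos, ?_⟩
  set w : ℂ := u * Complex.exp (θ * Complex.I) with hw
  have hwn : ‖w‖ = |u| := by
    rw [hw, norm_mul, Complex.norm_exp_ofReal_mul_I, Complex.norm_real, mul_one, Real.norm_eq_abs]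
  have h := Complex.norm_log_sub_logTaylor_le 2 (z := w) (by rw [hwn]; linarith)
  have hre := (Complex.abs_re_le_norm _).trans h
  have hT : Complex.logTaylor (2 + 1) w = w - w ^ 2 / 2 := by
    simp [Complex.logTaylor_succ, Complex.logTaylor_zero]; ring
  have hw1 : w.re = u * Real.cos θ := by
    simp [hw, Complex.exp_mul_I, ← Complex.ofReal_cos, ← Complex.ofReal_sin]
  have hw2 : w.im = u * Real.sin θ := by
    simp [hw, Complex.exp_mul_I, ← Complex.ofReal_cos, ← Complex.ofReal_sin]
  have hw3 : (w ^ 2 / 2).re = u ^ 2 * Real.cos (2 * θ) / 2 := by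
    have : (w ^ 2 / 2).re = (w ^ 2).re / 2 := by
      simp
    rw [this, sq, Complex.mul_re, hw1, hw2, Real.cos_two_mul]
    nlinarith
  have hlog : (Complex.log (1 + w)).re = Real.log (1 + 2 * u * Real.cos θ + u ^ 2) / 2 := by
    rw [Complex.log_re]
    have : 1 + 2 * u * Real.cos θ + u ^ 2 = ‖1 + w‖ ^ 2 := by
      rw [← Complex.normSq_eq_norm_sq, Complex.normSq_apply]
      simp only [Complex.add_re, Complex.one_re, Complex.add_im, Complex.one_im, hw1, hw2]
      nlinarith
    rw [this, Real.log_pow]; push_cast; ring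
  rw [hT, hwn, Complex.sub_re, Complex.sub_re, hlog, hw1, hw3] at hre
  have h1 := (abs_le.1 hre).1
  have h2 : |u| ^ (2 + 1) * (1 - |u|)⁻¹ / ((2 : ℕ) + 1 : ℝ) ≤ 3 / 2 * |u| ^ 3 := by
    have : (1 - |u|)⁻¹ ≤ 9 / 2 := by
      rw [inv_le_comm₀ (by linarith) (by norm_num)]; linarith
    have h5 := mul_le_mul_of_nonneg_left this (pow_nonneg (abs_nonneg u) 3)
    push_cast; norm_num; linarith
  linarith

/-- `p^{-1/2-δ}` -/
def rr (δ : ℝ) (p : ℕ) : ℝ := (p : ℝ) ^ (-(1 / 2 + δ))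

lemma rr_nonneg (δ : ℝ) (p : ℕ) : 0 ≤ rr δ p := by unfold rr; positivity

lemma rr_sq (δ : ℝ) {p : ℕ} (hp : 1 ≤ p) : rr δ p ^ 2 = (p : ℝ) ^ (-(1 + 2 * δ)) := by
  unfold rr
  rw [← Real.rpow_natCast, ← Real.rpow_mul (by positivity)]; congr 1; push_cast; ring

lemma rr0_sq (p : ℕ) : rr 0 p ^ 2 = 1 / (p : ℝ) := by
  unfold rr
  rw [← Real.rpow_natCast, ← Real.rpow_mul (by positivity)]
  rw [show (-(1 / 2 + 0) * ((2 : ℕ) : ℝ) : ℝ) = -1 by norm_num, Real.rpow_neg_one, one_div]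

lemma rr_le {δ : ℝ} (hδ : 0 ≤ δ) {p : ℕ} (hp : 1 ≤ p) : rr δ p ≤ rr 0 p := by
  unfold rr
  exact Real.rpow_le_rpow_of_exponent_le (by exact_mod_cast hp) (by linarith)

lemma rr0_cube {p : ℕ} (hp : 1 ≤ p) : rr 0 p ^ 3 = (p : ℝ) ^ (-(3 / 2) : ℝ) := by
  unfold rr
  rw [← Real.rpow_natCast, ← Real.rpow_mul (by positivity)]; congr 1; push_cast; ring

lemma rr_sq_ge {δ : ℝ} {p : ℕ} (hp : 1 ≤ p) :
    1 / (p : ℝ) - 2 * δ * (Real.log p / p) ≤ rr δ p ^ 2 := by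
  rw [rr_sq δ hp]
  have := inv_le_rpow (σ := 2 * δ) hp
  linarith

/-- tilted mean -/
def mt (t : ℝ) (p : ℕ) : ℝ := 2 * rr 0 p * Real.cos (t * Real.log p) / (1 + rr 0 p ^ 2)

lemma per_prime {δ : ℝ} (hδ : 0 ≤ δ) {p : ℕ} (hp : 2 ≤ p) (t x : ℝ) (hx : x = 1 ∨ x = -1) :
    0 < 1 + 2 * (x * rr δ p) * Real.cos (t * Real.log p) + (x * rr δ p) ^ 2 ∧
    2 * (rr δ p * Real.cos (t * Real.log p) * (x - mt t p)) ≤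
      Real.log (1 + 2 * (x * rr δ p) * Real.cos (t * Real.log p) + (x * rr δ p) ^ 2)
        - Real.cos (2 * t * Real.log p) / p - 2 * (1 / (p : ℝ)) + 7 * (p : ℝ) ^ (-(3 / 2) : ℝ)
        + 6 * δ * (Real.log p / p) := by
  have hp1 : 1 ≤ p := by omega
  have hp2 : (2 : ℝ) ≤ p := by exact_mod_cast hp
  set r := rr 0 p with hr
  set r' := rr δ p with hr'
  have hr0 : 0 ≤ r' := rr_nonneg _ _
  have hrr : r' ≤ r := rr_le hδ hp1
  have hr2 : r ^ 2 = 1 / (p : ℝ) := rr0_sq p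
  have hr2' : r ^ 2 ≤ 1 / 2 := by
    rw [hr2]; exact one_div_le_one_div_of_le (by norm_num) hp2
  have hr3 : r ^ 3 = (p : ℝ) ^ (-(3 / 2) : ℝ) := rr0_cube hp1
  have hge : 1 / (p : ℝ) - 2 * δ * (Real.log p / p) ≤ r' ^ 2 := rr_sq_ge hp1
  set θ := t * Real.log p with hθ
  have hx2 : x ^ 2 = 1 := by rcases hx with h | h <;> rw [h] <;> norm_num
  have hxa : |x| = 1 := by rcases hx with h | h <;> rw [h] <;> norm_num
  have hrr2 : r' ^ 2 ≤ r ^ 2 := pow_le_pow_left₀ hr0 hrr 2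
  have hrr3 : r' ^ 3 ≤ r ^ 3 := pow_le_pow_left₀ hr0 hrr 3
  obtain ⟨h1, h2⟩ := log_trig (u := x * r') (by rw [mul_pow, hx2]; linarith) θ
  refine ⟨h1, ?_⟩
  rw [abs_mul, hxa, one_mul, abs_of_nonneg hr0, show (x * r') ^ 2 = r' ^ 2 by
    rw [mul_pow, hx2, one_mul]] at h2
  rw [show (x * r') ^ 2 = r' ^ 2 by rw [mul_pow, hx2, one_mul]]
  rw [show 2 * t * Real.log p = 2 * θ by rw [hθ]; ring, ← hr3]
  have hc1 : Real.cos (2 * θ) ≤ 1 := Real.cos_le_one _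
  have hc2 : -1 ≤ Real.cos (2 * θ) := Real.neg_one_le_cos _
  have hcs : Real.cos θ ^ 2 = (1 + Real.cos (2 * θ)) / 2 := by rw [Real.cos_two_mul]; ring
  have hm : 2 * r' ^ 2 * (1 + Real.cos (2 * θ)) - 4 * r ^ 3 ≤
      2 * (r' * Real.cos θ * mt t p) := by
    have e : 2 * (r' * Real.cos θ * mt t p) = 4 * r' * r * Real.cos θ ^ 2 / (1 + r ^ 2) := by
      unfold mt; rw [← hr, ← hθ]; ring
    rw [e, hcs, le_div_iff₀ (by positivity)]
    have hr1 : r ≤ 1 := by nlinarith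
    have hrn : 0 ≤ r := hr0.trans hrr
    have a1 : 0 ≤ (1 + Real.cos (2 * θ)) := by linarith
    have a2 : r' ^ 2 * (1 + Real.cos (2 * θ)) ≤ r' * r * (1 + Real.cos (2 * θ)) := by
      apply mul_le_mul_of_nonneg_right _ a1; nlinarith
    have a3 : r' ^ 2 * (1 + Real.cos (2 * θ)) * r ^ 2 ≤ 2 * r ^ 3 := by
      have b1 : r' ^ 2 * (1 + Real.cos (2 * θ)) ≤ r ^ 2 * 2 :=
        mul_le_mul hrr2 (by linarith) a1 (by positivity)
      have b2 : r ^ 2 * 2 * r ^ 2 ≤ 2 * r ^ 3 := by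
        have : r ^ 3 * r ≤ r ^ 3 * 1 := mul_le_mul_of_nonneg_left hr1 (by positivity)
        nlinarith
      exact (mul_le_mul_of_nonneg_right b1 (sq_nonneg r)).trans b2
    have a4 : 0 ≤ r ^ 3 * r ^ 2 := by positivity
    nlinarith
  have hk : -(r' ^ 2 * Real.cos (2 * θ)) ≤ - (Real.cos (2 * θ) / p) + 2 * δ * (Real.log p / p) := by
    have : (1 / (p : ℝ) - r' ^ 2) * Real.cos (2 * θ) ≤ (1 / (p : ℝ) - r' ^ 2) * 1 :=
      mul_le_mul_of_nonneg_left hc1 (by linarith)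
    have e : Real.cos (2 * θ) / p = 1 / (p : ℝ) * Real.cos (2 * θ) := by ring
    rw [e]; linarith
  have e2 : 2 * (r' * Real.cos θ * (x - mt t p)) =
      2 * (x * r') * Real.cos θ - 2 * (r' * Real.cos θ * mt t p) := by ring
  rw [e2]
  nlinarith
end RMF

namespace RMF

/-- normalisation `∏ (1+1/p)` -/
def Zs (s : Finset ℕ) : ℝ := ∏ p ∈ s, (1 + 1 / (p : ℝ))

lemma Zs_pos (s : Finset ℕ) : 0 < Zs s := Finset.prod_pos fun p _ => by positivity

lemma Zs_log_le (s : Finset ℕ) : Real.log (Zs s) ≤ ∑ p ∈ s, 1 / (p : ℝ) := by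
  rw [Real.log_le_iff_le_exp (Zs_pos s), Real.exp_sum]
  refine Finset.prod_le_prod (fun p _ => by positivity) fun p _ => ?_
  linarith [Real.add_one_le_exp (1 / (p : ℝ))]

def qt (t : ℝ) (p : ℕ) : ℝ := (1 + mt t p) / 2
def bb (t : ℝ) (k p : ℕ) : ℝ := if p ≤ Yk k then rr 0 p * Real.cos (t * Real.log p) else 0
def bb' (t : ℝ) (k p : ℕ) : ℝ :=
  if p ≤ Yk k then rr (1 / 2 ^ k) p * Real.cos (t * Real.log p) else 0

lemma filter_primesLE {a b : ℕ} (h : a ≤ b) :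
    (Nat.primesLE b).filter (· ≤ a) = Nat.primesLE a := by
  ext p; simp only [Finset.mem_filter, Nat.mem_primesLE]; constructor
  · rintro ⟨⟨_, h2⟩, h3⟩; exact ⟨h3, h2⟩
  · rintro ⟨h1, h2⟩; exact ⟨⟨h1.trans h, h2⟩, h1⟩

lemma Wd_eq_rr (δ : ℝ) (s A : Finset ℕ) (t : ℝ) : Wd δ s A t =
    ∏ p ∈ s, (1 + 2 * (chi A p * rr δ p) * Real.cos (t * Real.log p) + (chi A p * rr δ p) ^ 2) := rfl

lemma lin_bound : ∃ C1 : ℝ, 1 ≤ C1 ∧ ∀ (k n : ℕ) (A : Finset ℕ) (t B : ℝ), k ≤ n → 1 ≤ B →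
    JJ (Nat.primesLE (Yk k)) A ≤ B * Zs (Nat.primesLE (Yk k)) →
    Lin (qt t) (Nat.primesLE (Yk n)) (bb' t k) A ≤
      1 / 2 * Real.log B + C1 * (1 + Real.log (2 + |t|)) := by
  obtain ⟨C5, hC5, hcos⟩ := cos_sum_ge
  refine ⟨(Real.log 4 + 2 + 2 * C5 + 18 + 7 * CP + 2), ?_, ?_⟩
  · have := CP_nonneg
    have : 0 ≤ Real.log 4 := Real.log_nonneg (by norm_num)
    linarith
  intro k n A t B hkn hB hJ
  set s := Nat.primesLE (Yk k) with hs
  set δ : ℝ := 1 / 2 ^ k with hδd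
  have hδ : 0 < δ := by positivity
  have hδ1 : δ ≤ 1 := by
    rw [hδd]; exact div_le_one_of_le₀ (one_le_pow₀ (by norm_num)) (by positivity)
  have hsp : ∀ p ∈ s, 2 ≤ p := fun p hp => ((Nat.mem_primesLE).1 hp).2.two_le
  have hlin : 2 * Lin (qt t) (Nat.primesLE (Yk n)) (bb' t k) A =
      ∑ p ∈ s, 2 * (rr δ p * Real.cos (t * Real.log p) * (chi A p - mt t p)) := by
    unfold Lin
    rw [hs, ← filter_primesLE (Yk_mono hkn), Finset.sum_filter, Finset.mul_sum]
    refine Finset.sum_congr rfl fun p _ => ?_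
    unfold bb' qt
    split_ifs with h
    · ring
    · ring
  have h1 : ∑ p ∈ s, 2 * (rr δ p * Real.cos (t * Real.log p) * (chi A p - mt t p)) ≤
      ∑ p ∈ s, (Real.log (1 + 2 * (chi A p * rr δ p) * Real.cos (t * Real.log p) + (chi A p * rr δ p) ^ 2)
        - Real.cos (2 * t * Real.log p) / p - 2 * (1 / (p : ℝ)) + 7 * (p : ℝ) ^ (-(3 / 2) : ℝ)
        + 6 * δ * (Real.log p / p)) :=
    Finset.sum_le_sum fun p hp => (per_prime hδ.le (hsp p hp) t _ (chi_cases A p)).2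
  rw [Finset.sum_add_distrib, Finset.sum_add_distrib, Finset.sum_sub_distrib,
    Finset.sum_sub_distrib, ← Finset.mul_sum, ← Finset.mul_sum, ← Finset.mul_sum,
    ← Finset.mul_sum] at h1
  rw [← Finset.mul_sum] at hlin
  have hW : ∑ p ∈ s, Real.log (1 + 2 * (chi A p * rr δ p) * Real.cos (t * Real.log p) + (chi A p * rr δ p) ^ 2)
      = Real.log (Wd δ s A t) := by
    rw [Wd_eq_rr, Real.log_prod]
    exact fun p hp => (per_prime hδ.le (hsp p hp) t _ (chi_cases A p)).1.ne'
  rw [hW] at h1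
  have hWpos : 0 < Wd δ s A t := by
    rw [Wd_eq_rr]
    exact Finset.prod_pos fun p hp => (per_prime hδ.le (hsp p hp) t _ (chi_cases A p)).1
  have hWle : Wd δ s A t ≤ 2 ^ k * (4 * (2 + |t|) ^ 2) * (B * Zs s) := by
    refine (Wd_le_JJ hδ s A (fun p hp => by have := hsp p hp; omega) t).trans ?_
    refine mul_le_mul ?_ hJ (JJ_nonneg _ _) (by positivity)
    have e : (1 / 4 + 2 * t ^ 2) / δ = 2 ^ k * (1 / 4 + 2 * t ^ 2) := by
      rw [hδd]; field_simp
    rw [e]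
    have h2k : (1 : ℝ) ≤ 2 ^ k := one_le_pow₀ (by norm_num)
    have : 2 * δ ≤ 2 ^ k * 2 := by nlinarith
    have h3 : 2 * (2 ^ k * (1 / 4 + 2 * t ^ 2) + 2 * δ) ≤ 2 ^ k * (2 * (9 / 4 + 2 * t ^ 2)) := by
      nlinarith
    refine h3.trans (mul_le_mul_of_nonneg_left ?_ (by positivity))
    have := sq_abs t
    nlinarith [abs_nonneg t]
  have hlogW : Real.log (Wd δ s A t) ≤ k * Real.log 2 + Real.log 4 + 2 * Real.log (2 + |t|)
      + Real.log B + Real.log (Zs s) := by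
    refine (Real.log_le_log hWpos hWle).trans_eq ?_
    have hz := Zs_pos s
    rw [Real.log_mul (by positivity) (by positivity), Real.log_mul (by positivity) (by positivity),
      Real.log_mul (by positivity) (by positivity), Real.log_mul (by positivity) (by positivity),
      Real.log_pow, Real.log_pow]
    push_cast; ring
  have hZ := Zs_log_le s
  have hR := sum_inv_ge k
  have hc := hcos k (2 * t)
  have h32 := sum_32_le s
  have hld := sum_log_div_Yk k
  rw [← hs] at hR hc hld
  have hld2 : 6 * δ * ∑ p ∈ s, Real.log p / p ≤ 18 := by
    have := mul_le_mul_of_nonneg_left hld (show 0 ≤ 6 * δ by positivity)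
    have e : 6 * δ * (3 * 2 ^ k) = 18 := by rw [hδd]; field_simp; norm_num
    linarith
  have hl0 : 0 ≤ Real.log (2 + |t|) := Real.log_nonneg (by linarith [abs_nonneg t])
  have hl2 : Real.log (2 + |2 * t|) ≤ 1 + Real.log (2 + |t|) := by
    rw [abs_mul, abs_two]
    have : 2 + 2 * |t| ≤ 2 * (2 + |t|) := by linarith
    refine (Real.log_le_log (by positivity) this).trans ?_
    rw [Real.log_mul (by norm_num) (by positivity)]
    linarith [Real.log_two_lt_d9]
  have hCl := mul_le_mul_of_nonneg_left hl2 hC5.le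
  have hl4 : 0 ≤ Real.log 4 := Real.log_nonneg (by norm_num)
  have hCP := CP_nonneg
  have hCl0 := mul_nonneg hC5.le hl0
  have p1 := mul_nonneg hl4 hl0
  have p2 := mul_nonneg hCP hl0
  nlinarith
end RMF

namespace RMF

lemma mt_abs (t : ℝ) (p : ℕ) : |mt t p| ≤ 1 := by
  unfold mt
  have h0 := rr_nonneg 0 p
  rw [abs_div, abs_of_pos (show 0 < 1 + rr 0 p ^ 2 by positivity), div_le_one (by positivity),
    abs_mul, abs_of_nonneg (show 0 ≤ 2 * rr 0 p by positivity)]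
  have := Real.abs_cos_le_one (t * Real.log p)
  nlinarith [sq_nonneg (rr 0 p - 1)]

lemma qt_isP (t : ℝ) : IsP (qt t) := fun p => by
  have := abs_le.1 (mt_abs t p)
  unfold qt; constructor <;> linarith [this.1, this.2]

lemma mt_sq {p : ℕ} (hp : 2 ≤ p) (t : ℝ) : mt t p ^ 2 ≤ 8 / 9 := by
  have h1 : rr 0 p ^ 2 ≤ 1 / 2 := by
    rw [rr0_sq]; exact one_div_le_one_div_of_le (by norm_num) (by exact_mod_cast hp)
  unfold mt
  rw [div_pow, div_le_iff₀ (by positivity), mul_pow, mul_pow]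
  set x := rr 0 p ^ 2
  have hx : 0 ≤ x := sq_nonneg _
  have hc : Real.cos (t * Real.log p) ^ 2 ≤ 1 := Real.cos_sq_le_one _
  have : x * Real.cos (t * Real.log p) ^ 2 ≤ x := mul_le_of_le_one_right hx hc
  nlinarith [mul_nonneg (show 0 ≤ 1 - 2 * x by linarith) (show 0 ≤ 2 - x by linarith)]

lemma rr_diff_sq {δ : ℝ} (hδ : 0 ≤ δ) {p : ℕ} (hp : 1 ≤ p) (c : ℝ) (hc : |c| ≤ 1) :
    (rr 0 p * c - rr δ p * c) ^ 2 ≤ 2 * δ * (Real.log p / p) := by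
  have h1 := rr_le hδ hp
  have h2 := rr_nonneg δ p
  have h3 := rr_sq_ge (δ := δ) hp
  rw [← rr0_sq] at h3
  have h4 : c ^ 2 ≤ 1 := by rw [← sq_abs]; exact pow_le_one₀ (abs_nonneg _) hc
  have h5 : (rr 0 p - rr δ p) ^ 2 ≤ rr 0 p ^ 2 - rr δ p ^ 2 := by nlinarith
  calc (rr 0 p * c - rr δ p * c) ^ 2 = (rr 0 p - rr δ p) ^ 2 * c ^ 2 := by ring
    _ ≤ (rr 0 p - rr δ p) ^ 2 := mul_le_of_le_one_right (sq_nonneg _) h4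
    _ ≤ _ := by linarith

lemma sum_ite_le (n k : ℕ) :
    ∑ p ∈ Nat.primesLE (Yk n), (if p ≤ Yk k then 2 * (1 / 2 ^ k : ℝ) * (Real.log p / p) else 0) ≤ 6 := by
  rw [← Finset.sum_filter]
  have h1 : ∑ p ∈ (Nat.primesLE (Yk n)).filter (· ≤ Yk k), 2 * (1 / 2 ^ k : ℝ) * (Real.log p / p) ≤
      ∑ p ∈ Nat.primesLE (Yk k), 2 * (1 / 2 ^ k : ℝ) * (Real.log p / p) := by
    refine Finset.sum_le_sum_of_subset_of_nonneg ?_ fun p hp _ => ?_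
    · intro p hp
      simp only [Finset.mem_filter, Nat.mem_primesLE] at hp ⊢
      exact ⟨hp.2, hp.1.2⟩
    · have : 0 ≤ Real.log p := Real.log_natCast_nonneg p
      positivity
  refine h1.trans ?_
  rw [← Finset.mul_sum]
  have := mul_le_mul_of_nonneg_left (sum_log_div_Yk k) (show (0 : ℝ) ≤ 2 * (1 / 2 ^ k) by positivity)
  have e : (2 : ℝ) * (1 / 2 ^ k) * (3 * 2 ^ k) = 6 := by field_simp; norm_num
  linarith

lemma sum_ite_block (n k : ℕ) :
    ∑ p ∈ Nat.primesLE (Yk n), (if Yk k < p ∧ p ≤ Yk (k + 1) then 1 / (p : ℝ) else 0) ≤ 9 := by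
  rw [← Finset.sum_filter]
  refine le_trans (Finset.sum_le_sum_of_subset_of_nonneg ?_ fun p hp _ => ?_) (sum_block k)
  · intro p hp
    simp only [Finset.mem_filter, Nat.mem_primesLE] at hp ⊢
    exact ⟨⟨hp.2.2, hp.1.2⟩, hp.2.1⟩
  · positivity

lemma ballot_hyp : ∃ C0 : ℝ, ∀ (t A : ℝ) (n : ℕ), 1 + Real.log (2 + |t|) ≤ A →
    Ballot (qt t) (Nat.primesLE (Yk n)) (bb t) (bb' t) C0 A n := by
  obtain ⟨C5, hC5, hcos⟩ := cos_sum_ge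
  refine ⟨21 + 6 * C5, fun t A n hA => ?_⟩
  have hL : 0 ≤ Real.log (2 + |t|) := Real.log_nonneg (by linarith [abs_nonneg t])
  have hc1 : ∀ p : ℕ, |Real.cos (t * Real.log p)| ≤ 1 := fun p => Real.abs_cos_le_one _
  have hp1 : ∀ p ∈ Nat.primesLE (Yk n), 2 ≤ p := fun p hp => (Nat.mem_primesLE.1 hp).2.two_le
  have hqm : ∀ p, 2 * qt t p - 1 = mt t p := fun p => by unfold qt; ring
  have hδ : ∀ k : ℕ, (0 : ℝ) ≤ 1 / 2 ^ k := fun k => by positivity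
  have hN : ∀ k, ∑ p ∈ Nat.primesLE (Yk n), (bb t k p - bb' t k p) ^ 2 ≤ 6 := by
    intro k
    refine le_trans (Finset.sum_le_sum fun p hp => ?_) (sum_ite_le n k)
    have := hp1 p hp
    unfold bb bb'
    split_ifs with h
    · exact rr_diff_sq (hδ k) (by omega) _ (hc1 p)
    · simp
  refine ⟨qt_isP t, fun p hp => ?_, by linarith, by linarith, ?_, ?_, ?_, ?_, ?_, ?_⟩
  · rw [hqm]; have := mt_sq (hp1 p hp) t; linarith
  · intro k j p
    have h1 := rr_nonneg 0 p
    have h2 := rr_nonneg (1 / 2 ^ j) p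
    unfold bb bb'
    split_ifs
    · have : rr 0 p * Real.cos (t * Real.log p) * (rr (1 / 2 ^ j) p * Real.cos (t * Real.log p)) =
        rr 0 p * rr (1 / 2 ^ j) p * Real.cos (t * Real.log p) ^ 2 := by ring
      rw [this]; positivity
    all_goals simp
  · intro k p
    by_cases h : p ≤ Yk k
    · left; unfold bb; rw [if_pos h, if_pos (h.trans (Yk_mono (Nat.le_succ k)))]
    · right; intro j hj; unfold bb'; rw [if_neg]
      intro h'; exact h (h'.trans (Yk_mono hj))
  · intro k
    have : ∑ p ∈ Nat.primesLE (Yk n), (bb t (k + 1) p - bb' t k p) ^ 2 ≤ 6 + 9 := by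
      refine le_trans (Finset.sum_le_sum fun p hp => ?_)
        ((Finset.sum_add_distrib).trans_le (add_le_add (sum_ite_le n k) (sum_ite_block n k)))
      have hp2 := hp1 p hp
      have hy := Yk_mono (Nat.le_succ k)
      unfold bb bb'
      by_cases h : p ≤ Yk k
      · rw [if_pos h, if_pos (h.trans hy), if_pos h, if_neg (by omega), add_zero]
        exact rr_diff_sq (hδ k) (by omega) _ (hc1 p)
      · rw [if_neg h, if_neg h]
        by_cases h' : p ≤ Yk (k + 1)
        · rw [if_pos h', if_pos ⟨by omega, h'⟩, ← rr0_sq, sub_zero, zero_add, mul_pow]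
          exact mul_le_of_le_one_right (sq_nonneg _) (Real.cos_sq_le_one _)
        · rw [if_neg h', if_neg (by omega)]; simp
    linarith
  · intro k; linarith [hN k]
  · have : ∑ p ∈ Nat.primesLE (Yk n), |bb t 0 p| ≤ ∑ p ∈ Nat.primesLE (Yk n), if p = 2 then (1 : ℝ) else 0 := by
      refine Finset.sum_le_sum fun p hp => ?_
      have hp2 := hp1 p hp
      unfold bb
      have hY : Yk 0 = 2 := by simp [Yk]
      rw [hY]
      by_cases h : p = 2
      · rw [if_pos h.le, if_pos h, abs_mul, abs_of_nonneg (rr_nonneg _ _)]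
        have h1 : rr 0 p ^ 2 ≤ 1 ^ 2 := by
          rw [rr0_sq]
          exact (div_le_one₀ (by positivity)).2 (by exact_mod_cast (by omega : 1 ≤ p)) |>.trans_eq (by norm_num)
        have h2 := abs_le_of_sq_le_sq' h1 (by norm_num)
        exact mul_le_one₀ h2.2 (abs_nonneg _) (hc1 p)
      · rw [if_neg (by omega), if_neg h]; simp
    have h2 : ∑ p ∈ Nat.primesLE (Yk n), (if p = 2 then (1 : ℝ) else 0) ≤ 1 := by
      rw [Finset.sum_ite_eq']; split_ifs <;> norm_num
    linarith
  · intro k hk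
    have hs : ∑ p ∈ Nat.primesLE (Yk n), bb t k p ^ 2 =
        ∑ p ∈ Nat.primesLE (Yk k), (1 / 2 * (1 / (p : ℝ)) + 1 / 2 * (Real.cos (2 * t * Real.log p) / p)) := by
      rw [← filter_primesLE (Yk_mono hk), Finset.sum_filter]
      refine Finset.sum_congr rfl fun p _ => ?_
      unfold bb
      split_ifs with h
      · rw [mul_pow, rr0_sq, show 2 * t * Real.log p = 2 * (t * Real.log p) by ring, Real.cos_two_mul]
        ring
      · simp
    rw [hs, Finset.sum_add_distrib, ← Finset.mul_sum, ← Finset.mul_sum]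
    have h1 := sum_inv_ge k
    have h2 := hcos k (2 * t)
    have hl2 : Real.log (2 + |2 * t|) ≤ 1 + Real.log (2 + |t|) := by
      rw [abs_mul, abs_two]
      have : 2 + 2 * |t| ≤ 2 * (2 + |t|) := by linarith
      refine (Real.log_le_log (by positivity) this).trans ?_
      rw [Real.log_mul (by norm_num) (by positivity)]
      linarith [Real.log_two_lt_d9]
    have h3 := mul_le_mul_of_nonneg_left hl2 hC5.le
    have hk0 : (0 : ℝ) ≤ k := Nat.cast_nonneg k
    have hl := Real.log_two_gt_d9
    set X := ∑ p ∈ Nat.primesLE (Yk k), 1 / (p : ℝ)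
    set Y := ∑ p ∈ Nat.primesLE (Yk k), Real.cos (2 * t * Real.log p) / p
    set L := Real.log (2 + |t|)
    have hkl : (k : ℝ) * 0.69 ≤ k * Real.log 2 := mul_le_mul_of_nonneg_left (by linarith) hk0
    have hXY : (k : ℝ) * 0.69 - 2 - C5 * (2 + L) ≤ X + Y := by linarith
    by_cases hcase : 2 + C5 * (2 + L) ≤ (k : ℝ) * 0.345
    · left
      have : (k : ℝ) * 0.1725 ≤ 1 / 2 * X + 1 / 2 * Y := by linarith
      have h5 : 21 * ((k : ℝ) * 0.1725) ≤ (21 + 6 * C5) * (1 / 2 * X + 1 / 2 * Y) :=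
        mul_le_mul (by linarith) this (by positivity) (by linarith)
      linarith
    · right
      push Not at hcase
      have hA1 : (1 + L) ≤ A ^ 2 := by nlinarith
      have h6 : (21 + 6 * C5) * (1 + L) ≤ (21 + 6 * C5) * A ^ 2 :=
        mul_le_mul_of_nonneg_left hA1 (by linarith)
      have := mul_nonneg hC5.le hL
      linarith
end RMF

namespace RMF

open Classical in
/-- indicator that `M_{Y_k} ≤ B` for all `k ≤ n` -/
def GG (n : ℕ) (B : ℝ) (A : Finset ℕ) : ℝ :=
  if ∀ k ≤ n, JJ (Nat.primesLE (Yk k)) A ≤ B * Zs (Nat.primesLE (Yk k)) then 1 else 0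

lemma pk_log_le (t : ℝ) : pk (1 / 2) t * (1 + Real.log (2 + |t|)) ≤ 8 * (1 + ‖t‖) ^ (-(3 / 2 : ℝ)) := by
  have ha := abs_nonneg t
  rw [Real.norm_eq_abs]
  have hx : 0 < 1 + |t| := by linarith
  have h1 : pk (1 / 2) t ≤ 2 * (1 + |t|) ^ (-2 : ℝ) := by
    unfold pk
    rw [Real.rpow_neg hx.le, ← div_eq_mul_inv, Real.rpow_two, div_le_div_iff₀ (by positivity) (by positivity)]
    have := Real.pi_gt_three
    have h2 := sq_abs t
    have : 3 * (1 / 4 + t ^ 2) ≤ Real.pi * (1 / 4 + t ^ 2) :=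
      mul_le_mul_of_nonneg_right this.le (by positivity)
    nlinarith [sq_nonneg (|t| - 1)]
  have h2 : 1 + Real.log (2 + |t|) ≤ 4 * (1 + |t|) ^ (1 / 2 : ℝ) := by
    have a1 : Real.log (2 + |t|) ≤ Real.log 2 + Real.log (1 + |t|) := by
      rw [← Real.log_mul (by norm_num) hx.ne']
      exact Real.log_le_log (by positivity) (by linarith)
    have a2 := Real.log_le_rpow_div hx.le (show (0 : ℝ) < 1 / 2 by norm_num)
    have a3 : 1 ≤ (1 + |t|) ^ (1 / 2 : ℝ) := Real.one_le_rpow (by linarith) (by norm_num)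
    linarith [Real.log_two_lt_d9]
  have h3 : 0 ≤ 1 + Real.log (2 + |t|) := by
    have := Real.log_nonneg (show 1 ≤ 2 + |t| by linarith)
    linarith
  calc _ ≤ 2 * (1 + |t|) ^ (-2 : ℝ) * (4 * (1 + |t|) ^ (1 / 2 : ℝ)) :=
        mul_le_mul h1 h2 h3 (by positivity)
    _ = 8 * ((1 + |t|) ^ (-2 : ℝ) * (1 + |t|) ^ (1 / 2 : ℝ)) := by ring
    _ = _ := by rw [← Real.rpow_add hx]; norm_num

lemma Wd_div_Zs (s A : Finset ℕ) (t : ℝ) : Wd 0 s A t / Zs s =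
    ∏ p ∈ s, (fun (p : ℕ) (x : ℝ) => (1 + x * mt t p)) p (chi A p) := by
  rw [Wd_eq_rr, Zs, ← Finset.prod_div_distrib]
  refine Finset.prod_congr rfl fun p _ => ?_
  rw [← rr0_sq]
  unfold mt
  rw [mul_pow, chi_sq]
  field_simp
  ring

lemma Wd_int (s A : Finset ℕ) : Integrable (fun t => pk (1 / 2) t * Wd 0 s A t) := by
  refine pk_bdd_int (by norm_num) (Wd_cont 0 s A)
    (M := ∏ p ∈ s, (1 + 2 * rr 0 p + rr 0 p ^ 2)) fun u => ?_
  rw [Wd_eq_rr, Finset.abs_prod]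
  refine Finset.prod_le_prod (fun _ _ => abs_nonneg _) fun p _ => ?_
  have h0 := rr_nonneg 0 p
  have h1 : |2 * (chi A p * rr 0 p) * Real.cos (u * Real.log p)| ≤ 2 * rr 0 p := by
    rw [abs_mul, abs_mul, abs_mul, chi_abs, abs_two, abs_of_nonneg h0, one_mul]
    exact mul_le_of_le_one_right (by positivity) (Real.abs_cos_le_one _)
  rw [mul_pow, chi_sq, one_mul]
  have := abs_le.1 h1
  exact abs_le.2 ⟨by linarith [sq_nonneg (rr 0 p)], by linarith⟩

theorem GG_bound : ∃ C : ℝ, 0 < C ∧ ∀ (n : ℕ) (B : ℝ), 1 ≤ n → 1 ≤ B →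
    Ex (fun _ => 1 / 2) (Nat.primesLE (Yk n))
      (fun A => JJ (Nat.primesLE (Yk n)) A / Zs (Nat.primesLE (Yk n)) * GG n B A) ≤
      C * (1 + Real.log B) / Real.sqrt n := by
  obtain ⟨C1, hC1, hlin⟩ := lin_bound
  obtain ⟨C0, hbh⟩ := ballot_hyp
  obtain ⟨Cb, hCb, hbal⟩ := ballot_main C0
  have hI : Integrable (fun t : ℝ => (1 + ‖t‖) ^ (-(3 / 2 : ℝ))) :=
    integrable_one_add_norm (by simp; norm_num)
  set I := ∫ t : ℝ, (1 + ‖t‖) ^ (-(3 / 2 : ℝ)) with hIdef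
  have hI0 : 0 ≤ I := integral_nonneg fun t => by positivity
  refine ⟨Cb * C1 * 8 * (I + 1), by positivity, fun n B hn hB => ?_⟩
  set s := Nat.primesLE (Yk n) with hs
  have hZ := Zs_pos s
  have hlB : 0 ≤ Real.log B := Real.log_nonneg hB
  have hn0 : (0 : ℝ) < Real.sqrt n := Real.sqrt_pos.2 (by exact_mod_cast hn)
  have hq : IsP (fun _ => (1 / 2 : ℝ)) := fun p => by norm_num
  -- swap
  have hswap : Ex (fun _ => 1 / 2) s (fun A => JJ s A / Zs s * GG n B A) =
      ∫ t, pk (1 / 2) t * Ex (fun _ => 1 / 2) s (fun A => Wd 0 s A t / Zs s * GG n B A) := by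
    unfold Ex JJ
    simp only [Finset.mul_sum]
    rw [integral_finsetSum]
    · refine Finset.sum_congr rfl fun A _ => ?_
      rw [show (fun t => pk (1 / 2) t * ((∏ p ∈ A, (1 / 2 : ℝ)) * (∏ p ∈ s \ A, (1 - 1 / 2 : ℝ)) *
        (Wd 0 s A t / Zs s * GG n B A))) = fun t => ((∏ p ∈ A, (1 / 2 : ℝ)) * (∏ p ∈ s \ A, (1 - 1 / 2 : ℝ)) *
        (1 / Zs s * GG n B A)) * (pk (1 / 2) t * Wd 0 s A t) by funext t; ring, integral_const_mul]
      ring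
    · intro A _
      rw [show (fun t => pk (1 / 2) t * ((∏ p ∈ A, (1 / 2 : ℝ)) * (∏ p ∈ s \ A, (1 - 1 / 2 : ℝ)) *
        (Wd 0 s A t / Zs s * GG n B A))) = fun t => ((∏ p ∈ A, (1 / 2 : ℝ)) * (∏ p ∈ s \ A, (1 - 1 / 2 : ℝ)) *
        (1 / Zs s * GG n B A)) * (pk (1 / 2) t * Wd 0 s A t) by funext t; ring]
      exact (Wd_int s A).const_mul _
  have hpt : ∀ t, Ex (fun _ => 1 / 2) s (fun A => Wd 0 s A t / Zs s * GG n B A) ≤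
      Cb * C1 * (1 + Real.log B) / Real.sqrt n * (1 + Real.log (2 + |t|)) := by
    intro t
    have hL : 0 ≤ Real.log (2 + |t|) := Real.log_nonneg (by linarith [abs_nonneg t])
    simp only [Wd_div_Zs]
    rw [Ex_tilt s (fun p x => 1 + x * mt t p) (fun p _ => by ring)]
    have e : (fun p => (1 + 1 * mt t p) / 2) = qt t := by funext p; unfold qt; ring
    rw [e]
    set At := 1 / 2 * Real.log B + C1 * (1 + Real.log (2 + |t|)) with hAt
    have hAt1 : 1 + Real.log (2 + |t|) ≤ At := by
      have : 1 * (1 + Real.log (2 + |t|)) ≤ C1 * (1 + Real.log (2 + |t|)) :=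
        mul_le_mul_of_nonneg_right hC1 (by linarith)
      linarith
    have h1 : Ex (qt t) s (GG n B) ≤ Ex (qt t) s (Gk (qt t) s (bb' t) At n) := by
      refine Ex_mono (qt_isP t) fun A _ => ?_
      unfold GG Gk
      split_ifs with h h'
      · exact le_rfl
      · exact absurd (fun j hj => hlin j n A t B hj hB (h j hj)) h'
      · norm_num
      · exact le_rfl
    refine (h1.trans (hbal _ _ _ _ _ n hn (hbh t At n hAt1))).trans ?_
    have h2 : At ≤ C1 * (1 + Real.log B) * (1 + Real.log (2 + |t|)) := by
      have a1 : 0 ≤ C1 * Real.log B * Real.log (2 + |t|) := by positivity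
      have a2 : 1 * Real.log B ≤ C1 * Real.log B := mul_le_mul_of_nonneg_right hC1 hlB
      nlinarith
    rw [div_mul_eq_mul_div]
    refine div_le_div_of_nonneg_right ?_ hn0.le
    nlinarith [mul_le_mul_of_nonneg_left h2 hCb.le]
  rw [hswap]
  set D := Cb * C1 * (1 + Real.log B) / Real.sqrt n with hD
  have hD0 : 0 ≤ D := by positivity
  have hmono : ∫ t, pk (1 / 2) t * Ex (fun _ => 1 / 2) s (fun A => Wd 0 s A t / Zs s * GG n B A) ≤
      ∫ t : ℝ, D * 8 * (1 + ‖t‖) ^ (-(3 / 2 : ℝ)) := by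
    refine integral_mono_of_nonneg (Filter.Eventually.of_forall fun t => ?_) (hI.const_mul _)
      (Filter.Eventually.of_forall fun t => ?_)
    · refine mul_nonneg (pk_nonneg (by norm_num) t) (Ex_nonneg hq fun A _ => ?_)
      refine mul_nonneg (div_nonneg (Wd_nonneg _ _ _ _) hZ.le) ?_
      unfold GG; split_ifs <;> norm_num
    · have h1 := mul_le_mul_of_nonneg_left (hpt t) (pk_nonneg (δ := 1 / 2) (by norm_num) t)
      have h2 := mul_le_mul_of_nonneg_left (pk_log_le t) hD0
      calc _ ≤ _ := h1
        _ = D * (pk (1 / 2) t * (1 + Real.log (2 + |t|))) := by ring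
        _ ≤ _ := h2
        _ = _ := by ring
  refine hmono.trans ?_
  rw [integral_const_mul, ← hIdef]
  have : D * 8 * I ≤ D * 8 * (I + 1) := by gcongr; linarith
  refine this.trans_eq ?_
  rw [hD]; ring
end RMF

namespace RMF

abbrev hf : ℕ → ℝ := fun _ => 1 / 2

lemma hf_isP : IsP hf := fun p => by norm_num [hf]

def MM (y : ℕ) (A : Finset ℕ) : ℝ := JJ (Nat.primesLE y) A / Zs (Nat.primesLE y)

lemma MM_nonneg (y : ℕ) (A : Finset ℕ) : 0 ≤ MM y A :=
  div_nonneg (JJ_nonneg _ _) (Zs_pos _).le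

lemma JJ_indep {p : ℕ} {s : Finset ℕ} (hp : p ∉ s) : Indep p (JJ s) := by
  have key : ∀ A B : Finset ℕ, (∀ r, r ≠ p → chi A r = chi B r) → JJ s A = JJ s B := by
    intro A B h
    unfold JJ
    have : ∀ t, Wd 0 s A t = Wd 0 s B t := fun t => by
      unfold Wd
      refine Finset.prod_congr rfl fun r hr => ?_
      rw [h r (fun e => hp (e ▸ hr))]
    simp only [this]
  intro A
  exact ⟨key _ _ fun r hr => chi_insert_ne A hr, key _ _ fun r hr => chi_erase_ne A hr⟩

lemma MM_indep {p y : ℕ} (hp : y < p) : Indep p (MM y) := by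
  have h : p ∉ Nat.primesLE y := fun h => by have := (Nat.mem_primesLE.1 h).1; omega
  intro A
  unfold MM
  rw [(JJ_indep h A).1, (JJ_indep h A).2]; exact ⟨rfl, rfl⟩

lemma JJ_step {p : ℕ} {s : Finset ℕ} (hp : p ∉ s) (A : Finset ℕ) :
    JJ (insert p s) (insert p A) + JJ (insert p s) (A.erase p) = 2 * (1 + 1 / (p : ℝ)) * JJ s A := by
  unfold JJ
  rw [← integral_add (Wd_int _ _) (Wd_int _ _), ← integral_const_mul]
  congr 1
  funext t
  have e1 : ∀ B : Finset ℕ, Wd 0 (insert p s) B t =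
      (1 + 2 * (chi B p * rr 0 p) * Real.cos (t * Real.log p) + (chi B p * rr 0 p) ^ 2) * Wd 0 s B t := by
    intro B; rw [Wd_eq_rr, Finset.prod_insert hp, ← Wd_eq_rr]
  have e2 : Wd 0 s (insert p A) t = Wd 0 s A t := by
    unfold Wd
    refine Finset.prod_congr rfl fun r hr => ?_
    rw [chi_insert_ne A (show r ≠ p from fun e => hp (e ▸ hr))]
  have e3 : Wd 0 s (A.erase p) t = Wd 0 s A t := by
    unfold Wd
    refine Finset.prod_congr rfl fun r hr => ?_
    rw [chi_erase_ne A (show r ≠ p from fun e => hp (e ▸ hr))]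
  rw [e1, e1, e2, e3, chi_insert_self, chi_erase_self, ← rr0_sq]
  ring

lemma primesLE_succ_prime {y : ℕ} (h : (y + 1).Prime) :
    Nat.primesLE (y + 1) = insert (y + 1) (Nat.primesLE y) := by
  ext p; simp only [Finset.mem_insert, Nat.mem_primesLE]
  constructor
  · rintro ⟨h1, h2⟩
    rcases Nat.lt_or_ge y p with h3 | h3
    · left; omega
    · right; exact ⟨h3, h2⟩
  · rintro (rfl | ⟨h1, h2⟩)
    · exact ⟨le_rfl, h⟩
    · exact ⟨by omega, h2⟩

lemma primesLE_succ_not {y : ℕ} (h : ¬ (y + 1).Prime) :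
    Nat.primesLE (y + 1) = Nat.primesLE y := by
  ext p; simp only [Nat.mem_primesLE]
  constructor
  · rintro ⟨h1, h2⟩
    refine ⟨?_, h2⟩
    rcases Nat.lt_or_ge y p with h3 | h3
    · have : p = y + 1 := by omega
      subst this; exact absurd h2 h
    · exact h3
  · rintro ⟨h1, h2⟩; exact ⟨by omega, h2⟩

lemma MM_mart {N y : ℕ} (hy : y + 1 ≤ N) {Φ : Finset ℕ → ℝ} (hΦ : ∀ p, y < p → Indep p Φ) :
    Ex hf (Nat.primesLE N) (fun A => Φ A * MM (y + 1) A) =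
      Ex hf (Nat.primesLE N) (fun A => Φ A * MM y A) := by
  by_cases h : (y + 1).Prime
  · have hmem : y + 1 ∈ Nat.primesLE N := Nat.mem_primesLE.2 ⟨hy, h⟩
    have hn : y + 1 ∉ Nat.primesLE y := fun h => by have := (Nat.mem_primesLE.1 h).1; omega
    rw [Ex_coord hf hmem]
    refine Ex_congr hf fun A _ => ?_
    have hi := hΦ (y + 1) (by omega) A
    rw [hi.1, hi.2]
    have hz := Zs_pos (Nat.primesLE y)
    have hj := JJ_step hn A
    have hZ : Zs (insert (y + 1) (Nat.primesLE y)) = (1 + 1 / ((y + 1 : ℕ) : ℝ)) * Zs (Nat.primesLE y) := by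
      unfold Zs; rw [Finset.prod_insert hn]
    unfold MM
    rw [primesLE_succ_prime h, hZ]
    have hpos : 0 < 1 + 1 / ((y + 1 : ℕ) : ℝ) := by positivity
    have e : JJ (insert (y + 1) (Nat.primesLE y)) (insert (y + 1) A) =
      2 * (1 + 1 / ((y + 1 : ℕ) : ℝ)) * JJ (Nat.primesLE y) A - JJ (insert (y + 1) (Nat.primesLE y)) (A.erase (y + 1)) := by
      linarith
    rw [e]
    field_simp
    ring
  · unfold MM; rw [primesLE_succ_not h]

open Classical in
def LL (a b : ℕ) (lam : ℝ) (A : Finset ℕ) : ℝ :=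
  if ∀ j, a ≤ j → j ≤ b → MM j A ≤ lam then 1 else 0

lemma LL_cases (a b : ℕ) (lam : ℝ) (A : Finset ℕ) : LL a b lam A = 0 ∨ LL a b lam A = 1 := by
  unfold LL; split_ifs <;> simp

lemma Indep_of {p : ℕ} {Φ : Finset ℕ → ℝ} (h : ∀ A B : Finset ℕ, (∀ j, j ≠ p → (j ∈ A ↔ j ∈ B)) → Φ A = Φ B) :
    Indep p Φ := fun A => ⟨h _ _ fun j hj => by simp [hj], h _ _ fun j hj => by simp [hj]⟩

lemma LL_indep {a b p : ℕ} (hp : b < p) (lam : ℝ) : Indep p (LL a b lam) := by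
  intro A
  have h1 : ∀ j, j ≤ b → MM j (insert p A) = MM j A := fun j hj => (MM_indep (by omega) A).1
  have h2 : ∀ j, j ≤ b → MM j (A.erase p) = MM j A := fun j hj => (MM_indep (by omega) A).2
  unfold LL
  constructor
  · congr 1; apply propext
    exact forall_congr' fun j => imp_congr_right fun _ => imp_congr_right fun hj => by rw [h1 j hj]
  · congr 1; apply propext
    exact forall_congr' fun j => imp_congr_right fun _ => imp_congr_right fun hj => by rw [h2 j hj]

lemma Indep_mul {p : ℕ} {Φ Ψ : Finset ℕ → ℝ} (h1 : Indep p Φ) (h2 : Indep p Ψ) :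
    Indep p (fun A => Φ A * Ψ A) := fun A => by
  simp only [(h1 A).1, (h1 A).2, (h2 A).1, (h2 A).2, and_self]

lemma LL_succ {a b : ℕ} (hab : a ≤ b) (lam : ℝ) (A : Finset ℕ) :
    (LL a (b + 1) lam A = LL a b lam A ∧ (LL a b lam A = 0 ∨ MM (b + 1) A ≤ lam)) ∨
    (LL a (b + 1) lam A = 0 ∧ lam ≤ MM (b + 1) A) := by
  by_cases h : MM (b + 1) A ≤ lam
  · left
    refine ⟨?_, Or.inr h⟩
    unfold LL
    congr 1; apply propext
    constructor
    · exact fun H j h1 h2 => H j h1 (by omega)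
    · intro H j h1 h2
      rcases Nat.lt_or_ge b j with h3 | h3
      · have : j = b + 1 := by omega
        rw [this]; exact h
      · exact H j h1 h3
  · right
    refine ⟨?_, le_of_not_ge h⟩
    unfold LL
    rw [if_neg]
    exact fun H => h (H (b + 1) (by omega) le_rfl)

lemma doob {a b N : ℕ} (hab : a ≤ b) (hbN : b ≤ N) {lam : ℝ} {Φ : Finset ℕ → ℝ}
    (hΦ0 : ∀ A, 0 ≤ Φ A) (hΦ : ∀ p, a < p → Indep p Φ) :
    lam * Ex hf (Nat.primesLE N) (fun A => Φ A * (1 - LL a b lam A)) +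
      Ex hf (Nat.primesLE N) (fun A => Φ A * LL a b lam A * MM b A) ≤
      Ex hf (Nat.primesLE N) (fun A => Φ A * MM a A) := by
  induction b, hab using Nat.le_induction with
  | base =>
    rw [← Ex_const_mul, ← Ex_add]
    refine Ex_mono hf_isP fun A _ => ?_
    have h0 := hΦ0 A
    unfold LL
    by_cases h : MM a A ≤ lam
    · rw [if_pos]
      · simp
      · intro j h1 h2
        have : j = a := by omega
        rw [this]; exact h
    · rw [if_neg]
      · push Not at h
        nlinarith
      · exact fun H => h (H a le_rfl le_rfl)
  | succ b hab ih =>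
    refine le_trans ?_ (ih (by omega))
    rw [← MM_mart (Φ := fun A => Φ A * LL a b lam A) hbN
      (fun p hp => Indep_mul (hΦ p (by omega)) (LL_indep hp lam))]
    rw [← Ex_const_mul, ← Ex_add, ← Ex_const_mul, ← Ex_add]
    refine Ex_mono hf_isP fun A _ => ?_
    have h0 := hΦ0 A
    rcases LL_succ hab lam A with ⟨h1, h2⟩ | ⟨h1, h2⟩
    · rw [h1]
    · rw [h1]
      rcases LL_cases a b lam A with h3 | h3 <;> rw [h3] <;> nlinarith

lemma Ex_union (q : ℕ → ℝ) (s u : Finset ℕ) (hd : Disjoint u s) (Φ : Finset ℕ → ℝ) (h : ∀ p ∈ u, Indep p Φ) :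
    Ex q (u ∪ s) Φ = Ex q s Φ := by
  induction u using Finset.induction_on with
  | empty => simp
  | insert p u hp ih =>
    rw [Finset.insert_union, Ex_insert]
    · have : (fun A => Φ (insert p A)) = Φ := by
        funext A; exact (h p (Finset.mem_insert_self _ _) A).1
      rw [this, ih (Finset.disjoint_of_subset_left (Finset.subset_insert _ _) hd)
        (fun r hr => h r (Finset.mem_insert_of_mem hr))]
      ring
    · rw [Finset.mem_union]
      rintro (h' | h')
      · exact hp h'
      · exact (Finset.disjoint_left.1 hd) (Finset.mem_insert_self _ _) h'

lemma Ex_primesLE {y N : ℕ} (hy : y ≤ N) (q : ℕ → ℝ) {Φ : Finset ℕ → ℝ} (h : ∀ p, y < p → Indep p Φ) :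
    Ex q (Nat.primesLE N) Φ = Ex q (Nat.primesLE y) Φ := by
  have e : Nat.primesLE N = (Nat.primesLE N \ Nat.primesLE y) ∪ Nat.primesLE y := by
    rw [Finset.sdiff_union_of_subset]
    intro p hp
    rw [Nat.mem_primesLE] at *
    exact ⟨hp.1.trans hy, hp.2⟩
  rw [e]
  refine Ex_union q _ _ Finset.sdiff_disjoint Φ fun p hp => h p ?_
  rw [Finset.mem_sdiff, Nat.mem_primesLE, Nat.mem_primesLE] at hp
  by_contra hc
  exact hp.2 ⟨by omega, hp.1.2⟩

lemma GG_indep {n p : ℕ} (hp : Yk n < p) (B : ℝ) : Indep p (GG n B) := by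
  intro A
  have h0 : ∀ k ≤ n, p ∉ Nat.primesLE (Yk k) := fun k hk h => by
    have := (Nat.mem_primesLE.1 h).1
    have := Yk_mono hk
    omega
  unfold GG
  constructor
  · congr 1; apply propext
    exact forall_congr' fun j => imp_congr_right fun hj => by rw [(JJ_indep (h0 j hj) A).1]
  · congr 1; apply propext
    exact forall_congr' fun j => imp_congr_right fun hj => by rw [(JJ_indep (h0 j hj) A).2]

lemma MM_one (A : Finset ℕ) : MM 1 A = 1 := by
  have : Nat.primesLE 1 = ∅ := by
    ext p; simp only [Nat.mem_primesLE, Finset.notMem_empty, iff_false]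
    rintro ⟨h1, h2⟩; have := h2.two_le; omega
  unfold MM JJ Zs Wd
  rw [this]
  simp only [Finset.prod_empty, mul_one, div_one]
  exact pk_one (by norm_num)

theorem max_bound : ∃ C : ℝ, 0 < C ∧ ∀ (n N : ℕ) (B lam : ℝ), 1 ≤ n → 1 ≤ B → 0 < lam → Yk n ≤ N →
    Ex hf (Nat.primesLE N) (fun A => 1 - LL (Yk n) N lam A) ≤
      1 / B + C * (1 + Real.log B) / (lam * Real.sqrt n) := by
  obtain ⟨C, hC, hG⟩ := GG_bound
  refine ⟨C, hC, fun n N B lam hn hB hl hN => ?_⟩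
  have hy2 := Yk_ge_two n
  have hGc : ∀ A, GG n B A = 0 ∨ GG n B A = 1 := fun A => by unfold GG; split_ifs <;> simp
  have h1 : Ex hf (Nat.primesLE N) (fun A => 1 - LL (Yk n) N lam A) ≤
      Ex hf (Nat.primesLE N) (fun A => 1 * (1 - LL 1 (Yk n) B A)) +
      Ex hf (Nat.primesLE N) (fun A => GG n B A * (1 - LL (Yk n) N lam A)) := by
    rw [← Ex_add]
    refine Ex_mono hf_isP fun A _ => ?_
    have hLn : LL 1 (Yk n) B A ≤ GG n B A := by
      unfold GG LL
      split_ifs with h h'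
      · exact le_rfl
      · exfalso; apply h'
        intro k hk
        have := h (Yk k) (by have := Yk_ge_two k; omega) (Yk_mono hk)
        unfold MM at this
        rwa [div_le_iff₀ (Zs_pos _)] at this
      · norm_num
      · exact le_rfl
    have hL2 : 0 ≤ LL (Yk n) N lam A := by rcases LL_cases (Yk n) N lam A with h | h <;> rw [h] <;> norm_num
    have hL1 : LL 1 (Yk n) B A ≤ 1 := by rcases LL_cases 1 (Yk n) B A with h | h <;> rw [h] <;> norm_num
    rcases hGc A with h | h
    · rw [h] at hLn ⊢; linarith
    · rw [h]; linarith
  have h2 := doob (a := 1) (b := Yk n) (N := N) (lam := B) (Φ := fun _ => 1) (by omega) hN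
    (fun _ => zero_le_one) (fun p _ A => ⟨rfl, rfl⟩)
  have h2' : 0 ≤ Ex hf (Nat.primesLE N) (fun A => 1 * LL 1 (Yk n) B A * MM (Yk n) A) :=
    Ex_nonneg hf_isP fun A _ => mul_nonneg (by rcases LL_cases 1 (Yk n) B A with h | h <;> rw [h] <;> norm_num)
      (MM_nonneg _ _)
  have h2'' : Ex hf (Nat.primesLE N) (fun A => 1 * MM 1 A) = 1 := by
    simp only [MM_one, mul_one]; exact Ex_one _ _
  rw [h2''] at h2
  have h3 := doob (a := Yk n) (b := N) (N := N) (lam := lam) (Φ := GG n B) hN le_rfl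
    (fun A => by rcases hGc A with h | h <;> rw [h] <;> norm_num) (fun p hp => GG_indep hp B)
  have h3' : 0 ≤ Ex hf (Nat.primesLE N) (fun A => GG n B A * LL (Yk n) N lam A * MM N A) :=
    Ex_nonneg hf_isP fun A _ => mul_nonneg (mul_nonneg (by rcases hGc A with h | h <;> rw [h] <;> norm_num)
      (by rcases LL_cases (Yk n) N lam A with h | h <;> rw [h] <;> norm_num)) (MM_nonneg _ _)
  rw [Ex_primesLE hN hf (Φ := fun A => GG n B A * MM (Yk n) A)
    (fun p hp => Indep_mul (GG_indep hp B) (MM_indep hp))] at h3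
  have h4 := hG n B hn hB
  have h5 : Ex hf (Nat.primesLE (Yk n)) (fun A => GG n B A * MM (Yk n) A) ≤ C * (1 + Real.log B) / Real.sqrt n := by
    refine le_trans (le_of_eq ?_) h4
    refine Ex_congr _ fun A _ => ?_
    unfold MM; ring
  have hn0 : (0 : ℝ) < Real.sqrt n := Real.sqrt_pos.2 (by exact_mod_cast hn)
  have h6 : Ex hf (Nat.primesLE N) (fun A => 1 * (1 - LL 1 (Yk n) B A)) ≤ 1 / B := by
    rw [le_div_iff₀ (by linarith)]; linarith
  have h7 : Ex hf (Nat.primesLE N) (fun A => GG n B A * (1 - LL (Yk n) N lam A)) ≤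
      C * (1 + Real.log B) / (lam * Real.sqrt n) := by
    rw [le_div_iff₀ (by positivity)]
    rw [le_div_iff₀ hn0] at h5
    have := h3.trans' (le_add_of_nonneg_right h3')
    have := mul_le_mul_of_nonneg_right this hn0.le
    linarith
  linarith
end RMF

namespace RMF

lemma prodchi_indep {p : ℕ} {T : Finset ℕ} (hp : p ∉ T) : Indep p (fun A => ∏ r ∈ T, chi A r) := by
  intro A
  exact ⟨Finset.prod_congr rfl fun r hr => chi_insert_ne A (fun e => hp (e ▸ hr)),
    Finset.prod_congr rfl fun r hr => chi_erase_ne A (fun e => hp (e ▸ hr))⟩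

lemma Ex_prodchi_aux {s T U : Finset ℕ} {p : ℕ} (hps : p ∈ s) (hT : p ∈ T) (hU : p ∉ U) :
    Ex hf s (fun A => (∏ r ∈ T, chi A r) * ∏ r ∈ U, chi A r) = 0 := by
  have e : ∀ A : Finset ℕ, (∏ r ∈ T, chi A r) * ∏ r ∈ U, chi A r =
      id (chi A p) * ((∏ r ∈ T.erase p, chi A r) * ∏ r ∈ U, chi A r) := by
    intro A; rw [← Finset.mul_prod_erase T _ hT, id]; ring
  simp only [e]
  rw [Ex_coord_mul hf hps id (Indep_mul (prodchi_indep (Finset.notMem_erase p T)) (prodchi_indep hU))]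
  simp [hf]; left; norm_num

lemma Ex_fA_mul {N n m : ℕ} (hn : n ≤ N) (hm : m ≤ N) (hnm : n ≠ m) :
    Ex hf (Nat.primesLE N) (fun A => fA A n * fA A m) = 0 := by
  unfold fA
  by_cases h1 : Squarefree n
  swap
  · simp only [if_neg h1, zero_mul]; exact Ex_const _ _ _
  by_cases h2 : Squarefree m
  swap
  · simp only [if_neg h2, mul_zero]; exact Ex_const _ _ _
  simp only [if_pos h1, if_pos h2]
  have hne : n.primeFactors ≠ m.primeFactors := by
    intro h
    apply hnm
    rw [← Nat.prod_primeFactors_of_squarefree h1, ← Nat.prod_primeFactors_of_squarefree h2, h]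
  have hmem : ∀ k p, k ≤ N → p ∈ k.primeFactors → p ∈ Nat.primesLE N := fun k p hk hp =>
    Nat.mem_primesLE.2 ⟨(Nat.le_of_mem_primeFactors hp).trans hk, Nat.prime_of_mem_primeFactors hp⟩
  by_cases hs : n.primeFactors ⊆ m.primeFactors
  · have : ¬ m.primeFactors ⊆ n.primeFactors := fun h => hne (Finset.Subset.antisymm hs h)
    obtain ⟨p, hp1, hp2⟩ := Finset.not_subset.1 this
    have := Ex_prodchi_aux (hmem m p hm hp1) hp1 hp2
    simpa only [mul_comm] using this
  · obtain ⟨p, hp1, hp2⟩ := Finset.not_subset.1 hs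
    exact Ex_prodchi_aux (hmem n p hn hp1) hp1 hp2

lemma fA_sq_le (A : Finset ℕ) (n : ℕ) : fA A n * fA A n ≤ 1 := by
  unfold fA
  split_ifs
  · rw [← Finset.prod_mul_distrib]
    simp [chi_mul_self]
  · norm_num

lemma Ex_SA_sq {N a b : ℕ} (hab : b ≤ a) (ha : a ≤ N) :
    Ex hf (Nat.primesLE N) (fun A => (SA A a - SA A b) ^ 2) ≤ (a : ℝ) - b := by
  have e : ∀ A : Finset ℕ, (SA A a - SA A b) ^ 2 =
      ∑ n ∈ Finset.Ioc b a, ∑ m ∈ Finset.Ioc b a, fA A n * fA A m := by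
    intro A
    have : SA A a - SA A b = ∑ n ∈ Finset.Ioc b a, fA A n := by
      unfold SA
      have h := Finset.sum_Ioc_consecutive (fun n => fA A n) (Nat.zero_le b) hab
      rw [show Finset.Icc 1 a = Finset.Ioc 0 a from rfl, show Finset.Icc 1 b = Finset.Ioc 0 b from rfl]
      linarith
    rw [this, sq, Finset.sum_mul_sum]
  simp only [e]
  rw [Ex_sum]
  simp only [Ex_sum]
  have : ∀ n ∈ Finset.Ioc b a, ∑ m ∈ Finset.Ioc b a, Ex hf (Nat.primesLE N) (fun A => fA A n * fA A m) ≤ 1 := by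
    intro n hn
    rw [Finset.mem_Ioc] at hn
    rw [Finset.sum_eq_single_of_mem n (Finset.mem_Ioc.2 hn)]
    · refine (Ex_mono hf_isP (Ψ := fun _ => 1) fun A _ => fA_sq_le A n).trans_eq (Ex_one _ _)
    · intro m hm hmn
      rw [Finset.mem_Ioc] at hm
      exact Ex_fA_mul (by omega) (by omega) (Ne.symm hmn)
  refine (Finset.sum_le_sum this).trans ?_
  rw [Finset.sum_const, Nat.card_Ioc, nsmul_eq_mul, mul_one, Nat.cast_sub hab]

lemma Ex_SA_sq' {N a b : ℕ} (hb : b ≤ N) (ha : a ≤ N) :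
    Ex hf (Nat.primesLE N) (fun A => (SA A a - SA A b) ^ 2) ≤ |(a : ℝ) - b| := by
  rcases le_total b a with h | h
  · exact (Ex_SA_sq h ha).trans (le_abs_self _)
  · rw [abs_sub_comm]
    refine le_trans ?_ ((Ex_SA_sq h hb).trans (le_abs_self _))
    refine le_of_eq (Ex_congr _ fun A _ => by ring)

lemma sum_blocks (g : ℕ → ℝ) (s0 H J : ℕ) :
    ∑ u ∈ Finset.Ioc s0 (s0 + J * H), g u =
      ∑ j ∈ Finset.range J, ∑ u ∈ Finset.Ioc (s0 + j * H) (s0 + j * H + H), g u := by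
  induction J with
  | zero => simp
  | succ J ih =>
    rw [Finset.sum_range_succ, ← ih]
    rw [show s0 + (J + 1) * H = s0 + J * H + H by ring]
    exact (Finset.sum_Ioc_consecutive g (by omega) (by omega)).symm

/-- block error -/
def eb (x a H : ℕ) (A : Finset ℕ) : ℝ :=
  2 / (H : ℝ) * ∑ u ∈ Finset.Ioc a (a + H), ∑ v ∈ Finset.Ioc a (a + H), (SA A (x / u) - SA A (x / v)) ^ 2

lemma block_bound {x a H : ℕ} (hH : 2 ≤ H) (haH : H ≤ a) (A : Finset ℕ) :
    ∑ u ∈ Finset.Ioc a (a + H), (if u.Prime then SA A (x / u) ^ 2 else 0) ≤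
      68 / Real.log H * ∑ u ∈ Finset.Ioc a (a + H), SA A (x / u) ^ 2 + eb x a H A := by
  have hH0 : (0 : ℝ) < H := by exact_mod_cast (by omega : 0 < H)
  have hl : 0 < Real.log H := Real.log_pos (by exact_mod_cast (by omega : 1 < H))
  set blk := Finset.Ioc a (a + H)
  have hcard : (blk.card : ℝ) = H := by simp [blk]
  have h1 : ∀ u, SA A (x / u) ^ 2 ≤ 2 / (H : ℝ) * ∑ v ∈ blk, SA A (x / v) ^ 2 +
      2 / (H : ℝ) * ∑ v ∈ blk, (SA A (x / u) - SA A (x / v)) ^ 2 := by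
    intro u
    have : ∑ v ∈ blk, SA A (x / u) ^ 2 ≤ ∑ v ∈ blk, (2 * SA A (x / v) ^ 2 + 2 * (SA A (x / u) - SA A (x / v)) ^ 2) :=
      Finset.sum_le_sum fun v _ => by nlinarith [sq_nonneg (SA A (x / u) - 2 * SA A (x / v))]
    rw [Finset.sum_const, nsmul_eq_mul, hcard, Finset.sum_add_distrib, ← Finset.mul_sum, ← Finset.mul_sum] at this
    rw [div_mul_eq_mul_div, div_mul_eq_mul_div, ← add_div, le_div_iff₀ hH0]
    linarith
  rw [← Finset.sum_filter]
  have hnn : 0 ≤ ∑ v ∈ blk, SA A (x / v) ^ 2 := Finset.sum_nonneg fun _ _ => sq_nonneg _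
  calc ∑ u ∈ blk.filter Nat.Prime, SA A (x / u) ^ 2
      ≤ ∑ u ∈ blk.filter Nat.Prime, (2 / (H : ℝ) * ∑ v ∈ blk, SA A (x / v) ^ 2 +
      2 / (H : ℝ) * ∑ v ∈ blk, (SA A (x / u) - SA A (x / v)) ^ 2) := Finset.sum_le_sum fun u _ => h1 u
    _ = (blk.filter Nat.Prime).card * (2 / (H : ℝ) * ∑ v ∈ blk, SA A (x / v) ^ 2) +
      2 / (H : ℝ) * ∑ u ∈ blk.filter Nat.Prime, ∑ v ∈ blk, (SA A (x / u) - SA A (x / v)) ^ 2 := by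
        rw [Finset.sum_add_distrib, Finset.sum_const, nsmul_eq_mul, ← Finset.mul_sum]
    _ ≤ _ := by
      refine add_le_add ?_ ?_
      · have hbt := brun_titchmarsh hH haH
        have := mul_le_mul_of_nonneg_right hbt
          (show 0 ≤ 2 / (H : ℝ) * ∑ v ∈ blk, SA A (x / v) ^ 2 by positivity)
        refine this.trans_eq ?_
        field_simp; ring
      · unfold eb
        refine mul_le_mul_of_nonneg_left ?_ (by positivity)
        exact Finset.sum_le_sum_of_subset_of_nonneg (Finset.filter_subset _ _)
          fun _ _ _ => Finset.sum_nonneg fun _ _ => sq_nonneg _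

lemma div_abs_le {x a H u v : ℕ} (hu : u ∈ Finset.Ioc a (a + H)) (hv : v ∈ Finset.Ioc a (a + H)) (ha : 0 < a) :
    |((x / u : ℕ) : ℝ) - ((x / v : ℕ) : ℝ)| ≤ ((x / a : ℕ) : ℝ) - ((x / (a + H) : ℕ) : ℝ) := by
  rw [Finset.mem_Ioc] at hu hv
  have u1 : ((x / u : ℕ) : ℝ) ≤ ((x / a : ℕ) : ℝ) := by exact_mod_cast Nat.div_le_div_left hu.1.le ha
  have v1 : ((x / v : ℕ) : ℝ) ≤ ((x / a : ℕ) : ℝ) := by exact_mod_cast Nat.div_le_div_left hv.1.le ha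
  have u2 : ((x / (a + H) : ℕ) : ℝ) ≤ ((x / u : ℕ) : ℝ) := by
    exact_mod_cast Nat.div_le_div_left hu.2 (by omega)
  have v2 : ((x / (a + H) : ℕ) : ℝ) ≤ ((x / v : ℕ) : ℝ) := by
    exact_mod_cast Nat.div_le_div_left hv.2 (by omega)
  exact abs_le.2 ⟨by linarith, by linarith⟩

lemma Ex_eb {x a H N : ℕ} (ha : 0 < a) (hH : 0 < H) (hN : x ≤ N) :
    Ex hf (Nat.primesLE N) (eb x a H) ≤ 2 * H * (((x / a : ℕ) : ℝ) - ((x / (a + H) : ℕ) : ℝ)) := by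
  unfold eb
  rw [Ex_const_mul, Ex_sum]
  simp only [Ex_sum]
  have hH0 : (0 : ℝ) < H := by exact_mod_cast hH
  set d := ((x / a : ℕ) : ℝ) - ((x / (a + H) : ℕ) : ℝ)
  have : ∑ u ∈ Finset.Ioc a (a + H), ∑ v ∈ Finset.Ioc a (a + H),
      Ex hf (Nat.primesLE N) (fun A => (SA A (x / u) - SA A (x / v)) ^ 2) ≤
      ∑ u ∈ Finset.Ioc a (a + H), ∑ v ∈ Finset.Ioc a (a + H), d :=
    Finset.sum_le_sum fun u hu => Finset.sum_le_sum fun v hv =>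
      (Ex_SA_sq' ((Nat.div_le_self _ _).trans hN) ((Nat.div_le_self _ _).trans hN)).trans
        (div_abs_le hu hv ha)
  refine (mul_le_mul_of_nonneg_left this (by positivity)).trans_eq ?_
  simp only [Finset.sum_const, Nat.card_Ioc, nsmul_eq_mul, Nat.add_sub_cancel_left]
  field_simp

/-- total error -/
def err (x : ℕ) (A : Finset ℕ) : ℝ :=
  ∑ j ∈ Finset.range x, eb x (Nat.sqrt x + j * Nat.sqrt (Nat.sqrt x)) (Nat.sqrt (Nat.sqrt x)) A

lemma eb_nonneg (x a H A) : 0 ≤ eb x a H A := by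
  unfold eb
  exact mul_nonneg (by positivity) (Finset.sum_nonneg fun _ _ => Finset.sum_nonneg fun _ _ => sq_nonneg _)

lemma err_nonneg (x A) : 0 ≤ err x A := Finset.sum_nonneg fun _ _ => eb_nonneg _ _ _ _

lemma Ex_err {x N : ℕ} (hx : 1 ≤ x) (hN : x ≤ N) :
    Ex hf (Nat.primesLE N) (err x) ≤ 6 * Nat.sqrt (Nat.sqrt x) * Nat.sqrt x := by
  set s0 := Nat.sqrt x with hs0
  set H := Nat.sqrt s0 with hH
  have hs1 : 0 < s0 := Nat.sqrt_pos.2 hx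
  have hH1 : 0 < H := Nat.sqrt_pos.2 hs1
  unfold err
  rw [Ex_sum]
  have h1 : ∑ j ∈ Finset.range x, Ex hf (Nat.primesLE N) (eb x (s0 + j * H) H) ≤
      ∑ j ∈ Finset.range x, 2 * (H : ℝ) * (((x / (s0 + j * H) : ℕ) : ℝ) - ((x / (s0 + (j + 1) * H) : ℕ) : ℝ)) := by
    refine Finset.sum_le_sum fun j _ => ?_
    have := Ex_eb (x := x) (a := s0 + j * H) (H := H) (N := N) (by omega) hH1 hN
    rwa [show s0 + j * H + H = s0 + (j + 1) * H by ring] at this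
  refine h1.trans ?_
  rw [← Finset.mul_sum, Finset.sum_range_sub' (fun j => ((x / (s0 + j * H) : ℕ) : ℝ))]
  have h2 : x / s0 ≤ 3 * s0 := by
    have := Nat.sqrt_le_add x
    rw [← hs0] at this
    refine (Nat.div_le_div_right this).trans ?_
    rw [Nat.div_le_iff_le_mul_add_pred hs1]
    nlinarith
  have h3 : ((x / s0 : ℕ) : ℝ) ≤ 3 * s0 := by exact_mod_cast h2
  have h4 : (0 : ℝ) ≤ ((x / (s0 + x * H) : ℕ) : ℝ) := by positivity
  rw [zero_mul, add_zero]
  calc 2 * (H : ℝ) * (((x / s0 : ℕ) : ℝ) - ((x / (s0 + x * H) : ℕ) : ℝ)) ≤ 2 * (H : ℝ) * (3 * s0) := by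
        refine mul_le_mul_of_nonneg_left ?_ (by positivity); linarith
    _ = _ := by ring

lemma sum_div_le {x s0 M : ℕ} (hs0 : s0 = Nat.sqrt x) (g : ℕ → ℝ) (hg : ∀ m, 0 ≤ g m) (g0 : g 0 = 0) :
    ∑ u ∈ Finset.Ioc s0 M, g (x / u) ≤
      3 * (x : ℝ) * ∑ m ∈ Finset.Icc 1 s0, g m / ((m : ℝ) * (m + 1)) := by
  have hmap : ∀ u ∈ Finset.Ioc s0 M, x / u ∈ Finset.range (s0 + 1) := by
    intro u hu
    rw [Finset.mem_Ioc] at hu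
    rw [Finset.mem_range, Nat.div_lt_iff_lt_mul (by omega)]
    have := Nat.lt_succ_sqrt x
    rw [← hs0] at this
    simp only [Nat.succ_eq_add_one] at this
    nlinarith
  rw [← Finset.sum_fiberwise_of_maps_to hmap, Finset.range_eq_Ico, Finset.sum_eq_sum_Ico_succ_bot (by omega)]
  have hz : ∑ u ∈ (Finset.Ioc s0 M).filter (fun u => x / u = 0), g (x / u) = 0 :=
    Finset.sum_eq_zero fun u hu => by rw [(Finset.mem_filter.1 hu).2, g0]
  rw [hz, zero_add, Finset.mul_sum]
  rw [show Finset.Ico (0 + 1) (s0 + 1) = Finset.Icc 1 s0 from rfl]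
  refine Finset.sum_le_sum fun m hm => ?_
  rw [Finset.mem_Icc] at hm
  have e : ∑ u ∈ (Finset.Ioc s0 M).filter (fun u => x / u = m), g (x / u) =
      ((Finset.Ioc s0 M).filter (fun u => x / u = m)).card * g m := by
    rw [Finset.sum_congr rfl (fun u hu => by rw [(Finset.mem_filter.1 hu).2] : ∀ u ∈ _, g (x / u) = g m),
      Finset.sum_const, nsmul_eq_mul]
  rw [e]
  have hsub : (Finset.Ioc s0 M).filter (fun u => x / u = m) ⊆ Finset.Ioc (x / (m + 1)) (x / m) := by
    intro u hu
    simp only [Finset.mem_filter, Finset.mem_Ioc] at hu ⊢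
    obtain ⟨⟨h1, h2⟩, h3⟩ := hu
    constructor
    · rw [Nat.div_lt_iff_lt_mul (by omega), mul_comm]
      rw [← Nat.div_lt_iff_lt_mul (by omega)]; omega
    · rw [Nat.le_div_iff_mul_le (by omega), mul_comm, ← Nat.le_div_iff_mul_le (by omega)]; omega
  have hcard := Finset.card_le_card hsub
  rw [Nat.card_Ioc] at hcard
  have hle : x / (m + 1) ≤ x / m := Nat.div_le_div_left (by omega) (by omega)
  have hm0 : (0 : ℝ) < m := by exact_mod_cast hm.1
  have hc2 : (((Finset.Ioc s0 M).filter (fun u => x / u = m)).card : ℝ) ≤ 3 * x / ((m : ℝ) * (m + 1)) := by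
    have a1 : (((Finset.Ioc s0 M).filter (fun u => x / u = m)).card : ℝ) ≤
        ((x / m : ℕ) : ℝ) - ((x / (m + 1) : ℕ) : ℝ) := by
      rw [← Nat.cast_sub hle]; exact_mod_cast hcard
    have a2 : ((x / m : ℕ) : ℝ) ≤ (x : ℝ) / m := Nat.cast_div_le
    have a3 : (x : ℝ) / (m + 1) ≤ ((x / (m + 1) : ℕ) : ℝ) + 1 := by
      rw [div_le_iff₀ (by positivity)]
      have := (Nat.lt_mul_div_succ x (show 0 < m + 1 by omega)).le
      have h' : (x : ℝ) ≤ ((m + 1 : ℕ) : ℝ) * ((x / (m + 1) + 1 : ℕ) : ℝ) := by exact_mod_cast this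
      push_cast at h'
      push_cast
      linarith
    have a4 : (m : ℝ) * (m + 1) ≤ 2 * x := by
      have h1 : m * m ≤ x := (Nat.mul_le_mul hm.2 hm.2).trans (hs0 ▸ Nat.sqrt_le x)
      have : m * (m + 1) ≤ 2 * x := by nlinarith
      exact_mod_cast this
    have a5 : (x : ℝ) / m - x / (m + 1) = x / ((m : ℝ) * (m + 1)) := by field_simp; ring
    have a6 : 1 ≤ 2 * x / ((m : ℝ) * (m + 1)) := by rw [le_div_iff₀ (by positivity)]; linarith
    have a7 : 3 * x / ((m : ℝ) * (m + 1)) = x / ((m : ℝ) * (m + 1)) + 2 * x / ((m : ℝ) * (m + 1)) := by ring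
    linarith
  calc _ ≤ 3 * x / ((m : ℝ) * (m + 1)) * g m := mul_le_mul_of_nonneg_right hc2 (hg m)
    _ = _ := by ring

def VA (A : Finset ℕ) (x : ℕ) : ℝ :=
  ∑ p ∈ (Finset.Icc 1 x).filter (fun p : ℕ => Nat.Prime p ∧ Real.sqrt x < (p : ℝ)), SA A (x / p) ^ 2

theorem VA_bound : ∃ C : ℝ, 0 < C ∧ ∀ (x : ℕ) (A : Finset ℕ), 16 ≤ x →
    VA A x ≤ C * x * MM x A + err x A := by
  obtain ⟨C, hC, hprod⟩ := prod_primes_le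
  refine ⟨204 * C * 8, by positivity, fun x A hx => ?_⟩
  set s0 := Nat.sqrt x with hs0
  set H := Nat.sqrt s0 with hH
  have hs4 : 4 ≤ s0 := Nat.le_sqrt.2 (by omega)
  have hH2 : 2 ≤ H := Nat.le_sqrt.2 (by omega)
  have hHs : H ≤ s0 := Nat.sqrt_le_self s0
  have hsx : s0 ≤ x := Nat.sqrt_le_self x
  have h1 : VA A x ≤ ∑ u ∈ Finset.Ioc s0 (s0 + x * H), (if u.Prime then SA A (x / u) ^ 2 else 0) := by
    unfold VA
    rw [← Finset.sum_filter]
    refine Finset.sum_le_sum_of_subset_of_nonneg ?_ fun _ _ _ => sq_nonneg _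
    intro p hp
    simp only [Finset.mem_filter, Finset.mem_Icc, Finset.mem_Ioc] at hp ⊢
    refine ⟨⟨?_, ?_⟩, hp.2.1⟩
    · have : (s0 : ℝ) < p := lt_of_le_of_lt (Real.nat_sqrt_le_real_sqrt) hp.2.2
      exact_mod_cast this
    · nlinarith [hp.1.2]
  rw [sum_blocks] at h1
  have h2 : ∑ j ∈ Finset.range x, ∑ u ∈ Finset.Ioc (s0 + j * H) (s0 + j * H + H),
      (if u.Prime then SA A (x / u) ^ 2 else 0) ≤ ∑ j ∈ Finset.range x,
      (68 / Real.log H * ∑ u ∈ Finset.Ioc (s0 + j * H) (s0 + j * H + H), SA A (x / u) ^ 2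
        + eb x (s0 + j * H) H A) :=
    Finset.sum_le_sum fun j _ => block_bound hH2 (by omega) A
  rw [Finset.sum_add_distrib, ← Finset.mul_sum, ← sum_blocks (fun u => SA A (x / u) ^ 2)] at h2
  have h3 := sum_div_le (M := s0 + x * H) hs0 (fun m => SA A m ^ 2) (fun _ => sq_nonneg _) (by simp [SA])
  have h4 := SA_sum_le_JJ A hsx
  have hH1 : (2 : ℝ) ≤ H := by exact_mod_cast hH2
  have hl : 0 < Real.log H := Real.log_pos (by linarith)
  have hx0 : (0 : ℝ) < x := by exact_mod_cast (by omega : 0 < x)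
  have h5 : Real.log x ≤ 8 * Real.log H := by
    have a1 : x < (s0 + 1) * (s0 + 1) := Nat.lt_succ_sqrt x
    have a2 : s0 < (H + 1) * (H + 1) := Nat.lt_succ_sqrt s0
    have a3 : H + 1 ≤ H ^ 2 := by nlinarith
    have a4 : s0 + 1 ≤ H ^ 4 := by nlinarith
    have a5 : x ≤ H ^ 8 := by nlinarith
    have a6 : (x : ℝ) ≤ (H : ℝ) ^ 8 := by exact_mod_cast a5
    have := Real.log_le_log hx0 a6
    rwa [Real.log_pow] at this
  have h6 : JJ (Nat.primesLE x) A ≤ C * Real.log x * MM x A := by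
    have hz := Zs_pos (Nat.primesLE x)
    have e : JJ (Nat.primesLE x) A = Zs (Nat.primesLE x) * MM x A := by
      unfold MM; field_simp
    rw [e]
    exact mul_le_mul_of_nonneg_right (hprod x (by omega)) (MM_nonneg _ _)
  have hM := MM_nonneg x A
  have h7 : 68 / Real.log H * ∑ u ∈ Finset.Ioc s0 (s0 + x * H), SA A (x / u) ^ 2 ≤
      204 * C * 8 * x * MM x A := by
    have b1 : ∑ u ∈ Finset.Ioc s0 (s0 + x * H), SA A (x / u) ^ 2 ≤ 3 * x * (C * (8 * Real.log H) * MM x A) := by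
      refine h3.trans (mul_le_mul_of_nonneg_left ?_ (by positivity))
      refine (h4.trans h6).trans ?_
      gcongr
    refine (mul_le_mul_of_nonneg_left b1 (by positivity)).trans_eq ?_
    field_simp; ring
  have h8 : err x A = ∑ j ∈ Finset.range x, eb x (s0 + j * H) H A := rfl
  rw [h8]
  linarith
end RMF

namespace RMF

variable {Ω : Type*} [MeasurableSpace Ω] {μ : Measure Ω} [IsProbabilityMeasure μ] {f : Ω → ℕ → ℝ}

open Classical in
/-- random configuration -/
def cfg (f : Ω → ℕ → ℝ) (s : Finset ℕ) (ω : Ω) : Finset ℕ := s.filter (fun p => f ω p = 1)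

lemma cfg_prob (hR : IsRademacherRMF μ f) (N : ℕ) {B : Finset ℕ} (hB : B ⊆ Nat.primesLE N) :
    μ {ω | cfg f (Nat.primesLE N) ω = B} ≤
      ENNReal.ofReal ((∏ p ∈ B, hf p) * (∏ p ∈ Nat.primesLE N \ B, (1 - hf p))) := by
  classical
  set s := Nat.primesLE N with hs
  have hsp : ∀ p ∈ s, Nat.Prime p := fun p hp => (Nat.mem_primesLE.1 hp).2
  set S : Finset Nat.Primes := s.subtype Nat.Prime with hS
  set E : Nat.Primes → Set ℝ := fun p => if (p : ℕ) ∈ B then {1} else {1}ᶜ with hE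
  have hEm : ∀ p, MeasurableSet (E p) := fun p => by
    simp only [hE]; split_ifs
    · exact measurableSet_singleton _
    · exact (measurableSet_singleton _).compl
  have hsub : {ω | cfg f s ω = B} ⊆ ⋂ p ∈ S, (fun ω => f ω (p : ℕ)) ⁻¹' E p := by
    intro ω hω
    simp only [Set.mem_setOf_eq] at hω
    simp only [Set.mem_iInter, Set.mem_preimage]
    intro p hp
    have hps : (p : ℕ) ∈ s := Finset.mem_subtype.1 hp
    simp only [hE]
    split_ifs with h
    · rw [← hω] at h; exact (Finset.mem_filter.1 h).2
    · intro h1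
      apply h; rw [← hω]; exact Finset.mem_filter.2 ⟨hps, h1⟩
  refine (measure_mono hsub).trans ?_
  rw [hR.indep.measure_inter_preimage_eq_mul S (fun p _ => hEm p)]
  have hhalf : ∀ p ∈ S, μ ((fun ω => f ω (p : ℕ)) ⁻¹' E p) = ENNReal.ofReal (1 / 2) := by
    intro p _
    have h1 : μ ((fun ω => f ω (p : ℕ)) ⁻¹' {1}) = 1 / 2 := hR.prob_one p p.2
    have e2 : ENNReal.ofReal (1 / 2) = 1 / 2 := by
      rw [ENNReal.ofReal_div_of_pos (by norm_num)]; norm_num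
    rw [e2]
    simp only [hE]
    split_ifs
    · exact h1
    · rw [Set.preimage_compl, measure_compl ((hR.meas p) (measurableSet_singleton 1)) (measure_ne_top _ _),
        h1, measure_univ]
      norm_num
  rw [Finset.prod_congr rfl hhalf, Finset.prod_const, ← ENNReal.ofReal_pow (by norm_num)]
  apply ENNReal.ofReal_le_ofReal
  have hc : S.card = s.card := 
    (Finset.card_subtype Nat.Prime s).trans (by rw [Finset.filter_true_of_mem hsp])
  rw [hc]
  apply le_of_eq
  simp only [hf]
  rw [show (1 - 1 / 2 : ℝ) = 1 / 2 by norm_num, Finset.prod_const, Finset.prod_const, ← pow_add]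
  congr 1
  rw [Finset.card_sdiff_of_subset hB]
  have := Finset.card_le_card hB
  omega

lemma prob_le_Ex (hR : IsRademacherRMF μ f) (N : ℕ) (P : Finset ℕ → Prop) {Φ : Finset ℕ → ℝ}
    (h0 : ∀ A, 0 ≤ Φ A) (h1 : ∀ A, P A → 1 ≤ Φ A) :
    μ {ω | P (cfg f (Nat.primesLE N) ω)} ≤ ENNReal.ofReal (Ex hf (Nat.primesLE N) Φ) := by
  classical
  set s := Nat.primesLE N with hs
  have hsub : {ω | P (cfg f s ω)} ⊆ ⋃ B ∈ s.powerset.filter P, {ω | cfg f s ω = B} := by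
    intro ω hω
    simp only [Set.mem_iUnion, Set.mem_setOf_eq, exists_prop]
    exact ⟨_, Finset.mem_filter.2 ⟨Finset.mem_powerset.2 (Finset.filter_subset _ _), hω⟩, rfl⟩
  refine (measure_mono hsub).trans ((measure_biUnion_finset_le _ _).trans ?_)
  have hw : ∀ B : Finset ℕ, 0 ≤ (∏ p ∈ B, hf p) * (∏ p ∈ s \ B, (1 - hf p)) := fun B =>
    mul_nonneg (Finset.prod_nonneg fun p _ => by norm_num [hf])
      (Finset.prod_nonneg fun p _ => by norm_num [hf])
  calc ∑ B ∈ s.powerset.filter P, μ {ω | cfg f s ω = B}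
      ≤ ∑ B ∈ s.powerset.filter P, ENNReal.ofReal ((∏ p ∈ B, hf p) * (∏ p ∈ s \ B, (1 - hf p))) :=
        Finset.sum_le_sum fun B hB =>
          cfg_prob hR N (Finset.mem_powerset.1 (Finset.mem_filter.1 hB).1)
    _ = ENNReal.ofReal (∑ B ∈ s.powerset.filter P, (∏ p ∈ B, hf p) * (∏ p ∈ s \ B, (1 - hf p))) :=
        (ENNReal.ofReal_sum_of_nonneg fun B _ => hw B).symm
    _ ≤ _ := by
      apply ENNReal.ofReal_le_ofReal
      unfold Ex
      calc _ ≤ ∑ B ∈ s.powerset.filter P, (∏ p ∈ B, hf p) * (∏ p ∈ s \ B, (1 - hf p)) * Φ B :=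
            Finset.sum_le_sum fun B hB => le_mul_of_one_le_right (hw B) (h1 B (Finset.mem_filter.1 hB).2)
        _ ≤ _ := Finset.sum_le_sum_of_subset_of_nonneg (Finset.filter_subset _ _)
            fun B _ _ => mul_nonneg (hw B) (h0 B)

lemma ae_sign (hR : IsRademacherRMF μ f) : ∀ᵐ ω ∂μ, ∀ p : ℕ, p.Prime → f ω p = 1 ∨ f ω p = -1 := by
  rw [ae_all_iff]
  intro p
  by_cases hp : p.Prime
  · have hm1 : MeasurableSet {ω | f ω p = 1} := hR.meas p (measurableSet_singleton 1)
    have hm2 : MeasurableSet {ω | f ω p = -1} := hR.meas p (measurableSet_singleton (-1))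
    have hd : Disjoint {ω | f ω p = 1} {ω | f ω p = -1} := by
      rw [Set.disjoint_left]
      intro ω h1 h2
      simp only [Set.mem_setOf_eq] at h1 h2
      rw [h1] at h2; norm_num at h2
    have hu : μ ({ω | f ω p = 1} ∪ {ω | f ω p = -1}) = 1 := by
      rw [measure_union hd hm2, hR.prob_one p hp, hR.prob_neg_one p hp]
      exact ENNReal.add_halves 1
    have := (prob_compl_eq_zero_iff (hm1.union hm2)).2 hu
    rw [ae_iff]
    refine measure_mono_null ?_ this
    intro ω hω
    simp only [Set.mem_setOf_eq, Classical.not_imp] at hω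
    simp only [Set.mem_compl_iff, Set.mem_union, Set.mem_setOf_eq]
    exact hω.2
  · exact Filter.Eventually.of_forall fun ω h => absurd h hp

lemma f_eq_fA (hR : IsRademacherRMF μ f) {ω : Ω} (hω : ∀ p : ℕ, p.Prime → f ω p = 1 ∨ f ω p = -1)
    {N n : ℕ} (hn : n ≤ N) : f ω n = fA (cfg f (Nat.primesLE N) ω) n := by
  unfold fA
  split_ifs with h
  · rw [hR.eq_prod_of_squarefree ω n h]
    refine Finset.prod_congr rfl fun p hp => ?_
    have hpp := Nat.prime_of_mem_primeFactors hp
    have hmem : p ∈ Nat.primesLE N :=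
      Nat.mem_primesLE.2 ⟨(Nat.le_of_mem_primeFactors hp).trans hn, hpp⟩
    unfold chi cfg
    rcases hω p hpp with h1 | h1
    · rw [if_pos (Finset.mem_filter.2 ⟨hmem, h1⟩), h1]
    · rw [if_neg, h1]
      intro h2
      have := (Finset.mem_filter.1 h2).2
      rw [h1] at this; norm_num at this
  · exact hR.eq_zero_of_not_squarefree ω n h

lemma Vrad_eq (hR : IsRademacherRMF μ f) {ω : Ω} (hω : ∀ p : ℕ, p.Prime → f ω p = 1 ∨ f ω p = -1)
    {N x : ℕ} (hx : x ≤ N) : Vrad f ω x = VA (cfg f (Nat.primesLE N) ω) x := by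
  unfold Vrad VA SA
  refine Finset.sum_congr rfl fun p _ => ?_
  rw [Nat.floor_div_eq_div]
  congr 1
  refine Finset.sum_congr rfl fun n hn => f_eq_fA hR hω ?_
  exact ((Finset.mem_Icc.1 hn).2.trans (Nat.div_le_self _ _)).trans hx
end RMF

namespace RMF

lemma sqrt_sqrt_bound {x : ℕ} (hx : 1 ≤ x) :
    ((Nat.sqrt (Nat.sqrt x) : ℝ) * (Nat.sqrt x : ℝ)) / x ≤ (x : ℝ) ^ (-(1 / 4) : ℝ) := by
  have hx0 : (0 : ℝ) < x := by exact_mod_cast hx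
  have h1 : (Nat.sqrt x : ℝ) ≤ (x : ℝ) ^ (1 / 2 : ℝ) := by
    rw [← Real.sqrt_eq_rpow]; exact Real.nat_sqrt_le_real_sqrt
  have h2 : (Nat.sqrt (Nat.sqrt x) : ℝ) ≤ (x : ℝ) ^ (1 / 4 : ℝ) := by
    refine (Real.nat_sqrt_le_real_sqrt).trans ?_
    rw [Real.sqrt_eq_rpow]
    refine (Real.rpow_le_rpow (by positivity) h1 (by norm_num)).trans (le_of_eq ?_)
    rw [← Real.rpow_mul hx0.le]; norm_num
  rw [div_le_iff₀ hx0]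
  refine (mul_le_mul h2 h1 (by positivity) (by positivity)).trans (le_of_eq ?_)
  rw [← Real.rpow_add hx0]
  nth_rewrite 3 [← Real.rpow_one (x : ℝ)]
  rw [← Real.rpow_add hx0]; norm_num

lemma summable_exp_rpow {ε : ℝ} (hε : 0 < ε) :
    Summable (fun i : ℕ => Real.exp (-(1 / 8) * (i : ℝ) ^ ε)) := by
  have ht : Filter.Tendsto (fun i : ℕ => (i : ℝ) ^ ε) Filter.atTop Filter.atTop :=
    (tendsto_rpow_atTop hε).comp tendsto_natCast_atTop_atTop
  have h := (isLittleO_exp_neg_mul_rpow_atTop (a := 1 / 8) (by norm_num) (-2 / ε)).comp_tendsto ht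
  refine summable_of_isBigO_nat (g := fun i : ℕ => (i : ℝ) ^ (-2 : ℝ))
    (Real.summable_nat_rpow.2 (by norm_num)) ?_
  refine h.isBigO.congr (fun i => rfl) (fun i => ?_)
  simp only [Function.comp]
  rw [← Real.rpow_mul (Nat.cast_nonneg i)]
  congr 1; field_simp

lemma testPoint_rpow_le {ε : ℝ} (i : ℕ) :
    ((testPoint ε i : ℕ) : ℝ) ^ (-(1 / 8) : ℝ) ≤ 2 * Real.exp (-(1 / 8) * (i : ℝ) ^ ε) := by
  set y := Real.exp ((i : ℝ) ^ ε) with hy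
  have hy1 : 1 ≤ y := Real.one_le_exp (Real.rpow_nonneg (Nat.cast_nonneg i) _)
  have h1 : y / 2 ≤ (testPoint ε i : ℝ) := by
    have a1 : y < (⌊y⌋₊ : ℝ) + 1 := Nat.lt_floor_add_one y
    have a2 : (1 : ℝ) ≤ (⌊y⌋₊ : ℝ) := by exact_mod_cast (Nat.one_le_floor_iff y).2 hy1
    show y / 2 ≤ (⌊y⌋₊ : ℝ)
    linarith
  refine (Real.rpow_le_rpow_of_nonpos (by positivity) h1 (by norm_num)).trans ?_
  rw [Real.div_rpow (by positivity) (by norm_num), div_eq_mul_inv, ← Real.rpow_neg (by norm_num),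
    hy, ← Real.exp_mul, mul_comm]
  refine mul_le_mul ?_ (le_of_eq (by ring_nf)) (by positivity) (by norm_num)
  calc (2 : ℝ) ^ (-(-(1 / 8)) : ℝ) ≤ 2 ^ (1 : ℝ) :=
        Real.rpow_le_rpow_of_exponent_le (by norm_num) (by norm_num)
    _ = 2 := Real.rpow_one 2

/-- abstract union bound -/
lemma core : ∃ C : ℝ, 0 < C ∧ ∀ (n N : ℕ) (I : Finset ℕ) (x : ℕ → ℕ) (T D : ℝ), 2 ≤ n → Yk n ≤ N →
    1 ≤ T → 0 < D → (∀ i ∈ I, Yk n ≤ x i ∧ x i ≤ N) →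
    ∃ Φ : Finset ℕ → ℝ, (∀ A, 0 ≤ Φ A) ∧
      (∀ A, (∃ i ∈ I, T < VA A (x i) * D / x i) → 1 ≤ Φ A) ∧
      Ex hf (Nat.primesLE N) Φ ≤ 1 / T + C * (1 + Real.log T) * D / (T * Real.sqrt n) +
        12 * D / T * ∑ i ∈ I, (x i : ℝ) ^ (-(1 / 4) : ℝ) := by
  obtain ⟨Cm, hCm, hmax⟩ := max_bound
  obtain ⟨Cv, hCv, hV⟩ := VA_bound
  refine ⟨2 * Cv * Cm, by positivity, fun n N I x T D hn hN hT hD hI => ?_⟩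
  have hT0 : 0 < T := by linarith
  have hY16 : 16 ≤ Yk n := by
    calc 16 = Yk 2 := by norm_num [Yk]
      _ ≤ Yk n := Nat.pow_le_pow_right (by norm_num) (Nat.pow_le_pow_right (by norm_num) hn)
  set lam := T / (2 * Cv * D) with hlam
  have hlam0 : 0 < lam := by positivity
  set η := T / (2 * D) with hη
  have hη0 : 0 < η := by positivity
  have hLL : ∀ A, 0 ≤ 1 - LL (Yk n) N lam A := fun A => by
    rcases LL_cases (Yk n) N lam A with h | h <;> rw [h] <;> norm_num
  have hx0 : ∀ i ∈ I, (0 : ℝ) < x i := fun i hi => by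
    have := (hI i hi).1; exact_mod_cast (by omega : 0 < x i)
  have hterm : ∀ A, ∀ i ∈ I, 0 ≤ (1 / (x i * η)) * err (x i) A := fun A i hi =>
    mul_nonneg (by have := hx0 i hi; positivity) (err_nonneg _ _)
  refine ⟨fun A => (1 - LL (Yk n) N lam A) + ∑ i ∈ I, (1 / (x i * η)) * err (x i) A,
    fun A => add_nonneg (hLL A) (Finset.sum_nonneg (hterm A)), ?_, ?_⟩
  · rintro A ⟨i, hi, hbad⟩
    have hs := Finset.single_le_sum (hterm A) hi
    have hs0 := Finset.sum_nonneg (hterm A)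
    by_cases hc : ∀ j, Yk n ≤ j → j ≤ N → MM j A ≤ lam
    · have hM := hc (x i) (hI i hi).1 (hI i hi).2
      have hv := hV (x i) A (hY16.trans (hI i hi).1)
      have hxi := hx0 i hi
      have h1 : 1 ≤ (1 / (x i * η)) * err (x i) A := by
        rw [one_div, inv_mul_eq_div, le_div_iff₀ (by positivity), one_mul]
        rw [lt_div_iff₀ hxi] at hbad
        have e1 : VA A (x i) * D ≤ (Cv * x i * lam + err (x i) A) * D := by
          refine mul_le_mul_of_nonneg_right (hv.trans ?_) hD.le
          gcongr
        have e2 : Cv * x i * lam * D = T * x i / 2 := by rw [hlam]; field_simp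
        have e3 : x i * η * D = T * x i / 2 := by rw [hη]; field_simp
        have e4 : x i * η * D ≤ err (x i) A * D := by nlinarith
        exact le_of_mul_le_mul_right e4 hD
      have := hLL A
      linarith
    · have : LL (Yk n) N lam A = 0 := by unfold LL; rw [if_neg hc]
      simp only [this]; linarith
  · rw [Ex_add, Ex_sum]
    refine add_le_add ((hmax n N T lam (by omega) hT hlam0 hN).trans (le_of_eq ?_)) ?_
    · rw [hlam]; congr 1; field_simp
    · rw [Finset.mul_sum]
      refine Finset.sum_le_sum fun i hi => ?_
      rw [Ex_const_mul]
      have hxi := hx0 i hi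
      have hx1 : 1 ≤ x i := by exact_mod_cast hxi
      have h1 := Ex_err hx1 (hI i hi).2
      calc 1 / (x i * η) * Ex hf (Nat.primesLE N) (err (x i))
          ≤ 1 / (x i * η) * (6 * Nat.sqrt (Nat.sqrt (x i)) * Nat.sqrt (x i)) := by gcongr
        _ = 12 * D / T * (((Nat.sqrt (Nat.sqrt (x i)) : ℝ) * (Nat.sqrt (x i) : ℝ)) / x i) := by
            rw [hη]; field_simp; ring
        _ ≤ _ := by gcongr; exact sqrt_sqrt_bound hx1

end RMF

namespace RMF

lemma T_bounds {T : ℝ} (hT : 1 ≤ T) :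
    1 / T ≤ T ^ (-(1 / 4 : ℝ)) ∧ (1 + Real.log T) / T ≤ 3 * T ^ (-(1 / 4 : ℝ)) := by
  have hT0 : 0 < T := by linarith
  have h1 : 1 / T ≤ T ^ (-(1 / 4 : ℝ)) := by
    rw [one_div, ← Real.rpow_neg_one]
    exact Real.rpow_le_rpow_of_exponent_le hT (by norm_num)
  refine ⟨h1, ?_⟩
  have h2 : Real.log T ≤ T ^ (3 / 4 : ℝ) / (3 / 4) := Real.log_le_rpow_div hT0.le (by norm_num)
  have h3 : T ^ (3 / 4 : ℝ) / T = T ^ (-(1 / 4 : ℝ)) := by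
    rw [div_eq_mul_inv, ← Real.rpow_neg_one, ← Real.rpow_add hT0]; norm_num
  have h4 : Real.log T / T ≤ T ^ (3 / 4 : ℝ) / (3 / 4) / T := by gcongr
  have h5 : T ^ (3 / 4 : ℝ) / (3 / 4) / T = 4 / 3 * (T ^ (3 / 4 : ℝ) / T) := by ring
  rw [h5, h3] at h4
  rw [add_div]
  have : 0 ≤ T ^ (-(1 / 4 : ℝ)) := by positivity
  linarith

lemma sqrt_le_rpow {n x : ℕ} (h : Yk n ≤ x) : Real.sqrt n ≤ 16 * (x : ℝ) ^ (1 / 8 : ℝ) := by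
  have hY : (0 : ℝ) < Yk n := by have := Yk_ge_two n; exact_mod_cast (by omega : 0 < Yk n)
  have hx : (Yk n : ℝ) ≤ x := by exact_mod_cast h
  have h1 : Real.sqrt n ≤ n := by
    rcases Nat.eq_zero_or_pos n with h0 | h0
    · simp [h0]
    · rw [Real.sqrt_le_left (by positivity)]
      have : (1 : ℝ) ≤ n := by exact_mod_cast h0
      nlinarith
  have h2 : (n : ℝ) ≤ 2 ^ n := by exact_mod_cast (Nat.lt_two_pow_self).le
  have h3 := log_Yk n
  have h4 := Real.log_le_log hY hx
  have h5 : Real.log x ≤ (x : ℝ) ^ (1 / 8 : ℝ) / (1 / 8) :=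
    Real.log_le_rpow_div (by positivity) (by norm_num)
  have h6 := Real.log_two_gt_d9
  have h7 : (0 : ℝ) < 2 ^ n := by positivity
  nlinarith

lemma Yk_le_Xpt {ε l : ℝ} {n : ℕ} (h : (n : ℝ) ≤ l ^ (1 / (4 * ε))) : (Yk n : ℝ) ≤ Xpt ε l := by
  have hY : (0 : ℝ) < Yk n := by have := Yk_ge_two n; exact_mod_cast (by omega : 0 < Yk n)
  rw [← Real.exp_log hY, log_Yk]
  unfold Xpt
  apply Real.exp_le_exp.2
  have h1 : (2 : ℝ) ^ n ≤ 2 ^ (l ^ (1 / (4 * ε))) := by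
    rw [← Real.rpow_natCast]
    exact Real.rpow_le_rpow_of_exponent_le (by norm_num) h
  have h6 := Real.log_two_lt_d9
  have h7 : (0 : ℝ) < 2 ^ n := by positivity
  nlinarith

lemma loglog_le {ε l : ℝ} {x : ℕ} (hx : 3 ≤ x) (h : (x : ℝ) ≤ Xpt ε l) (hl : 0 ≤ l) :
    Real.log (Real.log x) ≤ l ^ (1 / (4 * ε)) := by
  have hx0 : (3 : ℝ) ≤ x := by exact_mod_cast hx
  have h1 : Real.log x ≤ 2 ^ (l ^ (1 / (4 * ε))) := by
    rw [Real.log_le_iff_le_exp (by linarith)]; exact h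
  have h2 : 0 < Real.log x := Real.log_pos (by linarith)
  have h3 := Real.log_le_log h2 h1
  rw [Real.log_rpow (by norm_num)] at h3
  have h4 : 0 ≤ l ^ (1 / (4 * ε)) := Real.rpow_nonneg hl _
  have h6 := Real.log_two_lt_d9
  nlinarith

lemma testPoint_tendsto {ε : ℝ} (hε : 0 < ε) (X : ℝ) : ∃ M : ℕ, ∀ i : ℕ, M ≤ i → X < (testPoint ε i : ℝ) := by
  have ht : Filter.Tendsto (fun i : ℕ => (i : ℝ) ^ ε) Filter.atTop Filter.atTop :=
    (tendsto_rpow_atTop hε).comp tendsto_natCast_atTop_atTop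
  have h2 := (Real.tendsto_exp_atTop.comp ht).eventually_gt_atTop (X + 1)
  obtain ⟨M, hM⟩ := Filter.eventually_atTop.1 h2
  refine ⟨M, fun i hi => ?_⟩
  have h3 := hM i hi
  have h4 := Nat.lt_floor_add_one (Real.exp ((i : ℝ) ^ ε))
  simp only [Function.comp] at h3
  show X < (⌊Real.exp ((i : ℝ) ^ ε)⌋₊ : ℝ)
  linarith

lemma VA_nonneg (A : Finset ℕ) (x : ℕ) : 0 ≤ VA A x := by
  unfold VA; exact Finset.sum_nonneg fun _ _ => sq_nonneg _

end RMF

open RMF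
set_option maxHeartbeats 1000000

/-- For every `T ≥ 1` and sufficiently large `ℓ`, the probability that some test point
`x_i ∈ (X_{ℓ-1}, X_ℓ]` has `V(x_i)√(log log x_i)/x_i > T` is
`≪_ε (√(ℓ^K)/T)^{4/ε} 2^{-ℓ^K/ε} + T^{-1/4}`. -/
theorem variance_event_rademacher
    {Ω : Type*} [MeasurableSpace Ω] (μ : Measure Ω) [IsProbabilityMeasure μ]
    (f : Ω → ℕ → ℝ) (hf : IsRademacherRMF μ f) :
    ∃ ε₀ : ℝ, 0 < ε₀ ∧ ∀ ε : ℝ, 0 < ε → ε < ε₀ →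
      ∃ C : ℝ, 0 < C ∧ ∃ L : ℕ, ∀ ℓ : ℕ, L ≤ ℓ → 2 ≤ ℓ → ∀ T : ℝ, 1 ≤ T →
        μ {ω | ¬ ∀ i : ℕ, 1 ≤ i →
              Xpt ε ((ℓ : ℝ) - 1) < (testPoint ε i : ℝ) →
              (testPoint ε i : ℝ) ≤ Xpt ε (ℓ : ℝ) →
              Vrad f ω (testPoint ε i) *
                  Real.sqrt (Real.log (Real.log (testPoint ε i))) / (testPoint ε i : ℝ) ≤ T} ≤
          ENNReal.ofReal (C *
            ((Real.sqrt ((ℓ : ℝ) ^ (1 / (4 * ε))) / T) ^ (4 / ε) *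
                (2 : ℝ) ^ (-((ℓ : ℝ) ^ (1 / (4 * ε))) / ε) +
              T ^ (-(1 / 4 : ℝ)))) := by
  refine ⟨1, one_pos, fun ε hε _ => ?_⟩
  obtain ⟨C0, hC0, hcore⟩ := core
  set K : ℝ := 1 / (4 * ε) with hK
  have hK0 : 0 < K := by positivity
  set S : ℝ := ∑' i : ℕ, Real.exp (-(1 / 8) * (i : ℝ) ^ ε) with hS
  have hsum := summable_exp_rpow hε
  have hS0 : 0 ≤ S := tsum_nonneg fun i => (Real.exp_pos _).le
  set c : ℝ := Real.sqrt (2 ^ (K + 1)) with hc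
  have hc0 : 0 < c := Real.sqrt_pos.2 (by positivity)
  set C : ℝ := 1 + C0 * 3 * c + 384 * c * S with hC
  have hCpos : 0 < C := by positivity
  have hev : ∀ᶠ l : ℕ in Filter.atTop, (2 : ℝ) ≤ ((l : ℝ) - 1) ^ K := by
    have ht : Filter.Tendsto (fun l : ℕ => ((l : ℝ) - 1) ^ K) Filter.atTop Filter.atTop :=
      (tendsto_rpow_atTop hK0).comp
        (Filter.tendsto_atTop_add_const_right _ (-1) tendsto_natCast_atTop_atTop)
    exact ht.eventually_ge_atTop 2
  obtain ⟨L, hL⟩ := Filter.eventually_atTop.1 hev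
  refine ⟨C, hCpos, L, fun ℓ hℓ hℓ2 T hT => ?_⟩
  have hT0 : 0 < T := by linarith
  have hℓr : (2 : ℝ) ≤ ℓ := by exact_mod_cast hℓ2
  have hl2 := hL ℓ hℓ
  set n := ⌊((ℓ : ℝ) - 1) ^ K⌋₊ with hn
  have hn2 : 2 ≤ n := Nat.le_floor (by exact_mod_cast hl2)
  have hnle : (n : ℝ) ≤ ((ℓ : ℝ) - 1) ^ K := Nat.floor_le (by linarith)
  have hnlt : ((ℓ : ℝ) - 1) ^ K < n + 1 := Nat.lt_floor_add_one _
  have hmono : ((ℓ : ℝ) - 1) ^ K ≤ (ℓ : ℝ) ^ K :=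
    Real.rpow_le_rpow (by linarith) (by linarith) hK0.le
  have hnr : (2 : ℝ) ≤ n := by exact_mod_cast hn2
  set N := ⌊Xpt ε ℓ⌋₊ with hN
  have hYX : (Yk n : ℝ) ≤ Xpt ε ((ℓ : ℝ) - 1) := Yk_le_Xpt hnle
  have hYN : Yk n ≤ N := Nat.le_floor (Yk_le_Xpt (hnle.trans hmono))
  set D : ℝ := Real.sqrt ((ℓ : ℝ) ^ K) with hD
  have hlK : 0 < (ℓ : ℝ) ^ K := by positivity
  have hD0 : 0 < D := Real.sqrt_pos.2 hlK
  have hDn : D ≤ c * Real.sqrt n := by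
    rw [hD, hc, ← Real.sqrt_mul (by positivity)]
    apply Real.sqrt_le_sqrt
    have h1 : (ℓ : ℝ) ^ K ≤ (2 * ((ℓ : ℝ) - 1)) ^ K :=
      Real.rpow_le_rpow (by linarith) (by linarith) hK0.le
    rw [Real.mul_rpow (by norm_num) (by linarith)] at h1
    rw [Real.rpow_add (by norm_num), Real.rpow_one]
    have h2 : (0 : ℝ) < 2 ^ K := by positivity
    have h3 : ((ℓ : ℝ) - 1) ^ K ≤ 2 * n := by linarith
    calc (ℓ : ℝ) ^ K ≤ 2 ^ K * ((ℓ : ℝ) - 1) ^ K := h1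
      _ ≤ 2 ^ K * (2 * n) := by gcongr
      _ = _ := by ring
  obtain ⟨M, hM⟩ := testPoint_tendsto hε (Xpt ε ℓ)
  classical
  set I : Finset ℕ := (Finset.range M).filter (fun i =>
    Xpt ε ((ℓ : ℝ) - 1) < (testPoint ε i : ℝ) ∧ (testPoint ε i : ℝ) ≤ Xpt ε ℓ) with hI
  have hIx : ∀ i ∈ I, Yk n ≤ testPoint ε i ∧ testPoint ε i ≤ N := by
    intro i hi
    obtain ⟨_, h1, h2⟩ := Finset.mem_filter.1 hi
    exact ⟨by exact_mod_cast (hYX.trans h1.le), Nat.le_floor h2⟩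
  obtain ⟨Φ, hΦ0, hΦ1, hΦE⟩ := hcore n N I (testPoint ε) T D hn2 hYN hT hD0 hIx
  have hY16 : 16 ≤ Yk n := by
    calc 16 = Yk 2 := by norm_num [Yk]
      _ ≤ Yk n := Nat.pow_le_pow_right (by norm_num) (Nat.pow_le_pow_right (by norm_num) hn2)
  have hP := prob_le_Ex hf N (fun A => ∃ i ∈ I, T < VA A (testPoint ε i) * D / testPoint ε i) hΦ0 hΦ1
  refine le_trans (measure_mono_ae ?_) (hP.trans (ENNReal.ofReal_le_ofReal (hΦE.trans ?_)))
  · filter_upwards [ae_sign hf] with ω hω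
    intro hbad
    change ¬ _ at hbad
    push Not at hbad
    obtain ⟨i, _, h1, h2, h3⟩ := hbad
    have hiI : i ∈ I := Finset.mem_filter.2 ⟨Finset.mem_range.2 (by
      by_contra hcon
      exact absurd (hM i (not_lt.1 hcon)) (not_lt.2 h2)), h1, h2⟩
    refine ⟨i, hiI, lt_of_lt_of_le h3 ?_⟩
    rw [Vrad_eq hf hω (hIx i hiI).2]
    have := VA_nonneg (cfg f (Nat.primesLE N) ω) (testPoint ε i)
    have h4 : Real.sqrt (Real.log (Real.log (testPoint ε i))) ≤ D :=
      Real.sqrt_le_sqrt (loglog_le (by have := (hIx i hiI).1; omega) h2 (by linarith))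
    gcongr
  · obtain ⟨ht1, ht2⟩ := T_bounds hT
    set τ := T ^ (-(1 / 4 : ℝ)) with hτ
    have hτ0 : 0 < τ := by positivity
    have hsn : 0 < Real.sqrt n := Real.sqrt_pos.2 (by linarith)
    have hlog : 0 ≤ Real.log T := Real.log_nonneg hT
    have b2 : C0 * (1 + Real.log T) * D / (T * Real.sqrt n) ≤ C0 * 3 * c * τ := by
      have hDc : D / Real.sqrt n ≤ c := (div_le_iff₀ hsn).2 hDn
      calc C0 * (1 + Real.log T) * D / (T * Real.sqrt n)
          = C0 * ((1 + Real.log T) / T) * (D / Real.sqrt n) := by field_simp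
        _ ≤ C0 * (3 * τ) * c := by gcongr
        _ = _ := by ring
    have b3 : 12 * D / T * ∑ i ∈ I, ((testPoint ε i : ℕ) : ℝ) ^ (-(1 / 4) : ℝ) ≤ 384 * c * S * τ := by
      have hs1 : D * ∑ i ∈ I, ((testPoint ε i : ℕ) : ℝ) ^ (-(1 / 4) : ℝ) ≤ 32 * c * S := by
        rw [Finset.mul_sum]
        have hle : ∀ i ∈ I, D * ((testPoint ε i : ℕ) : ℝ) ^ (-(1 / 4) : ℝ) ≤
            32 * c * Real.exp (-(1 / 8) * (i : ℝ) ^ ε) := by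
          intro i hi
          have hx := (hIx i hi).1
          have hx0 : (0 : ℝ) < (testPoint ε i : ℕ) := by
            exact_mod_cast (by omega : 0 < testPoint ε i)
          have hq := sqrt_le_rpow hx
          calc D * ((testPoint ε i : ℕ) : ℝ) ^ (-(1 / 4) : ℝ)
              ≤ (c * (16 * ((testPoint ε i : ℕ) : ℝ) ^ (1 / 8 : ℝ))) *
                  ((testPoint ε i : ℕ) : ℝ) ^ (-(1 / 4) : ℝ) := by
                gcongr; exact hDn.trans (by gcongr)
            _ = c * 16 * ((testPoint ε i : ℕ) : ℝ) ^ (-(1 / 8) : ℝ) := by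
                rw [show (-(1 / 8) : ℝ) = 1 / 8 + -(1 / 4) by norm_num, Real.rpow_add hx0]; ring
            _ ≤ c * 16 * (2 * Real.exp (-(1 / 8) * (i : ℝ) ^ ε)) := by
                gcongr; exact testPoint_rpow_le i
            _ = _ := by ring
        refine (Finset.sum_le_sum hle).trans ?_
        rw [← Finset.mul_sum]
        gcongr
        exact hsum.sum_le_tsum I (fun i _ => (Real.exp_pos _).le)
      calc 12 * D / T * ∑ i ∈ I, ((testPoint ε i : ℕ) : ℝ) ^ (-(1 / 4) : ℝ)
          = 12 * (1 / T) * (D * ∑ i ∈ I, ((testPoint ε i : ℕ) : ℝ) ^ (-(1 / 4) : ℝ)) := by ring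
        _ ≤ 12 * τ * (32 * c * S) :=
          mul_le_mul (by linarith) hs1 (by positivity) (by positivity)
        _ = _ := by ring
    have hfirst : 0 ≤ (D / T) ^ (4 / ε) * (2 : ℝ) ^ (-((ℓ : ℝ) ^ K) / ε) := by positivity
    have : C * τ ≤ C * ((D / T) ^ (4 / ε) * (2 : ℝ) ^ (-((ℓ : ℝ) ^ K) / ε) + τ) := by
      exact mul_le_mul_of_nonneg_left (by linarith) hCpos.le
    refine le_trans ?_ this
    rw [hC]; linarith
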